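/- Define nextprime(n) = min{p > n : p prime}, f(n) = nextprime(n) − n − 1, and R(n) = min{k ≥ 0 : f^k(n) ∈ {0,1}} (well-defined since f(n) < n for all n > 1 by Bertrand's postulate). Then R(n) = O(log log n), i.e. there exist constants C and N₀ such that R(n) ≤ C·log log n for all n ≥ N₀. -/

import Mathlib

/-- `nextprime n` is the smallest prime strictly greater than `n`. -/
def nextprime (n : ℕ) : ℕ := Nat.find (Nat.exists_infinite_primes (n + 1))

/-- `f n = nextprime n - n - 1`. -/
def fstep (n : ℕ) : ℕ := nextprime n - n - 1

/-- `R n` is the least `k` such that the `k`-th iterate of `f` applied to `n`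
lies in `{0, 1}`. -/
noncomputable def Rsteps (n : ℕ) : ℕ :=
  sInf {k : ℕ | fstep^[k] n = 0 ∨ fstep^[k] n = 1}

namespace Rarefaction

open Finset ArithmeticFunction
open scoped ArithmeticFunction.Moebius ArithmeticFunction.zeta

/-- The natural numbers in the half-open real interval `(a, x]`. -/
noncomputable def ivl (a x : ℝ) : Finset ℕ := Finset.Ioc ⌊a⌋₊ ⌊x⌋₊

lemma mem_ivl {a x : ℝ} (ha : 0 ≤ a) {n : ℕ} :
    n ∈ ivl a x ↔ a < n ∧ (n : ℝ) ≤ x := by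
  rw [ivl, Finset.mem_Ioc, Nat.floor_lt ha]
  refine and_congr_right fun h => ?_
  rcases le_or_gt 0 x with hx | hx
  · rw [Nat.le_floor_iff hx]
  · have h1 : (0 : ℝ) < n := lt_of_le_of_lt ha h
    have h2 : 0 < n := by exact_mod_cast h1
    rw [Nat.floor_of_nonpos hx.le]
    constructor
    · intro h3; omega
    · intro h3; linarith

lemma pos_of_mem_ivl {a x : ℝ} {n : ℕ} (h : n ∈ ivl a x) : 0 < n := by
  rw [ivl, Finset.mem_Ioc] at h; omega

lemma ivl_mono_left {a b x : ℝ} (h : a ≤ b) : ivl b x ⊆ ivl a x := by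
  intro n hn
  rw [ivl, Finset.mem_Ioc] at hn ⊢
  exact ⟨lt_of_le_of_lt (Nat.floor_mono h) hn.1, hn.2⟩

lemma ivl_mono_right {a x y : ℝ} (h : x ≤ y) : ivl a x ⊆ ivl a y := by
  intro n hn
  rw [ivl, Finset.mem_Ioc] at hn ⊢
  exact ⟨hn.1, hn.2.trans (Nat.floor_mono h)⟩

/-- Sum over the multiples of `d` in an interval. -/
lemma sum_ivl_dvd {a x : ℝ} (ha : 0 ≤ a) {d : ℕ} (hd : 0 < d) (g : ℕ → ℝ) :
    ∑ n ∈ ivl a x with d ∣ n, g n = ∑ k ∈ ivl (a / d) (x / d), g (d * k) := by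
  have hd' : (0 : ℝ) < d := by exact_mod_cast hd
  symm
  refine Finset.sum_bij' (fun k _ => d * k) (fun n _ => n / d) ?_ ?_ ?_ ?_ ?_
  · intro k hk
    rw [mem_ivl (by positivity)] at hk
    rw [Finset.mem_filter, mem_ivl ha]
    refine ⟨⟨?_, ?_⟩, Dvd.intro k rfl⟩
    · have := (div_lt_iff₀ hd').1 hk.1; push_cast; linarith
    · have := (le_div_iff₀ hd').1 hk.2; push_cast; linarith
  · intro n hn
    rw [Finset.mem_filter, mem_ivl ha] at hn
    obtain ⟨⟨h1, h2⟩, k, rfl⟩ := hn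
    rw [Nat.mul_div_cancel_left _ hd, mem_ivl (by positivity)]
    push_cast at h1 h2
    exact ⟨(div_lt_iff₀ hd').2 (by linarith), (le_div_iff₀ hd').2 (by linarith)⟩
  · intro k _
    exact Nat.mul_div_cancel_left _ hd
  · intro n hn
    rw [Finset.mem_filter] at hn
    exact Nat.mul_div_cancel' hn.2
  · intro k _; rfl

/-- Interchange of summation over `n` in an interval and over the divisors of `n`. -/
lemma sum_ivl_divisors {a x : ℝ} (ha : 0 ≤ a) (h : ℕ → ℕ → ℝ) :
    ∑ n ∈ ivl a x, ∑ d ∈ n.divisors, h d (n / d) =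
      ∑ d ∈ ivl 0 x, ∑ k ∈ ivl (a / d) (x / d), h d k := by
  have h1 : ∀ n ∈ ivl a x, ∑ d ∈ n.divisors, h d (n / d) =
      ∑ d ∈ ivl 0 x with d ∣ n, h d (n / d) := by
    intro n hn
    refine Finset.sum_congr ?_ fun _ _ => rfl
    ext d
    rw [Nat.mem_divisors, Finset.mem_filter]
    have hn0 := pos_of_mem_ivl hn
    rw [ivl, Finset.mem_Ioc] at *
    constructor
    · rintro ⟨h3, h4⟩
      refine ⟨⟨?_, ?_⟩, h3⟩
      · simpa using Nat.pos_of_dvd_of_pos h3 hn0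
      · exact (Nat.le_of_dvd hn0 h3).trans hn.2
    · rintro ⟨h3, h4⟩
      exact ⟨h4, hn0.ne'⟩
  rw [Finset.sum_congr rfl h1]
  simp_rw [Finset.sum_filter]
  rw [Finset.sum_comm]
  refine Finset.sum_congr rfl fun d hd => ?_
  have hd0 := pos_of_mem_ivl hd
  rw [← Finset.sum_filter, sum_ivl_dvd ha hd0]
  refine Finset.sum_congr rfl fun k _ => ?_
  rw [Nat.mul_div_cancel_left _ hd0]

/-- Möbius inversion in the form used for weighted sums. -/
lemma sum_moebius_inversion {y : ℝ} (hy : 1 ≤ y) (F : ℝ → ℝ) :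
    ∑ d ∈ ivl 0 y, (μ d : ℝ) / d * ∑ k ∈ ivl 0 (y / d), 1 / (k : ℝ) * F (y / d / k) = F y := by
  have h := sum_ivl_divisors (a := 0) (x := y) le_rfl
    (fun d k => (μ d : ℝ) / d * (1 / (k : ℝ) * F (y / d / k)))
  simp only [zero_div, ← Finset.mul_sum] at h
  rw [← h]
  have h2 : ∀ n ∈ ivl 0 y, ∑ d ∈ n.divisors,
      (μ d : ℝ) / d * (1 / ((n / d : ℕ) : ℝ) * F (y / d / ((n / d : ℕ) : ℝ))) =
      if n = 1 then F y else 0 := by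
    intro n hn
    have hn0 := pos_of_mem_ivl hn
    have h3 : ∀ d ∈ n.divisors,
        (μ d : ℝ) / d * (1 / ((n / d : ℕ) : ℝ) * F (y / d / ((n / d : ℕ) : ℝ))) =
        (μ d : ℝ) * (1 / n * F (y / n)) := by
      intro d hd
      have hdn := Nat.dvd_of_mem_divisors hd
      have hd0 : (d : ℝ) ≠ 0 := by
        have := Nat.pos_of_mem_divisors hd
        positivity
      have hn0' : (n : ℝ) ≠ 0 := by positivity
      rw [Nat.cast_div hdn hd0]
      rw [div_div, mul_div_cancel₀ _ hd0]
      field_simp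
    rw [Finset.sum_congr rfl h3, ← Finset.sum_mul]
    have h4 : ∑ d ∈ n.divisors, (μ d : ℝ) = if n = 1 then 1 else 0 := by
      have h5 := congrArg (fun f : ArithmeticFunction ℝ => f n)
        (coe_moebius_mul_coe_zeta (R := ℝ))
      beta_reduce at h5
      rw [coe_mul_zeta_apply, one_apply] at h5
      simpa only [intCoe_apply] using h5
    rw [h4]
    split_ifs with h5
    · subst h5; simp
    · simp
  rw [Finset.sum_congr rfl h2, Finset.sum_ite_eq' (ivl 0 y) 1, if_pos]
  rw [mem_ivl le_rfl]; simpa using hy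

lemma card_ivl_zero_le {y : ℝ} (hy : 0 ≤ y) : ((ivl 0 y).card : ℝ) ≤ y := by
  rw [ivl, Nat.card_Ioc, Nat.floor_zero, Nat.sub_zero]
  exact Nat.floor_le hy

/-- The harmonic sum over positive integers up to a real number. -/
noncomputable def harm (y : ℝ) : ℝ := ∑ k ∈ ivl 0 y, 1 / (k : ℝ)

lemma harm_eq (y : ℝ) : harm y = (harmonic ⌊y⌋₊ : ℝ) := by
  rw [harm, ivl, harmonic_eq_sum_Icc, Nat.floor_zero]
  push_cast
  simp only [one_div]
  rfl

lemma abs_harm_sub_le {y : ℝ} (hy : 0 < y) :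
    |harm y - Real.log y - Real.eulerMascheroniConstant| ≤ 2 / y := by
  have hγ1 := Real.one_half_lt_eulerMascheroniConstant
  have hγ2 := Real.eulerMascheroniConstant_lt_two_thirds
  rw [harm_eq]
  rcases lt_or_ge y 1 with h | h
  · rw [Nat.floor_eq_zero.2 h]
    have h1 : Real.log y ≤ 0 := Real.log_nonpos hy.le h.le
    have h2 := Real.log_le_sub_one_of_pos (x := y⁻¹) (by positivity)
    rw [Real.log_inv] at h2
    have h3 : 1 ≤ y⁻¹ := (one_le_inv₀ hy).2 h.le
    rw [div_eq_mul_inv, abs_le]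
    constructor <;> simp <;> linarith
  · set N := ⌊y⌋₊ with hN
    have hN1 : 1 ≤ N := Nat.le_floor (by simpa using h)
    have hNpos : (0 : ℝ) < N := by exact_mod_cast hN1
    have hle : (N : ℝ) ≤ y := Nat.floor_le hy.le
    have hlt : y < N + 1 := Nat.lt_floor_add_one y
    have h1 := Real.eulerMascheroniSeq_lt_eulerMascheroniConstant N
    have h2 := Real.eulerMascheroniConstant_lt_eulerMascheroniSeq' N
    rw [Real.eulerMascheroniSeq] at h1
    rw [Real.eulerMascheroniSeq', if_neg (by omega)] at h2
    have h3 : Real.log N ≤ Real.log y := Real.log_le_log hNpos hle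
    have h4 : Real.log y ≤ Real.log (N + 1) := Real.log_le_log hy hlt.le
    have h5 : Real.log (N + 1) - Real.log N ≤ 1 / N := by
      rw [← Real.log_div (by positivity) (by positivity)]
      have := Real.log_le_sub_one_of_pos (x := ((N : ℝ) + 1) / N) (by positivity)
      have h6 : ((N : ℝ) + 1) / N - 1 = 1 / N := by field_simp; ring
      linarith
    have h6 : 1 / (N : ℝ) ≤ 2 / y := by
      rw [div_le_div_iff₀ hNpos hy]
      have : (1 : ℝ) ≤ N := by exact_mod_cast hN1
      linarith
    rw [abs_le]
    constructor <;> linarith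

/-- Multiplicative windows carry harmonic mass equal to their logarithmic length. -/
lemma abs_sum_window_le {ε x : ℝ} (hε : 0 ≤ ε) (hε1 : ε ≤ 1) (hx : 0 < x) :
    |∑ k ∈ ivl (x * Real.exp (-ε)) x, 1 / (k : ℝ) - ε| ≤ 8 / x := by
  have he : 0 < x * Real.exp (-ε) := by positivity
  have hle : x * Real.exp (-ε) ≤ x := by
    have : Real.exp (-ε) ≤ 1 := Real.exp_le_one_iff.2 (by linarith)
    nlinarith
  have h1 : ∑ k ∈ ivl (x * Real.exp (-ε)) x, 1 / (k : ℝ) =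
      harm x - harm (x * Real.exp (-ε)) := by
    rw [eq_sub_iff_add_eq, add_comm, harm, harm, ivl, ivl, ivl,
      ← Finset.sum_union]
    · rw [Finset.Ioc_union_Ioc_eq_Ioc (Nat.floor_mono he.le) (Nat.floor_mono hle)]
    · rw [Finset.disjoint_left]
      intro n h2 h3
      rw [Finset.mem_Ioc] at h2 h3
      omega
  have h2 := abs_harm_sub_le hx
  have h3 := abs_harm_sub_le he
  rw [Real.log_mul hx.ne' (Real.exp_pos _).ne', Real.log_exp] at h3
  have h4 : 2 / (x * Real.exp (-ε)) ≤ 6 / x := by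
    rw [div_le_div_iff₀ he hx]
    have h5 : (1 : ℝ) / 3 ≤ Real.exp (-ε) := by
      have h6 : Real.exp 1 ≤ 3 := (Real.exp_one_lt_d9.trans (by norm_num)).le
      have h7 : Real.exp ε ≤ 3 := (Real.exp_le_exp.2 hε1).trans h6
      rw [Real.exp_neg, one_div]
      exact inv_anti₀ (Real.exp_pos _) h7
    nlinarith
  have h8 : 8 / x = 2 / x + 6 / x := by ring
  rw [h1, h8]
  rw [abs_le] at *
  constructor <;> linarith [h2.1, h2.2, h3.1, h3.2]

lemma sum_one_div_mul_div_le {y : ℝ} (hy : 0 < y) (c : ℝ) (hc : 0 ≤ c) :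
    ∑ d ∈ ivl 0 y, |(μ d : ℝ) / d| * (c * (d / y)) ≤ c := by
  have h1 : ∀ d ∈ ivl 0 y, |(μ d : ℝ) / d| * (c * (d / y)) ≤ c / y := by
    intro d hd
    have hd0 : (0 : ℝ) < d := by exact_mod_cast pos_of_mem_ivl hd
    have h2 : |(μ d : ℝ)| ≤ 1 := by exact_mod_cast abs_moebius_le_one
    rw [abs_div, abs_of_pos hd0]
    have h3 : |(μ d : ℝ)| / d * (c * (d / y)) = |(μ d : ℝ)| * (c / y) := by
      field_simp
    rw [h3]
    exact mul_le_of_le_one_left (by positivity) h2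
  refine (Finset.sum_le_sum h1).trans ?_
  rw [Finset.sum_const, nsmul_eq_mul]
  have := card_ivl_zero_le hy.le
  calc ((ivl 0 y).card : ℝ) * (c / y) ≤ y * (c / y) := by gcongr
    _ = c := by field_simp

/-- The sums `∑_{d ≤ y} μ(d) / d * log (y / d) ^ j`. -/
noncomputable def moebLog (j : ℕ) (y : ℝ) : ℝ :=
  ∑ d ∈ ivl 0 y, (μ d : ℝ) / d * Real.log (y / d) ^ j

lemma abs_moebLog_zero_le (y : ℝ) : |moebLog 0 y| ≤ 2 := by
  rcases lt_or_ge y 1 with h | h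
  · have : ivl 0 y = ∅ := by
      rw [ivl, Nat.floor_eq_zero.2 h]; simp
    simp [moebLog, this]
  set N := ⌊y⌋₊ with hN
  have hN1 : 1 ≤ N := Nat.le_floor (by simpa using h)
  have hNpos : (0 : ℝ) < N := by exact_mod_cast hN1
  have h1 : ∑ d ∈ Finset.Ioc 0 N, (μ d : ℝ) * ((N / d : ℕ) : ℝ) = 1 := by
    have h2 := sum_Ioc_mul_zeta_eq_sum (μ : ArithmeticFunction ℝ) N
    rw [coe_moebius_mul_coe_zeta] at h2
    simp only [one_apply, intCoe_apply] at h2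
    rw [← h2, Finset.sum_ite_eq' _ 1, if_pos (by simp; omega)]
  have h3 : moebLog 0 y * N - 1 =
      ∑ d ∈ Finset.Ioc 0 N, (μ d : ℝ) * ((N : ℝ) / d - ((N / d : ℕ) : ℝ)) := by
    rw [← h1, moebLog, ivl, Nat.floor_zero, Finset.sum_mul, ← Finset.sum_sub_distrib]
    refine Finset.sum_congr rfl fun d _ => ?_
    ring
  have h4 : |moebLog 0 y * N - 1| ≤ N := by
    rw [h3]
    refine (Finset.abs_sum_le_sum_abs _ _).trans ?_
    calc _ ≤ ∑ d ∈ Finset.Ioc 0 N, (1 : ℝ) := by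
          refine Finset.sum_le_sum fun d hd => ?_
          have hd0 : 0 < d := (Finset.mem_Ioc.1 hd).1
          have hd0' : (0 : ℝ) < d := by exact_mod_cast hd0
          have h2 : |(μ d : ℝ)| ≤ 1 := by exact_mod_cast abs_moebius_le_one
          have h5 : |(N : ℝ) / d - ((N / d : ℕ) : ℝ)| ≤ 1 := by
            have h6 : ((N / d : ℕ) : ℝ) ≤ (N : ℝ) / d := Nat.cast_div_le
            have h7 : (N : ℝ) / d < ((N / d : ℕ) : ℝ) + 1 := by
              rw [div_lt_iff₀ hd0']
              have := Nat.lt_div_mul_add (a := N) hd0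
              have h8 : N < (N / d + 1) * d := by
                rw [add_mul, one_mul]; exact this
              exact_mod_cast h8
            rw [abs_le]; constructor <;> linarith
          rw [abs_mul]
          exact mul_le_one₀ h2 (abs_nonneg _) h5
      _ = N := by simp
  have h5 : |moebLog 0 y| * N ≤ 2 * N := by
    rw [← abs_of_pos hNpos, ← abs_mul, abs_of_pos hNpos]
    have h6 : (1 : ℝ) ≤ N := by exact_mod_cast hN1
    rw [abs_le] at *
    constructor <;> linarith
  exact le_of_mul_le_mul_right h5 hNpos

lemma abs_moebLog_one_le {y : ℝ} (hy : 1 ≤ y) : |moebLog 1 y| ≤ 5 := by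
  have hγ1 := Real.one_half_lt_eulerMascheroniConstant
  have hγ2 := Real.eulerMascheroniConstant_lt_two_thirds
  set γ := Real.eulerMascheroniConstant
  have h1 := sum_moebius_inversion hy (fun _ => 1)
  simp only [mul_one] at h1
  have h2 : 1 - moebLog 1 y - γ * moebLog 0 y = ∑ d ∈ ivl 0 y, (μ d : ℝ) / d *
      (harm (y / d) - Real.log (y / d) - γ) := by
    rw [← h1, moebLog, moebLog, Finset.mul_sum, ← Finset.sum_sub_distrib, ← Finset.sum_sub_distrib]
    refine Finset.sum_congr rfl fun d _ => ?_
    rw [harm]; ring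
  have h3 : |1 - moebLog 1 y - γ * moebLog 0 y| ≤ 2 := by
    rw [h2]
    refine (Finset.abs_sum_le_sum_abs _ _).trans
      (le_trans ?_ (sum_one_div_mul_div_le (y := y) (by linarith) 2 (by norm_num)))
    refine Finset.sum_le_sum fun d hd => ?_
    have hd0 : (0 : ℝ) < d := by exact_mod_cast pos_of_mem_ivl hd
    rw [abs_mul]
    gcongr
    refine (abs_harm_sub_le (y := y / d) (by positivity)).trans (le_of_eq ?_)
    field_simp
  have h4 := abs_moebLog_zero_le y
  have h5 : |γ * moebLog 0 y| ≤ 2 := by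
    rw [abs_mul, abs_of_pos (by linarith)]; nlinarith [abs_nonneg (moebLog 0 y)]
  rw [abs_le] at *
  constructor <;> linarith

lemma hasDerivWithinAt_max_sub (c w : ℝ) :
    HasDerivWithinAt (fun u => max (u - c) 0) (if c ≤ w then 1 else 0) (Set.Ici w) w := by
  split_ifs with h
  · refine ((hasDerivWithinAt_id w _).sub_const c).congr (fun u hu => ?_) ?_
    · have : w ≤ u := hu
      simp; linarith
    · simp; linarith
  · push Not at h
    refine (HasDerivAt.congr_of_eventuallyEq (hasDerivAt_const w (0 : ℝ)) ?_).hasDerivWithinAt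
    filter_upwards [eventually_lt_nhds h] with u hu
    simp; linarith

lemma hasDerivAt_max_sub_pow (n : ℕ) (c w : ℝ) :
    HasDerivAt (fun u => max (u - c) 0 ^ (n + 2)) ((n + 2) * max (w - c) 0 ^ (n + 1)) w := by
  rcases lt_trichotomy w c with h | h | h
  · have h1 : max (w - c) 0 = 0 := by simp; linarith
    rw [h1]
    simp only [ne_eq, Nat.add_eq_zero_iff, one_ne_zero, and_false, not_false_eq_true, zero_pow,
      mul_zero]
    refine HasDerivAt.congr_of_eventuallyEq (hasDerivAt_const w (0 : ℝ)) ?_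
    filter_upwards [eventually_lt_nhds h] with u hu
    rw [max_eq_right (by linarith)]; simp
  · subst h
    simp only [sub_self, max_self, ne_eq, Nat.add_eq_zero_iff, one_ne_zero, and_false,
      not_false_eq_true, zero_pow, mul_zero]
    rw [hasDerivAt_iff_isLittleO]
    simp only [sub_self, max_self, smul_zero, sub_zero, ne_eq, Nat.add_eq_zero_iff,
      OfNat.ofNat_ne_zero, and_false, not_false_eq_true, zero_pow]
    have h1 : (fun u : ℝ => max (u - w) 0 ^ (n + 2)) =O[nhds w] (fun u => (u - w) ^ (n + 2)) := by
      refine Asymptotics.IsBigO.of_bound 1 (Filter.Eventually.of_forall fun u => ?_)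
      rw [one_mul, norm_pow, norm_pow]
      gcongr
      rw [Real.norm_eq_abs, Real.norm_eq_abs, abs_of_nonneg (le_max_right _ _)]
      exact max_le (le_abs_self _) (abs_nonneg _)
    refine h1.trans_isLittleO ?_
    have h2 : (fun x : ℝ => x ^ (n + 2)) =o[nhds 0] fun x : ℝ => x ^ 1 :=
      Asymptotics.isLittleO_pow_pow (by omega)
    have h3 : Filter.Tendsto (fun u : ℝ => u - w) (nhds w) (nhds 0) := by
      have : Filter.Tendsto (fun u : ℝ => u - w) (nhds w) (nhds (w - w)) :=
        (continuous_id.sub continuous_const).tendsto w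
      simpa using this
    simpa [Function.comp_def] using h2.comp_tendsto h3
  · have h1 : max (w - c) 0 = w - c := by simp; linarith
    rw [h1]
    have h2 : HasDerivAt (fun u => (u - c) ^ (n + 2)) ((n + 2) * (w - c) ^ (n + 1)) w := by
      simpa using ((hasDerivAt_id w).sub_const c).fun_pow (n + 2)
    refine HasDerivAt.congr_of_eventuallyEq h2 ?_
    filter_upwards [eventually_gt_nhds h] with u hu
    rw [max_eq_left (by linarith)]

/-- Sums against truncated logarithms only see the terms up to the truncation. -/
lemma sum_mul_max_pow_eq {X w : ℝ} (hw : Real.exp w ≤ X) (c : ℕ → ℝ) (j : ℕ) :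
    ∑ d ∈ ivl 0 X, c d * max (w - Real.log d) 0 ^ (j + 1) =
      ∑ d ∈ ivl 0 (Real.exp w), c d * Real.log (Real.exp w / d) ^ (j + 1) := by
  rw [← Finset.sum_subset (ivl_mono_right hw)]
  · refine Finset.sum_congr rfl fun d hd => ?_
    have hd0 : (0 : ℝ) < d := by exact_mod_cast pos_of_mem_ivl hd
    rw [mem_ivl le_rfl] at hd
    rw [Real.log_div (Real.exp_pos w).ne' hd0.ne', Real.log_exp, max_eq_left]
    have := Real.log_le_log hd0 hd.2
    rw [Real.log_exp] at this
    linarith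
  · intro d hd hd'
    have hd0 : (0 : ℝ) < d := by exact_mod_cast pos_of_mem_ivl hd
    rw [mem_ivl le_rfl] at hd'
    have h1 : Real.exp w < d := by
      by_contra h; push Not at h; exact hd' ⟨hd0, h⟩
    have := Real.log_lt_log (Real.exp_pos w) h1
    rw [Real.log_exp] at this
    rw [max_eq_right (by linarith)]
    simp

/-- The remainder in `∑_{k ≤ y} log (y / k) / k = log² y / 2 + γ log y + …`. -/
noncomputable def harmLogErr (y : ℝ) : ℝ :=
  ∑ k ∈ ivl 0 y, 1 / (k : ℝ) * Real.log (y / k) - Real.log y ^ 2 / 2 -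
    Real.eulerMascheroniConstant * Real.log y

lemma harmLogErr_one : harmLogErr 1 = 0 := by
  have : ivl 0 1 = {1} := by
    ext n
    rw [mem_ivl le_rfl]
    constructor
    · rintro ⟨h1, h2⟩
      have h1' : 0 < n := by exact_mod_cast h1
      have h2' : n ≤ 1 := by exact_mod_cast h2
      simp; omega
    · intro h; simp at h; subst h; norm_num
  simp [harmLogErr, this]

lemma abs_harmLogErr_sub_le {y y' : ℝ} (hy : 1 ≤ y) (hyy : y ≤ y') :
    |harmLogErr y' - harmLogErr y| ≤ 2 / y := by
  set γ := Real.eulerMascheroniConstant with hγ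
  set S : ℝ → ℝ := fun w => ∑ k ∈ ivl 0 y', 1 / (k : ℝ) * max (w - Real.log k) 0 with hS
  have hpos : 0 < y := by linarith
  have hpos' : 0 < y' := by linarith
  have hE : ∀ u, 0 < u → u ≤ y' → harmLogErr u =
      S (Real.log u) - Real.log u ^ 2 / 2 - γ * Real.log u := by
    intro u hu huy
    have h1 := sum_mul_max_pow_eq (X := y') (w := Real.log u) (by rwa [Real.exp_log hu])
      (fun k => 1 / (k : ℝ)) 0
    rw [Real.exp_log hu] at h1
    simp only [zero_add, pow_one] at h1
    rw [harmLogErr, hS]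
    simp only
    rw [h1]
  set a := Real.log y with ha
  set b := Real.log y' with hb
  have hab : a ≤ b := Real.log_le_log hpos hyy
  set g : ℝ → ℝ := fun w => (S w - w ^ 2 / 2 - γ * w) - (S a - a ^ 2 / 2 - γ * a) with hg
  have key : ∀ ⦃x⦄, x ∈ Set.Icc a b → ‖g x‖ ≤ 2 * Real.exp (-a) - 2 * Real.exp (-x) := by
    refine image_norm_le_of_norm_deriv_right_le_deriv_boundary'
      (f' := fun w => harm (Real.exp w) - w - γ) (B' := fun x => 2 * Real.exp (-x))
      ?_ ?_ ?_ ?_ ?_ ?_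
    · refine Continuous.continuousOn ?_
      simp only [hg, hS]
      fun_prop
    · intro w hw
      have hsum : HasDerivWithinAt S (∑ k ∈ ivl 0 y', 1 / (k : ℝ) *
          (if Real.log k ≤ w then 1 else 0)) (Set.Ici w) w :=
        HasDerivWithinAt.fun_sum fun k _ => (hasDerivWithinAt_max_sub _ w).const_mul _
      have hh : ∑ k ∈ ivl 0 y', 1 / (k : ℝ) * (if Real.log k ≤ w then 1 else 0) =
          harm (Real.exp w) := by
        have hwy : Real.exp w ≤ y' := by
          rw [← Real.exp_log hpos']; exact Real.exp_le_exp.2 hw.2.le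
        rw [harm, ← Finset.sum_subset (ivl_mono_right hwy)]
        · refine Finset.sum_congr rfl fun d hd => ?_
          have hd0 : (0 : ℝ) < d := by exact_mod_cast pos_of_mem_ivl hd
          rw [mem_ivl le_rfl] at hd
          rw [if_pos, mul_one]
          rw [Real.log_le_iff_le_exp hd0]; exact hd.2
        · intro d hd hd'
          have hd0 : (0 : ℝ) < d := by exact_mod_cast pos_of_mem_ivl hd
          rw [if_neg, mul_zero]
          intro h
          rw [Real.log_le_iff_le_exp hd0] at h
          exact hd' ((mem_ivl le_rfl).2 ⟨hd0, h⟩)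
      rw [hh] at hsum
      have h2 : HasDerivWithinAt (fun w : ℝ => w ^ 2 / 2) w (Set.Ici w) w := by
        exact (((hasDerivAt_pow 2 w).div_const 2).hasDerivWithinAt).congr_deriv (by simp)
      have h3 : HasDerivWithinAt (fun w : ℝ => γ * w) γ (Set.Ici w) w := by
        simpa using ((hasDerivAt_id w).const_mul γ).hasDerivWithinAt (s := Set.Ici w)
      exact ((hsum.sub h2).sub h3).sub_const _
    · simp [hg]
    · exact Continuous.continuousOn (by fun_prop)
    · intro x _
      have h1 : HasDerivAt (fun x : ℝ => Real.exp (-x)) (-Real.exp (-x)) x := by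
        simpa using (hasDerivAt_neg x).exp
      have h2 := ((h1.const_mul 2).const_sub (2 * Real.exp (-a))).hasDerivWithinAt
        (s := Set.Ici x)
      exact h2.congr_deriv (by ring)
    · intro x _
      have := abs_harm_sub_le (Real.exp_pos x)
      rw [Real.log_exp] at this
      rw [Real.norm_eq_abs, Real.exp_neg]
      exact this
  have h1 := key (Set.right_mem_Icc.2 hab)
  rw [hE y hpos hyy, hE y' hpos' le_rfl]
  rw [Real.norm_eq_abs] at h1
  refine h1.trans ?_
  rw [Real.exp_neg, ha, Real.exp_log hpos, div_eq_mul_inv]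
  have := Real.exp_pos (-b)
  linarith

lemma abs_moebLog_two_sub_le {y : ℝ} (hy : 1 ≤ y) : |moebLog 2 y - 2 * Real.log y| ≤ 20 := by
  have hγ1 := Real.one_half_lt_eulerMascheroniConstant
  have hγ2 := Real.eulerMascheroniConstant_lt_two_thirds
  set γ := Real.eulerMascheroniConstant
  have h1 := sum_moebius_inversion hy Real.log
  have h2 : Real.log y - moebLog 2 y / 2 - γ * moebLog 1 y - harmLogErr y * moebLog 0 y =
      ∑ d ∈ ivl 0 y, (μ d : ℝ) / d * (harmLogErr (y / d) - harmLogErr y) := by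
    rw [← h1, moebLog, moebLog, moebLog, Finset.mul_sum, Finset.mul_sum, Finset.sum_div,
      ← Finset.sum_sub_distrib, ← Finset.sum_sub_distrib, ← Finset.sum_sub_distrib]
    refine Finset.sum_congr rfl fun d _ => ?_
    rw [harmLogErr.eq_def (y / d)]; ring
  have h3 : |Real.log y - moebLog 2 y / 2 - γ * moebLog 1 y - harmLogErr y * moebLog 0 y|
      ≤ 2 := by
    rw [h2]
    refine (Finset.abs_sum_le_sum_abs _ _).trans
      (le_trans ?_ (sum_one_div_mul_div_le (y := y) (by linarith) 2 (by norm_num)))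
    refine Finset.sum_le_sum fun d hd => ?_
    have hd0 : (0 : ℝ) < d := by exact_mod_cast pos_of_mem_ivl hd
    have hd1 : (1 : ℝ) ≤ d := by exact_mod_cast pos_of_mem_ivl hd
    rw [mem_ivl le_rfl] at hd
    rw [abs_mul]
    gcongr
    rw [abs_sub_comm]
    refine (abs_harmLogErr_sub_le (y := y / d) ((one_le_div hd0).2 hd.2) ?_).trans (le_of_eq ?_)
    · exact div_le_self (by linarith) hd1
    · field_simp
  have h4 := abs_moebLog_zero_le y
  have h4' := abs_moebLog_one_le hy
  have h6 : |harmLogErr y| ≤ 2 := by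
    have := abs_harmLogErr_sub_le le_rfl hy
    rw [harmLogErr_one] at this
    simpa using this
  have h5 : |γ * moebLog 1 y| ≤ 4 := by
    rw [abs_mul, abs_of_pos (by linarith)]; nlinarith [abs_nonneg (moebLog 1 y)]
  have h7 : |harmLogErr y * moebLog 0 y| ≤ 4 := by
    rw [abs_mul]; nlinarith [abs_nonneg (moebLog 0 y), abs_nonneg (harmLogErr y)]
  rw [abs_le] at *
  constructor <;> linarith

/-- The smoothed Möbius sum `∑ μ(d) / d * (w - log d)₊³`. -/
noncomputable def moebCube (X w : ℝ) : ℝ :=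
  ∑ d ∈ ivl 0 X, (μ d : ℝ) / d * max (w - Real.log d) 0 ^ 3

lemma abs_moebCube_sub_le {X w₁ w₂ : ℝ} (h0 : 0 ≤ w₁) (h12 : w₁ ≤ w₂) (hX : Real.exp w₂ ≤ X) :
    |moebCube X w₂ - moebCube X w₁ - 3 * (w₂ ^ 2 - w₁ ^ 2)| ≤ 60 * (w₂ - w₁) := by
  have h1 : ∀ w ∈ Set.Icc w₁ w₂, HasDerivWithinAt (fun w => moebCube X w - 3 * w ^ 2)
      (3 * (moebLog 2 (Real.exp w) - 2 * w)) (Set.Icc w₁ w₂) w := by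
    intro w hw
    have h2 : HasDerivAt (fun w => moebCube X w)
        (∑ d ∈ ivl 0 X, (μ d : ℝ) / d * (((1 : ℕ) + 2) * max (w - Real.log d) 0 ^ (1 + 1))) w :=
      HasDerivAt.fun_sum fun d _ => (hasDerivAt_max_sub_pow 1 (Real.log d) w).const_mul _
    have h3 : ∑ d ∈ ivl 0 X, (μ d : ℝ) / d *
        (((1 : ℕ) + 2) * max (w - Real.log d) 0 ^ (1 + 1)) = 3 * moebLog 2 (Real.exp w) := by
      have h4 := sum_mul_max_pow_eq (X := X) (w := w)
        ((Real.exp_le_exp.2 hw.2).trans hX) (fun d => (μ d : ℝ) / d) 1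
      rw [moebLog, ← h4, Finset.mul_sum]
      refine Finset.sum_congr rfl fun d _ => ?_
      push_cast; ring
    rw [h3] at h2
    have h5 := (h2.sub ((hasDerivAt_pow 2 w).const_mul 3)).hasDerivWithinAt
      (s := Set.Icc w₁ w₂)
    exact h5.congr_deriv (by push_cast; ring)
  have h2 : ∀ w ∈ Set.Icc w₁ w₂, ‖3 * (moebLog 2 (Real.exp w) - 2 * w)‖ ≤ 60 := by
    intro w hw
    have := abs_moebLog_two_sub_le (y := Real.exp w) (Real.one_le_exp (h0.trans hw.1))
    rw [Real.log_exp] at this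
    rw [Real.norm_eq_abs, abs_mul, abs_of_pos (by norm_num : (0 : ℝ) < 3)]
    linarith
  have h3 := (convex_Icc w₁ w₂).norm_image_sub_le_of_norm_hasDerivWithin_le h1 h2
    (Set.left_mem_Icc.2 h12) (Set.right_mem_Icc.2 h12)
  rw [Real.norm_eq_abs, Real.norm_eq_abs, abs_of_nonneg (by linarith : 0 ≤ w₂ - w₁)] at h3
  refine le_trans (le_of_eq ?_) h3
  congr 1
  ring

lemma log_le_harm {y : ℝ} (hy : 1 ≤ y) : Real.log y ≤ harm y := by
  rw [harm_eq]
  exact log_le_harmonic_floor y (by linarith)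

lemma harm_le {y : ℝ} (hy : 1 ≤ y) : harm y ≤ 1 + Real.log y := by
  rw [harm_eq]
  exact harmonic_floor_le_one_add_log y hy

/-- The first theorem of Mertens for the von Mangoldt function. -/
lemma abs_sum_vonMangoldt_div_sub_log_le {x : ℝ} (hx : 1 ≤ x) :
    |∑ n ∈ ivl 0 x, Λ n / n - Real.log x| ≤ 6 := by
  set N := ⌊x⌋₊ with hN
  have hN1 : 1 ≤ N := Nat.le_floor (by simpa using hx)
  have hNpos : (0 : ℝ) < N := by exact_mod_cast hN1
  have hle : (N : ℝ) ≤ x := Nat.floor_le (by linarith)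
  have hlt : x < N + 1 := Nat.lt_floor_add_one x
  have hlog1 : Real.log N ≤ Real.log x := Real.log_le_log hNpos hle
  have hlog2 : Real.log x ≤ Real.log N + 1 := by
    have h1 : x ≤ N * Real.exp 1 := by
      have h2 : (1 : ℝ) ≤ N := by exact_mod_cast hN1
      have h3 := Real.add_one_le_exp 1
      nlinarith
    have h2 := Real.log_le_log (by linarith) h1
    rwa [Real.log_mul hNpos.ne' (Real.exp_pos 1).ne', Real.log_exp] at h2
  have hfac : Real.log (N.factorial) = ∑ n ∈ Finset.Ioc 0 N, Λ n * ((N / n : ℕ) : ℝ) := by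
    rw [← sum_Ioc_mul_zeta_eq_sum (Λ : ArithmeticFunction ℝ) N, vonMangoldt_mul_zeta]
    clear_value N
    clear hN hN1 hNpos hle hlt hlog1 hlog2
    induction N with
    | zero => simp
    | succ n ih =>
      rw [Nat.factorial_succ, Nat.cast_mul, Real.log_mul (by positivity) (by positivity), ih,
        Finset.sum_Ioc_succ_top (Nat.zero_le n), log_apply]
      ring
  have hup : Real.log (N.factorial) ≤ N * Real.log N := by
    rw [← Real.log_pow]
    refine Real.log_le_log (by positivity) ?_
    exact_mod_cast Nat.factorial_le_pow N
  have hlo : N * Real.log N - N ≤ Real.log (N.factorial) := by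
    have h1 := Real.pow_div_factorial_le_exp (N : ℝ) hNpos.le N
    have h2 := Real.log_le_log (by positivity) h1
    rw [Real.log_div (by positivity) (by positivity), Real.log_pow, Real.log_exp] at h2
    linarith
  have hS1 : Real.log (N.factorial) ≤ N * ∑ n ∈ ivl 0 x, Λ n / n := by
    rw [hfac, Finset.mul_sum, ivl, Nat.floor_zero]
    refine Finset.sum_le_sum fun n _ => ?_
    have : ((N / n : ℕ) : ℝ) ≤ (N : ℝ) / n := Nat.cast_div_le
    calc Λ n * ((N / n : ℕ) : ℝ) ≤ Λ n * ((N : ℝ) / n) :=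
          mul_le_mul_of_nonneg_left this vonMangoldt_nonneg
      _ = _ := by ring
  have hS2 : N * ∑ n ∈ ivl 0 x, Λ n / n ≤ Real.log (N.factorial) + 6 * N := by
    have h1 : N * ∑ n ∈ ivl 0 x, Λ n / n - Real.log (N.factorial) ≤ Chebyshev.psi N := by
      rw [hfac, Finset.mul_sum, ivl, Nat.floor_zero, Chebyshev.psi, Nat.floor_natCast,
        ← Finset.sum_sub_distrib]
      refine Finset.sum_le_sum fun n hn => ?_
      have hd0 : 0 < n := (Finset.mem_Ioc.1 hn).1
      have hd0' : (0 : ℝ) < n := by exact_mod_cast hd0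
      have h7 : (N : ℝ) / n < ((N / n : ℕ) : ℝ) + 1 := by
        rw [div_lt_iff₀ hd0']
        have := Nat.lt_div_mul_add (a := N) hd0
        have h8 : N < (N / n + 1) * n := by
          rw [add_mul, one_mul]; exact this
        exact_mod_cast h8
      calc N * (Λ n / n) - Λ n * ((N / n : ℕ) : ℝ) = Λ n * ((N : ℝ) / n - ((N / n : ℕ) : ℝ)) := by
            ring
        _ ≤ Λ n * 1 := mul_le_mul_of_nonneg_left (by linarith) vonMangoldt_nonneg
        _ = Λ n := mul_one _
    have h2 := Chebyshev.psi_le_const_mul_self hNpos.le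
    have h3 : Real.log 4 ≤ 2 := by
      have : (4 : ℝ) = 2 ^ 2 := by norm_num
      rw [this, Real.log_pow]
      have := Real.log_two_lt_d9
      norm_num; linarith
    nlinarith
  have h1 : Real.log N - 1 ≤ ∑ n ∈ ivl 0 x, Λ n / n := by
    refine le_of_mul_le_mul_left ?_ hNpos
    linarith
  have h2 : ∑ n ∈ ivl 0 x, Λ n / n ≤ Real.log N + 6 := by
    refine le_of_mul_le_mul_left ?_ hNpos
    linarith
  rw [abs_le]
  constructor <;> linarith

lemma sum_prime_log_div_le {q : ℝ} (hq : 1 ≤ q) :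
    ∑ p ∈ ivl 0 q with p.Prime, Real.log p / p ≤ Real.log q + 6 := by
  have h1 := abs_le.1 (abs_sum_vonMangoldt_div_sub_log_le hq)
  have h2 : ∑ p ∈ ivl 0 q with p.Prime, Real.log p / p ≤ ∑ n ∈ ivl 0 q, Λ n / n := by
    rw [Finset.sum_filter]
    refine Finset.sum_le_sum fun n _ => ?_
    split_ifs with h
    · rw [vonMangoldt_apply_prime h]
    · exact div_nonneg vonMangoldt_nonneg (Nat.cast_nonneg _)
  linarith [h1.2]

/-- All prime factors of `n` exceed `z`. -/
def Rough (z : ℝ) (n : ℕ) : Prop := ∀ p, p.Prime → p ∣ n → z < p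

noncomputable instance (z : ℝ) : DecidablePred (Rough z) := Classical.decPred _

/-- The normalising factor of the sieve weights. -/
noncomputable def sieveMass (z : ℝ) : ℝ := ∑ e ∈ ivl 0 z, (μ e : ℝ) ^ 2 / e

lemma log_le_two_mul_sieveMass {z : ℝ} (hz : 1 ≤ z) : Real.log z ≤ 2 * sieveMass z := by
  refine (log_le_harm hz).trans ?_
  have hsq : ∑ b ∈ ivl 0 z, 1 / (b : ℝ) ^ 2 ≤ 2 := by
    rw [ivl, Nat.floor_zero]
    have := sum_Ioc_inv_sq_le_sub (α := ℝ) (k := 1) (n := ⌊z⌋₊ ⊔ 1) one_ne_zero le_sup_right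
    have h2 : ∑ b ∈ Finset.Ioc 0 ⌊z⌋₊, 1 / (b : ℝ) ^ 2 ≤
        1 + ∑ b ∈ Finset.Ioc 1 (⌊z⌋₊ ⊔ 1), ((b : ℝ) ^ 2)⁻¹ := by
      have h3 : Finset.Ioc 0 ⌊z⌋₊ ⊆ insert 1 (Finset.Ioc 1 (⌊z⌋₊ ⊔ 1)) := by
        intro b hb
        simp only [Finset.mem_Ioc, Finset.mem_insert] at hb ⊢
        have := le_sup_left (a := ⌊z⌋₊) (b := 1)
        omega
      refine (Finset.sum_le_sum_of_subset_of_nonneg h3 fun i _ _ => by positivity).trans ?_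
      rw [Finset.sum_insert (by simp)]
      simp
    have h4 : (0 : ℝ) ≤ ((⌊z⌋₊ ⊔ 1 : ℕ) : ℝ)⁻¹ := by positivity
    push_cast at this h4
    norm_num at this
    linarith
  have hm : 0 ≤ sieveMass z := Finset.sum_nonneg fun e _ => by positivity
  have h1 : harm z ≤ (∑ b ∈ ivl 0 z, 1 / (b : ℝ) ^ 2) * sieveMass z := by
    rw [sieveMass, Finset.sum_mul_sum, ← Finset.sum_product', harm]
    choose a b hb using Nat.sq_mul_squarefree
    have h2 : ∀ n ∈ ivl 0 z, (b n, a n) ∈ ivl 0 z ×ˢ ivl 0 z ∧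
        1 / (n : ℝ) = 1 / (b n : ℝ) ^ 2 * ((μ (a n) : ℝ) ^ 2 / (a n)) := by
      intro n hn
      have hn0 := pos_of_mem_ivl hn
      obtain ⟨h3, h4⟩ := hb n
      have hbn : 0 < b n := by
        rcases Nat.eq_zero_or_pos (b n) with h | h
        · rw [h] at h3; simp at h3; omega
        · exact h
      have han : 0 < a n := by
        rcases Nat.eq_zero_or_pos (a n) with h | h
        · rw [h] at h3; simp at h3; omega
        · exact h
      rw [ivl, Finset.mem_Ioc, Nat.floor_zero] at hn
      constructor
      · rw [Finset.mem_product, ivl, Finset.mem_Ioc, Finset.mem_Ioc, Nat.floor_zero]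
        refine ⟨⟨hbn, ?_⟩, ⟨han, ?_⟩⟩
        · refine le_trans ?_ hn.2
          simp only
          nlinarith [Nat.one_le_iff_ne_zero.2 hbn.ne', Nat.one_le_iff_ne_zero.2 han.ne']
        · refine le_trans ?_ hn.2
          simp only
          have : 1 ≤ b n ^ 2 := Nat.one_le_pow _ _ hbn
          nlinarith
      · have h5 : (μ (a n) : ℝ) ^ 2 = 1 := by
          exact_mod_cast moebius_sq_eq_one_of_squarefree h4
        rw [h5]
        have h6 : (n : ℝ) = b n ^ 2 * a n := by exact_mod_cast h3.symm
        rw [h6]; field_simp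
    rw [Finset.sum_congr rfl fun n hn => (h2 n hn).2]
    have h7 : Set.InjOn (fun n => (b n, a n)) (ivl 0 z : Set ℕ) := by
      intro m _ n _ h
      simp only [Prod.mk.injEq] at h
      rw [← (hb m).1, ← (hb n).1, h.1, h.2]
    rw [← Finset.sum_image (g := fun n => (b n, a n))
      (f := fun p : ℕ × ℕ => 1 / (p.1 : ℝ) ^ 2 * ((μ p.2 : ℝ) ^ 2 / p.2)) h7]
    refine Finset.sum_le_sum_of_subset_of_nonneg ?_ fun i _ _ => by positivity
    intro p hp
    rw [Finset.mem_image] at hp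
    obtain ⟨n, hn, rfl⟩ := hp
    exact (h2 n hn).1
  refine h1.trans ?_
  gcongr

lemma sum_divisors_moebius {n : ℕ} :
    ∑ d ∈ n.divisors, (μ d : ℝ) = if n = 1 then 1 else 0 := by
  have h5 := congrArg (fun f : ArithmeticFunction ℝ => f n)
    (coe_moebius_mul_coe_zeta (R := ℝ))
  beta_reduce at h5
  rw [coe_mul_zeta_apply, one_apply] at h5
  simpa only [intCoe_apply] using h5

lemma sum_moebius_div_between {e f : ℕ} (he : 0 < e) (hf : 0 < f) :
    ∑ d ∈ f.divisors with e ∣ d, (μ (f / d) : ℝ) = if f = e then 1 else 0 := by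
  by_cases hef : e ∣ f
  · obtain ⟨g, rfl⟩ := hef
    have hg : 0 < g := Nat.pos_of_mul_pos_left hf
    have h1 : ∑ d ∈ (e * g).divisors with e ∣ d, (μ (e * g / d) : ℝ) =
        ∑ d ∈ g.divisors, (μ (g / d) : ℝ) := by
      symm
      refine Finset.sum_bij' (fun d _ => e * d) (fun d _ => d / e) ?_ ?_ ?_ ?_ ?_
      · intro d hd
        rw [Nat.mem_divisors] at hd
        rw [Finset.mem_filter, Nat.mem_divisors]
        exact ⟨⟨Nat.mul_dvd_mul_left e hd.1, hf.ne'⟩, Dvd.intro d rfl⟩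
      · intro d hd
        rw [Finset.mem_filter, Nat.mem_divisors] at hd
        obtain ⟨⟨h1, -⟩, k, rfl⟩ := hd
        rw [Nat.mul_div_cancel_left _ he, Nat.mem_divisors]
        exact ⟨Nat.dvd_of_mul_dvd_mul_left he h1, hg.ne'⟩
      · intro d _
        exact Nat.mul_div_cancel_left _ he
      · intro d hd
        rw [Finset.mem_filter] at hd
        exact Nat.mul_div_cancel' hd.2
      · intro d _
        rw [Nat.mul_div_mul_left _ _ he]
    rw [h1, Nat.sum_div_divisors g (fun d => (μ d : ℝ)), sum_divisors_moebius]
    have h2 : e * g = e ↔ g = 1 := by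
      constructor
      · intro h; exact Nat.eq_of_mul_eq_mul_left he (by rw [h, mul_one])
      · rintro rfl; exact mul_one e
    simp only [h2]
  · rw [if_neg (fun h : f = e => hef (h ▸ dvd_rfl)), Finset.sum_eq_zero]
    intro d hd
    rw [Finset.mem_filter, Nat.mem_divisors] at hd
    exact absurd (hd.2.trans hd.1.1) hef

/-- Diagonal coordinates of the sieve weights. -/
noncomputable def sieveCoord (z : ℝ) (e : ℕ) : ℝ := (μ e : ℝ) / (e * sieveMass z)

/-- Selberg-type upper bound sieve weights. -/
noncomputable def sieveWeight (z : ℝ) (d : ℕ) : ℝ :=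
  d * ∑ f ∈ ivl 0 z with d ∣ f, (μ (f / d) : ℝ) * sieveCoord z f

lemma sum_sieveWeight_div {z : ℝ} {e : ℕ} (he : e ∈ ivl 0 z) :
    ∑ d ∈ ivl 0 z with e ∣ d, sieveWeight z d / d = sieveCoord z e := by
  have he0 := pos_of_mem_ivl he
  have h1 : ∀ d ∈ {d ∈ ivl 0 z | e ∣ d}, sieveWeight z d / d =
      ∑ f ∈ ivl 0 z, if d ∣ f then (μ (f / d) : ℝ) * sieveCoord z f else 0 := by
    intro d hd
    have hd0 : (0 : ℝ) < d := by exact_mod_cast pos_of_mem_ivl (Finset.mem_filter.1 hd).1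
    rw [sieveWeight, mul_div_cancel_left₀ _ hd0.ne', Finset.sum_filter]
  rw [Finset.sum_congr rfl h1, Finset.sum_comm]
  have h2 : ∀ f ∈ ivl 0 z, ∑ d ∈ ivl 0 z with e ∣ d,
      (if d ∣ f then (μ (f / d) : ℝ) * sieveCoord z f else 0) =
      if f = e then sieveCoord z e else 0 := by
    intro f hf
    have hf0 := pos_of_mem_ivl hf
    rw [← Finset.sum_filter, ← Finset.sum_mul, Finset.filter_filter]
    have h3 : {d ∈ ivl 0 z | e ∣ d ∧ d ∣ f} = {d ∈ f.divisors | e ∣ d} := by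
      ext d
      simp only [Finset.mem_filter, Nat.mem_divisors, ivl, Finset.mem_Ioc, Nat.floor_zero] at hf ⊢
      constructor
      · rintro ⟨h, h4, h5⟩
        exact ⟨⟨h5, hf0.ne'⟩, h4⟩
      · rintro ⟨⟨h4, -⟩, h5⟩
        exact ⟨⟨Nat.pos_of_dvd_of_pos h4 hf0, (Nat.le_of_dvd hf0 h4).trans hf.2⟩, h5, h4⟩
    rw [h3, sum_moebius_div_between he0 hf0]
    split_ifs with h
    · rw [h, one_mul]
    · rw [zero_mul]
  rw [Finset.sum_congr rfl h2, Finset.sum_ite_eq' _ e, if_pos he]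

lemma sum_sieveWeight_quadratic {z : ℝ} (hz : 1 < z) :
    ∑ d₁ ∈ ivl 0 z, ∑ d₂ ∈ ivl 0 z,
      sieveWeight z d₁ * sieveWeight z d₂ * (1 / (Nat.lcm d₁ d₂ : ℝ)) ≤ 1 / sieveMass z := by
  have hJ : 0 < sieveMass z := by
    have := log_le_two_mul_sieveMass hz.le
    have := Real.log_pos hz
    linarith
  have h1 : ∀ d₁ ∈ ivl 0 z, ∀ d₂ ∈ ivl 0 z,
      sieveWeight z d₁ * sieveWeight z d₂ * (1 / (Nat.lcm d₁ d₂ : ℝ)) =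
      ∑ e ∈ ivl 0 z, (Nat.totient e : ℝ) * (if e ∣ d₁ then sieveWeight z d₁ / d₁ else 0) *
        (if e ∣ d₂ then sieveWeight z d₂ / d₂ else 0) := by
    intro d₁ h1 d₂ h2
    have hd1 := pos_of_mem_ivl h1
    have hd2 := pos_of_mem_ivl h2
    have hd1' : (0 : ℝ) < d₁ := by exact_mod_cast hd1
    have hd2' : (0 : ℝ) < d₂ := by exact_mod_cast hd2
    have h3 : ∑ e ∈ ivl 0 z with e ∣ d₁ ∧ e ∣ d₂, (Nat.totient e : ℝ) = (Nat.gcd d₁ d₂ : ℝ) := by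
      have h4 := Nat.sum_totient (Nat.gcd d₁ d₂)
      rw [← h4]
      push_cast
      refine Finset.sum_congr ?_ fun _ _ => rfl
      ext e
      simp only [Finset.mem_filter, Nat.mem_divisors, ivl, Finset.mem_Ioc, Nat.floor_zero,
        Nat.dvd_gcd_iff] at h1 ⊢
      constructor
      · rintro ⟨_, h⟩
        exact ⟨h, (Nat.gcd_pos_of_pos_left _ hd1).ne'⟩
      · rintro ⟨h, _⟩
        exact ⟨⟨Nat.pos_of_dvd_of_pos h.1 hd1, (Nat.le_of_dvd hd1 h.1).trans h1.2⟩, h⟩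
    have h5 : (Nat.gcd d₁ d₂ : ℝ) * (Nat.lcm d₁ d₂ : ℝ) = d₁ * d₂ := by
      exact_mod_cast Nat.gcd_mul_lcm d₁ d₂
    have h6 : (0 : ℝ) < Nat.lcm d₁ d₂ := by exact_mod_cast Nat.lcm_pos hd1 hd2
    calc sieveWeight z d₁ * sieveWeight z d₂ * (1 / (Nat.lcm d₁ d₂ : ℝ))
        = (Nat.gcd d₁ d₂ : ℝ) * (sieveWeight z d₁ / d₁) * (sieveWeight z d₂ / d₂) := by
          field_simp
          linear_combination (-(sieveWeight z d₁ * sieveWeight z d₂)) * h5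
      _ = ∑ e ∈ ivl 0 z with e ∣ d₁ ∧ e ∣ d₂,
            (Nat.totient e : ℝ) * (sieveWeight z d₁ / d₁) * (sieveWeight z d₂ / d₂) := by
          rw [← h3, Finset.sum_mul, Finset.sum_mul]
      _ = _ := by
          rw [Finset.sum_filter]
          refine Finset.sum_congr rfl fun e _ => ?_
          by_cases ha : e ∣ d₁ <;> by_cases hb : e ∣ d₂ <;> simp [ha, hb]
  have h2 : ∑ d₁ ∈ ivl 0 z, ∑ d₂ ∈ ivl 0 z,
      sieveWeight z d₁ * sieveWeight z d₂ * (1 / (Nat.lcm d₁ d₂ : ℝ)) =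
      ∑ e ∈ ivl 0 z, (Nat.totient e : ℝ) * sieveCoord z e ^ 2 := by
    rw [Finset.sum_congr rfl fun d₁ hd₁ => Finset.sum_congr rfl (h1 d₁ hd₁)]
    rw [Finset.sum_congr rfl fun d₁ _ => Finset.sum_comm, Finset.sum_comm]
    refine Finset.sum_congr rfl fun e he => ?_
    rw [← sum_sieveWeight_div he, sq, Finset.sum_mul_sum, Finset.mul_sum, Finset.sum_filter]
    refine Finset.sum_congr rfl fun d₁ _ => ?_
    by_cases ha : e ∣ d₁
    · simp only [ha, if_true]
      rw [Finset.sum_filter, Finset.mul_sum]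
      refine Finset.sum_congr rfl fun d₂ _ => ?_
      by_cases hb : e ∣ d₂ <;> simp [hb]; ring
    · simp [ha]
  rw [h2]
  have h3 : ∀ e ∈ ivl 0 z, (Nat.totient e : ℝ) * sieveCoord z e ^ 2 ≤
      (μ e : ℝ) ^ 2 / e * (1 / sieveMass z ^ 2) := by
    intro e he
    have he0 : (0 : ℝ) < e := by exact_mod_cast pos_of_mem_ivl he
    have h4 : (Nat.totient e : ℝ) ≤ e := by exact_mod_cast Nat.totient_le e
    calc (Nat.totient e : ℝ) * sieveCoord z e ^ 2 ≤ e * sieveCoord z e ^ 2 := by gcongr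
      _ = _ := by rw [sieveCoord]; field_simp
  refine (Finset.sum_le_sum h3).trans (le_of_eq ?_)
  rw [← Finset.sum_mul, ← sieveMass]
  field_simp

lemma sieveWeight_one {z : ℝ} (hz : 1 < z) : sieveWeight z 1 = 1 := by
  have hJ : 0 < sieveMass z := by
    have := log_le_two_mul_sieveMass hz.le
    have := Real.log_pos hz
    linarith
  rw [sieveWeight]
  simp only [Nat.cast_one, one_mul, isUnit_iff_eq_one, IsUnit.dvd, Finset.filter_true,
    Nat.div_one]
  have h1 : ∀ f ∈ ivl 0 z, (μ f : ℝ) * sieveCoord z f =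
      (μ f : ℝ) ^ 2 / f * (1 / sieveMass z) := by
    intro f hf
    rw [sieveCoord]
    have : (f : ℝ) ≠ 0 := by exact_mod_cast (pos_of_mem_ivl hf).ne'
    field_simp
  rw [Finset.sum_congr rfl h1, ← Finset.sum_mul, ← sieveMass]
  field_simp

lemma one_le_sieveMass {z : ℝ} (hz : 1 ≤ z) : 1 ≤ sieveMass z := by
  have h1 : 1 ∈ ivl 0 z := by rw [mem_ivl le_rfl]; simpa using hz
  have := Finset.single_le_sum (f := fun e : ℕ => (μ e : ℝ) ^ 2 / e)
    (fun i _ => by positivity) h1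
  simpa [sieveMass] using this

lemma abs_sieveWeight_le {z : ℝ} (hz : 1 ≤ z) {d : ℕ} (hd : d ∈ ivl 0 z) :
    |sieveWeight z d| ≤ z ^ 2 := by
  have hJ := one_le_sieveMass hz
  have hdz := ((mem_ivl le_rfl).1 hd).2
  rw [sieveWeight, abs_mul, Nat.abs_cast]
  have h1 : |∑ f ∈ ivl 0 z with d ∣ f, (μ (f / d) : ℝ) * sieveCoord z f| ≤ z := by
    refine (Finset.abs_sum_le_sum_abs _ _).trans ?_
    refine le_trans ?_ (card_ivl_zero_le (by linarith : 0 ≤ z))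
    rw [← mul_one ((ivl 0 z).card : ℝ), ← nsmul_eq_mul, ← Finset.sum_const]
    refine le_trans (Finset.sum_le_sum (g := fun _ => (1 : ℝ)) fun f hf => ?_)
      (Finset.sum_le_sum_of_subset_of_nonneg (Finset.filter_subset _ _) fun _ _ _ => by norm_num)
    have hf0 : (1 : ℝ) ≤ f := by
      exact_mod_cast pos_of_mem_ivl (Finset.mem_filter.1 hf).1
    have h2 : |(μ (f / d) : ℝ)| ≤ 1 := by exact_mod_cast abs_moebius_le_one
    have h3 : |(μ f : ℝ)| ≤ 1 := by exact_mod_cast abs_moebius_le_one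
    rw [abs_mul, sieveCoord, abs_div, abs_mul, abs_of_pos (by linarith : 0 < sieveMass z),
      Nat.abs_cast]
    refine mul_le_one₀ h2 (by positivity) (div_le_one_of_le₀ (h3.trans ?_) (by positivity))
    nlinarith
  calc (d : ℝ) * |∑ f ∈ ivl 0 z with d ∣ f, (μ (f / d) : ℝ) * sieveCoord z f| ≤ z * z := by
        gcongr
    _ = z ^ 2 := by ring

/-- Upper bound for the harmonic density of rough numbers in a short window. -/
lemma sum_rough_window_le {ε x z : ℝ} (hε : 0 < ε) (hε1 : ε ≤ 1) (hz : 1 < z)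
    (hx : z ^ 7 ≤ ε * x) :
    ∑ n ∈ ivl (x * Real.exp (-ε)) x with Rough z n, 1 / (n : ℝ) ≤ 10 * ε / Real.log z := by
  have hxpos : 0 < x := by
    have : 0 < z ^ 7 := by positivity
    by_contra h
    push Not at h
    nlinarith
  set W := ivl (x * Real.exp (-ε)) x with hW
  have hlogz := Real.log_pos hz
  have h1 : ∑ n ∈ W with Rough z n, 1 / (n : ℝ) ≤
      ∑ n ∈ W, 1 / (n : ℝ) * (∑ d ∈ ivl 0 z with d ∣ n, sieveWeight z d) ^ 2 := by
    rw [Finset.sum_filter]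
    refine Finset.sum_le_sum fun n hn => ?_
    split_ifs with h
    · have h2 : {d ∈ ivl 0 z | d ∣ n} = {1} := by
        ext d
        rw [Finset.mem_filter, mem_ivl le_rfl, Finset.mem_singleton]
        constructor
        · rintro ⟨⟨h3, h4⟩, h5⟩
          by_contra h6
          obtain ⟨p, hp, hpd⟩ := Nat.exists_prime_and_dvd h6
          have h7 := h p hp (hpd.trans h5)
          have h8 : (p : ℝ) ≤ d := by
            exact_mod_cast Nat.le_of_dvd (by exact_mod_cast h3) hpd
          linarith
        · rintro rfl
          simpa using hz.le
      rw [h2, Finset.sum_singleton, sieveWeight_one hz]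
      simp
    · positivity
  have h2 : ∑ n ∈ W, 1 / (n : ℝ) * (∑ d ∈ ivl 0 z with d ∣ n, sieveWeight z d) ^ 2 =
      ∑ d₁ ∈ ivl 0 z, ∑ d₂ ∈ ivl 0 z, sieveWeight z d₁ * sieveWeight z d₂ *
        ∑ n ∈ W with Nat.lcm d₁ d₂ ∣ n, 1 / (n : ℝ) := by
    have h3 : ∀ n ∈ W, 1 / (n : ℝ) * (∑ d ∈ ivl 0 z with d ∣ n, sieveWeight z d) ^ 2 =
        ∑ d₁ ∈ ivl 0 z, ∑ d₂ ∈ ivl 0 z, sieveWeight z d₁ * sieveWeight z d₂ *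
          if Nat.lcm d₁ d₂ ∣ n then 1 / (n : ℝ) else 0 := by
      intro n _
      rw [sq, Finset.sum_filter, Finset.sum_mul_sum, Finset.mul_sum]
      refine Finset.sum_congr rfl fun d₁ _ => ?_
      rw [Finset.mul_sum]
      refine Finset.sum_congr rfl fun d₂ _ => ?_
      simp only [Nat.lcm_dvd_iff]
      by_cases ha : d₁ ∣ n <;> by_cases hb : d₂ ∣ n <;> simp [ha, hb]; ring
    rw [Finset.sum_congr rfl h3, Finset.sum_comm]
    refine Finset.sum_congr rfl fun d₁ _ => ?_
    rw [Finset.sum_comm]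
    refine Finset.sum_congr rfl fun d₂ _ => ?_
    rw [← Finset.mul_sum, Finset.sum_filter]
  have h3 : ∀ d₁ ∈ ivl 0 z, ∀ d₂ ∈ ivl 0 z, sieveWeight z d₁ * sieveWeight z d₂ *
        ∑ n ∈ W with Nat.lcm d₁ d₂ ∣ n, 1 / (n : ℝ) ≤
      ε * (sieveWeight z d₁ * sieveWeight z d₂ * (1 / (Nat.lcm d₁ d₂ : ℝ))) + z ^ 4 * (8 / x) := by
    intro d₁ h1 d₂ h2
    have hl := Nat.lcm_pos (pos_of_mem_ivl h1) (pos_of_mem_ivl h2)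
    have hl' : (0 : ℝ) < Nat.lcm d₁ d₂ := by exact_mod_cast hl
    set l := Nat.lcm d₁ d₂
    have h4 : |∑ n ∈ W with l ∣ n, 1 / (n : ℝ) - ε * (1 / (l : ℝ))| ≤ 8 / x := by
      rw [hW, sum_ivl_dvd (by positivity) hl]
      have h5 := abs_sum_window_le (x := x / l) hε.le hε1 (by positivity)
      have h6 : x * Real.exp (-ε) / l = x / l * Real.exp (-ε) := by ring
      rw [h6]
      have h7 : ∑ k ∈ ivl (x / l * Real.exp (-ε)) (x / l), 1 / ((l * k : ℕ) : ℝ) =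
          1 / (l : ℝ) * ∑ k ∈ ivl (x / l * Real.exp (-ε)) (x / l), 1 / (k : ℝ) := by
        rw [Finset.mul_sum]
        refine Finset.sum_congr rfl fun k _ => ?_
        push_cast; ring
      rw [h7]
      have h8 : 1 / (l : ℝ) * ∑ k ∈ ivl (x / l * Real.exp (-ε)) (x / l), 1 / (k : ℝ) -
          ε * (1 / (l : ℝ)) =
          1 / (l : ℝ) * (∑ k ∈ ivl (x / l * Real.exp (-ε)) (x / l), 1 / (k : ℝ) - ε) := by ring
      rw [h8, abs_mul, abs_of_pos (by positivity : 0 < 1 / (l : ℝ))]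
      calc _ ≤ 1 / (l : ℝ) * (8 / (x / l)) := by gcongr
        _ = 8 / x := by field_simp
    have h9 : |sieveWeight z d₁ * sieveWeight z d₂| ≤ z ^ 4 := by
      rw [abs_mul]
      calc _ ≤ z ^ 2 * z ^ 2 := by
            gcongr
            · exact abs_sieveWeight_le hz.le h1
            · exact abs_sieveWeight_le hz.le h2
        _ = z ^ 4 := by ring
    have h10 : |sieveWeight z d₁ * sieveWeight z d₂ *
        (∑ n ∈ W with l ∣ n, 1 / (n : ℝ) - ε * (1 / (l : ℝ)))| ≤ z ^ 4 * (8 / x) := by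
      rw [abs_mul]
      gcongr
    have h11 := le_of_abs_le h10
    rw [mul_sub] at h11
    linarith
  have h4 := Finset.sum_le_sum fun d₁ hd₁ => Finset.sum_le_sum (h3 d₁ hd₁)
  simp only [Finset.sum_add_distrib, ← Finset.mul_sum, Finset.sum_const, nsmul_eq_mul] at h4
  rw [← h2] at h4
  have h5 : ε * (∑ d₁ ∈ ivl 0 z, ∑ d₂ ∈ ivl 0 z,
      sieveWeight z d₁ * sieveWeight z d₂ * (1 / (Nat.lcm d₁ d₂ : ℝ))) ≤
      2 * ε / Real.log z := by
    have h6 := sum_sieveWeight_quadratic hz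
    have h7 := log_le_two_mul_sieveMass hz.le
    calc _ ≤ ε * (1 / sieveMass z) := by gcongr
      _ ≤ ε * (2 / Real.log z) := by
          gcongr ε * ?_
          rw [div_le_div_iff₀ (by linarith) hlogz]
          linarith
      _ = _ := by ring
  have h6 : ((ivl 0 z).card : ℝ) * ((ivl 0 z).card * (z ^ 4 * (8 / x))) ≤
      8 * ε / Real.log z := by
    have h7 := card_ivl_zero_le (by linarith : 0 ≤ z)
    have h8 : Real.log z ≤ z := (Real.log_le_sub_one_of_pos (by linarith)).trans (by linarith)
    calc ((ivl 0 z).card : ℝ) * ((ivl 0 z).card * (z ^ 4 * (8 / x)))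
        ≤ z * (z * (z ^ 4 * (8 / x))) := by gcongr
      _ = 8 * z ^ 6 / x := by ring
      _ ≤ 8 * ε / Real.log z := by
          rw [div_le_div_iff₀ hxpos hlogz]
          have : z ^ 6 * Real.log z ≤ z ^ 6 * z := by gcongr
          nlinarith
  have h7 : 10 * ε / Real.log z = 2 * ε / Real.log z + 8 * ε / Real.log z := by ring
  rw [h7]
  linarith

/-- Harmonic mass of the rough numbers up to `y`. -/
lemma sum_rough_le {y z : ℝ} (hy : 1 ≤ y) (hz : 1 < z) :
    ∑ k ∈ ivl 0 y with Rough z k, 1 / (k : ℝ) ≤ (1 + Real.log (y * z)) / Real.log z := by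
  have hlogz := Real.log_pos hz
  rw [le_div_iff₀ hlogz]
  have h0 : 0 ≤ ∑ k ∈ ivl 0 y with Rough z k, 1 / (k : ℝ) :=
    Finset.sum_nonneg fun _ _ => by positivity
  refine (mul_le_mul_of_nonneg_left (log_le_harm hz.le) h0).trans ?_
  refine le_trans ?_ (harm_le (by nlinarith : 1 ≤ y * z))
  rw [harm, harm, Finset.sum_mul_sum, ← Finset.sum_product']
  have hinj : Set.InjOn (fun p : ℕ × ℕ => p.1 * p.2)
      (({k ∈ ivl 0 y | Rough z k} ×ˢ ivl 0 z : Finset (ℕ × ℕ)) : Set (ℕ × ℕ)) := by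
    have hcop : ∀ k l : ℕ, Rough z k → l ∈ ivl 0 z → Nat.Coprime k l := by
      intro k l hk hl
      refine Nat.Coprime.symm (Nat.coprime_of_dvd fun p hp hpl hpk => ?_)
      have h1 := hk p hp hpk
      have h2 : (p : ℝ) ≤ l := by exact_mod_cast Nat.le_of_dvd (pos_of_mem_ivl hl) hpl
      have h3 := ((mem_ivl le_rfl).1 hl).2
      linarith
    rintro ⟨k, l⟩ h1 ⟨k', l'⟩ h2 h
    simp only [Finset.coe_product, Set.mem_prod, Finset.mem_coe, Finset.mem_filter] at h1 h2 h
    have h3 : k ∣ k' := (hcop k l' h1.1.2 h2.2).dvd_of_dvd_mul_right (h ▸ Dvd.intro _ rfl)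
    have h4 : k' ∣ k := (hcop k' l h2.1.2 h1.2).dvd_of_dvd_mul_right (h ▸ Dvd.intro _ rfl)
    have h5 : k = k' := Nat.dvd_antisymm h3 h4
    subst h5
    have h6 := pos_of_mem_ivl h1.1.1
    rw [Prod.mk.injEq]
    exact ⟨rfl, Nat.eq_of_mul_eq_mul_left h6 h⟩
  have h1 : ∀ p : ℕ × ℕ, 1 / (p.1 : ℝ) * (1 / (p.2 : ℝ)) = 1 / ((p.1 * p.2 : ℕ) : ℝ) := by
    intro p; push_cast; field_simp
  simp only [h1]
  rw [← Finset.sum_image (g := fun p : ℕ × ℕ => p.1 * p.2) (f := fun n : ℕ => 1 / (n : ℝ)) hinj]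
  refine Finset.sum_le_sum_of_subset_of_nonneg ?_ fun i _ _ => by positivity
  intro n hn
  rw [Finset.mem_image] at hn
  obtain ⟨⟨k, l⟩, hp, rfl⟩ := hn
  simp only [Finset.mem_product, Finset.mem_filter] at hp
  have h2 := (mem_ivl le_rfl).1 hp.1.1
  have h3 := (mem_ivl le_rfl).1 hp.2
  rw [mem_ivl le_rfl]
  push_cast
  exact ⟨mul_pos h2.1 h3.1, mul_le_mul h2.2 h3.2 h3.1.le (by linarith)⟩

/-- Möbius-twisted sum of `F (log (x / e))` over the divisors `e` of `n`. -/
noncomputable def moebSum (F : ℝ → ℝ) (x : ℝ) (n : ℕ) : ℝ :=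
  ∑ e ∈ n.divisors, (μ e : ℝ) * F (Real.log (x / e))

/-- The difference of `F` produced by removing the prime power `p ^ a`. -/
noncomputable def primeDiff (p a : ℕ) (F : ℝ → ℝ) (s : ℝ) : ℝ :=
  F (s + a * Real.log p) - F (s + (a - 1) * Real.log p)

lemma sum_divisors_prime_pow_mul {p a m : ℕ} (hp : p.Prime) (ha : 0 < a) (hpm : ¬ p ∣ m)
    (h : ℕ → ℝ) :
    ∑ e ∈ (p ^ a * m).divisors, (μ e : ℝ) * h e =
      ∑ e ∈ m.divisors, (μ e : ℝ) * (h e - h (p * e)) := by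
  have hm : m ≠ 0 := by rintro rfl; exact hpm (dvd_zero p)
  have hpa : p ∣ p ^ a := dvd_pow_self p ha.ne'
  have hdisj : Disjoint m.divisors (m.divisors.image (p * ·)) := by
    rw [Finset.disjoint_left]
    intro e he he'
    rw [Finset.mem_image] at he'
    obtain ⟨k, -, rfl⟩ := he'
    exact hpm ((Dvd.intro k rfl).trans (Nat.dvd_of_mem_divisors he))
  have hsub : m.divisors ∪ m.divisors.image (p * ·) ⊆ (p ^ a * m).divisors := by
    intro e he
    rw [Nat.mem_divisors]
    refine ⟨?_, mul_ne_zero (pow_ne_zero _ hp.ne_zero) hm⟩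
    rcases Finset.mem_union.1 he with h1 | h1
    · exact (Nat.dvd_of_mem_divisors h1).trans (Dvd.intro_left _ rfl)
    · obtain ⟨k, hk, rfl⟩ := Finset.mem_image.1 h1
      exact mul_dvd_mul hpa (Nat.dvd_of_mem_divisors hk)
  rw [← Finset.sum_subset hsub, Finset.sum_union hdisj, Finset.sum_image]
  · rw [← Finset.sum_add_distrib]
    refine Finset.sum_congr rfl fun e he => ?_
    have hcop : Nat.Coprime p e := (Nat.Prime.coprime_iff_not_dvd hp).2
      fun h1 => hpm (h1.trans (Nat.dvd_of_mem_divisors he))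
    rw [isMultiplicative_moebius.map_mul_of_coprime hcop, moebius_apply_prime hp]
    push_cast
    ring
  · intro x _ y _ hxy
    exact Nat.eq_of_mul_eq_mul_left hp.pos hxy
  · intro e he he'
    by_cases hsq : Squarefree e
    · exfalso
      apply he'
      rw [Finset.mem_union, Finset.mem_image]
      have hed := Nat.dvd_of_mem_divisors he
      have key : ∀ k, ¬ p ∣ k → k ∣ p ^ a * m → k ∈ m.divisors := by
        intro k hk hkd
        rw [Nat.mem_divisors]
        refine ⟨Nat.Coprime.dvd_of_dvd_mul_left ?_ hkd, hm⟩
        exact (Nat.Coprime.pow_left a ((Nat.Prime.coprime_iff_not_dvd hp).2 hk)).symm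
      by_cases hpe : p ∣ e
      · obtain ⟨k, rfl⟩ := hpe
        refine Or.inr ⟨k, key k ?_ ((Dvd.intro_left p rfl).trans hed), rfl⟩
        intro hpk
        have := hsq p (mul_dvd_mul_left p hpk)
        exact hp.one_lt.ne' (Nat.isUnit_iff.1 this)
      · exact Or.inl (key e hpe hed)
    · rw [moebius_eq_zero_of_not_squarefree hsq]; simp

lemma moebSum_prime_pow_mul {p a m : ℕ} (hp : p.Prime) (ha : 0 < a) (hpm : ¬ p ∣ m)
    (F : ℝ → ℝ) {x : ℝ} (hx : 0 < x) :
    moebSum F x (p ^ a * m) = moebSum (primeDiff p a F) (x / (p ^ a : ℕ)) m := by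
  rw [moebSum, moebSum, sum_divisors_prime_pow_mul hp ha hpm]
  refine Finset.sum_congr rfl fun e he => ?_
  have he0 : (0 : ℝ) < e := by exact_mod_cast Nat.pos_of_mem_divisors he
  have hp0 : (0 : ℝ) < p := by exact_mod_cast hp.pos
  rw [primeDiff]
  push_cast
  rw [Real.log_div hx.ne' he0.ne', Real.log_div hx.ne' (mul_pos hp0 he0).ne',
    Real.log_mul hp0.ne' he0.ne', Real.log_div (by positivity) he0.ne',
    Real.log_div hx.ne' (by positivity), Real.log_pow]
  congr 3 <;> ring

/-- The short multiplicative window `(x e^{-ε}, x]`. -/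
noncomputable def win (ε x : ℝ) : Finset ℕ := ivl (x * Real.exp (-ε)) x

lemma mem_win {ε x : ℝ} (hx : 0 ≤ x) {n : ℕ} :
    n ∈ win ε x ↔ x * Real.exp (-ε) < n ∧ (n : ℝ) ≤ x := mem_ivl (by positivity)

/-- Absolute mass of `moebSum F` over the rough numbers in a window. -/
noncomputable def roughMass (ε : ℝ) (F : ℝ → ℝ) (q x : ℝ) : ℝ :=
  ∑ n ∈ win ε x with Rough q n, |moebSum F x n| / n

lemma sum_inv_prime_pow_le {p : ℕ} (hp : p.Prime) (A : ℕ) :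
    ∑ a ∈ Finset.Icc 1 A, 1 / ((p ^ a : ℕ) : ℝ) ≤ 2 / p := by
  have hp2 : (2 : ℝ) ≤ p := by exact_mod_cast hp.two_le
  have h2 : ∀ A : ℕ, ∑ a ∈ Finset.Icc 1 A, 1 / ((p ^ a : ℕ) : ℝ) ≤
      2 / p - 1 / ((p ^ A : ℕ) : ℝ) * (1 / (p - 1)) := by
    intro A
    have hp1 : (0 : ℝ) < p - 1 := by linarith
    have hp0 : (0 : ℝ) < p := by linarith
    induction A with
    | zero =>
      simp
      rw [inv_le_comm₀ hp1 (by positivity), inv_div]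
      linarith
    | succ n ih =>
      rw [Finset.sum_Icc_succ_top (by omega)]
      refine (add_le_add ih le_rfl).trans (le_of_eq ?_)
      push_cast
      rw [pow_succ]
      field_simp
      ring
  refine (h2 A).trans ?_
  have : (0 : ℝ) ≤ 1 / ((p ^ A : ℕ) : ℝ) * (1 / (p - 1)) := by
    have : (0 : ℝ) < p - 1 := by linarith
    positivity
  linarith

lemma one_le_div_of_dvd {ε x : ℝ} (hx : 0 ≤ x) {n e : ℕ} (hn : n ∈ win ε x) (he : e ∈ n.divisors) :
    1 ≤ x / e := by
  have he0 : (0 : ℝ) < e := by exact_mod_cast Nat.pos_of_mem_divisors he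
  rw [one_le_div he0]
  have h1 : (e : ℝ) ≤ n := by
    exact_mod_cast Nat.divisor_le he
  exact h1.trans ((mem_win hx).1 hn).2

lemma abs_moebSum_le_of_rough {ε x Y B : ℝ} (hx : 0 ≤ x) {F : ℝ → ℝ} (hY : 1 ≤ Y)
    (hF : ∀ s, Real.log Y ≤ s → F s = 0) (hB : ∀ s, 0 ≤ s → |F s| ≤ B) {n : ℕ}
    (hn : n ∈ win ε x) (hr : Rough Y n) : |moebSum F x n| ≤ B := by
  have hn0 : 0 < n := pos_of_mem_ivl hn
  have h1 : moebSum F x n = (μ n : ℝ) * F (Real.log (x / n)) := by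
    refine Finset.sum_eq_single n ?_ ?_
    · intro e he hen
      have he0 : (0 : ℝ) < e := by exact_mod_cast Nat.pos_of_mem_divisors he
      obtain ⟨k, rfl⟩ := Nat.dvd_of_mem_divisors he
      have hk : k ≠ 1 := by rintro rfl; exact hen (mul_one e).symm
      obtain ⟨p, hp, hpk⟩ := Nat.exists_prime_and_dvd hk
      have h2 := hr p hp (hpk.trans (Dvd.intro_left _ rfl))
      have hk0 : 0 < k := Nat.pos_of_mul_pos_left hn0
      have h3 : (p : ℝ) ≤ k := by exact_mod_cast Nat.le_of_dvd hk0 hpk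
      have h4 := ((mem_win hx).1 hn).2
      push_cast at h4
      have h5 : Y ≤ x / e := by
        rw [le_div_iff₀ he0]; nlinarith
      rw [hF _ (Real.log_le_log (by linarith) h5), mul_zero]
    · intro h
      exact absurd (Nat.mem_divisors_self n hn0.ne') h
  rw [h1, abs_mul]
  have h2 : |(μ n : ℝ)| ≤ 1 := by exact_mod_cast abs_moebius_le_one
  have h3 := hB _ (Real.log_nonneg (one_le_div_of_dvd hx hn (Nat.mem_divisors_self n hn0.ne')))
  calc _ ≤ 1 * B := by gcongr
    _ = B := one_mul B

/-- Sorting integers by their least prime factor. -/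
lemma roughMass_le_add {ε q x Y B : ℝ} (hε : 0 < ε) (hε1 : ε ≤ 1) (hx : 0 < x) (hq : 0 ≤ q)
    (hY : 1 < Y) (hYx : Y ^ 7 ≤ ε * x) {F : ℝ → ℝ}
    (hF : ∀ s, Real.log Y ≤ s → F s = 0) (hB : ∀ s, 0 ≤ s → |F s| ≤ B) :
    roughMass ε F q x ≤ 10 * ε * B / Real.log Y +
      ∑ p ∈ ivl q Y with p.Prime, ∑ a ∈ Finset.Icc 1 ⌊x⌋₊,
        1 / ((p ^ a : ℕ) : ℝ) * roughMass ε (primeDiff p a F) p (x / (p ^ a : ℕ)) := by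
  have hB0 : 0 ≤ B := (abs_nonneg _).trans (hB 0 le_rfl)
  set t : ℕ → ℝ := fun n => |moebSum F x n| / n with ht
  have ht0 : ∀ n, 0 ≤ t n := fun n => by positivity
  have h1 : ∀ n ∈ {n ∈ win ε x | Rough q n}, t n ≤ (if Rough Y n then B * (1 / (n : ℝ)) else 0) +
      ∑ p ∈ ivl q Y with p.Prime, ∑ a ∈ Finset.Icc 1 ⌊x⌋₊,
        if p ^ a ∣ n then (if Rough p (n / p ^ a) then t n else 0) else 0 := by
    intro n hn
    rw [Finset.mem_filter] at hn
    have hn0 : 0 < n := pos_of_mem_ivl hn.1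
    have hsum0 : ∀ p ∈ {p ∈ ivl q Y | p.Prime}, 0 ≤ ∑ a ∈ Finset.Icc 1 ⌊x⌋₊,
        if p ^ a ∣ n then (if Rough p (n / p ^ a) then t n else 0) else 0 := by
      intro p _
      refine Finset.sum_nonneg fun a _ => ?_
      split_ifs <;> simp [ht0]
    by_cases hr : Rough Y n
    · rw [if_pos hr]
      have h2 := abs_moebSum_le_of_rough hx.le hY.le hF hB hn.1 hr
      have h3 : t n ≤ B * (1 / (n : ℝ)) := by
        rw [ht, mul_one_div]
        simp only
        gcongr
      have := Finset.sum_nonneg hsum0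
      linarith
    · rw [if_neg hr, zero_add]
      have hn1 : n ≠ 1 := by
        rintro rfl
        apply hr
        intro p hp hp1
        exact absurd (Nat.dvd_one.1 hp1) hp.one_lt.ne'
      set p := n.minFac with hp
      have hpp : p.Prime := Nat.minFac_prime hn1
      have hpn : p ∣ n := Nat.minFac_dvd n
      have hpY : (p : ℝ) ≤ Y := by
        rw [Rough] at hr
        push Not at hr
        obtain ⟨l, hl, hln, hlY⟩ := hr
        have : (p : ℝ) ≤ l := by exact_mod_cast Nat.minFac_le_of_dvd hl.two_le hln
        linarith
      obtain ⟨a, m, hpm, hnm⟩ := Nat.exists_eq_pow_mul_and_not_dvd hn0.ne' p hpp.ne_one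
      have ha : 0 < a := by
        rcases Nat.eq_zero_or_pos a with h | h
        · rw [h, pow_zero, one_mul] at hnm
          exact absurd (hnm ▸ hpn) hpm
        · exact h
      have hpa0 : 0 < p ^ a := pow_pos hpp.pos a
      have hm0 : 0 < m := by
        rcases Nat.eq_zero_or_pos m with h | h
        · rw [h, mul_zero] at hnm; omega
        · exact h
      have hmem : p ∈ {p ∈ ivl q Y | p.Prime} := by
        rw [Finset.mem_filter, mem_ivl hq]
        exact ⟨⟨hn.2 p hpp hpn, hpY⟩, hpp⟩
      have hamem : a ∈ Finset.Icc 1 ⌊x⌋₊ := by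
        rw [Finset.mem_Icc]
        refine ⟨ha, Nat.le_floor ?_⟩
        have h3 : a < p ^ a := Nat.lt_pow_self hpp.one_lt
        have h4 : p ^ a ≤ n := Nat.le_of_dvd hn0 (hnm ▸ Dvd.intro m rfl)
        have h5 : (a : ℝ) ≤ n := by exact_mod_cast (h3.le.trans h4)
        exact h5.trans ((mem_win hx.le).1 hn.1).2
      have hrough : Rough p (n / p ^ a) := by
        rw [hnm, Nat.mul_div_cancel_left _ hpa0]
        intro l hl hlm
        have h3 : p ≤ l := Nat.minFac_le_of_dvd hl.two_le (hlm.trans (hnm ▸ Dvd.intro_left _ rfl))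
        have h4 : p ≠ l := by rintro h; exact hpm (h ▸ hlm)
        exact_mod_cast lt_of_le_of_ne h3 h4
      refine le_trans ?_ (Finset.single_le_sum hsum0 hmem)
      refine le_trans ?_ (Finset.single_le_sum (fun a _ => ?_) hamem)
      · rw [if_pos (hnm ▸ Dvd.intro m rfl), if_pos hrough]
      · split_ifs <;> simp [ht0]
  have h2 := Finset.sum_le_sum h1
  rw [Finset.sum_add_distrib] at h2
  have h3 : ∑ n ∈ win ε x with Rough q n, (if Rough Y n then B * (1 / (n : ℝ)) else 0) ≤
      10 * ε * B / Real.log Y := by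
    calc _ ≤ ∑ n ∈ win ε x, (if Rough Y n then B * (1 / (n : ℝ)) else 0) := by
          refine Finset.sum_le_sum_of_subset_of_nonneg (Finset.filter_subset _ _) fun i _ _ => ?_
          split_ifs <;> positivity
      _ = B * ∑ n ∈ win ε x with Rough Y n, 1 / (n : ℝ) := by
          rw [← Finset.sum_filter, ← Finset.mul_sum]
      _ ≤ B * (10 * ε / Real.log Y) := by
          gcongr
          exact sum_rough_window_le hε hε1 hY hYx
      _ = _ := by ring
  have h4 : ∑ n ∈ win ε x with Rough q n, ∑ p ∈ ivl q Y with p.Prime,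
      ∑ a ∈ Finset.Icc 1 ⌊x⌋₊,
        (if p ^ a ∣ n then (if Rough p (n / p ^ a) then t n else 0) else 0) ≤
      ∑ p ∈ ivl q Y with p.Prime, ∑ a ∈ Finset.Icc 1 ⌊x⌋₊,
        1 / ((p ^ a : ℕ) : ℝ) * roughMass ε (primeDiff p a F) p (x / (p ^ a : ℕ)) := by
    rw [Finset.sum_comm]
    refine Finset.sum_le_sum fun p hp => ?_
    rw [Finset.sum_comm]
    refine Finset.sum_le_sum fun a ha => ?_
    have hpp := (Finset.mem_filter.1 hp).2
    have hpa0 : 0 < p ^ a := pow_pos hpp.pos a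
    have hpa0' : (0 : ℝ) < (p ^ a : ℕ) := by exact_mod_cast hpa0
    calc _ ≤ ∑ n ∈ win ε x,
          (if p ^ a ∣ n then (if Rough p (n / p ^ a) then t n else 0) else 0) := by
          refine Finset.sum_le_sum_of_subset_of_nonneg (Finset.filter_subset _ _) fun i _ _ => ?_
          split_ifs <;> simp [ht0]
      _ = ∑ n ∈ win ε x with p ^ a ∣ n, (if Rough p (n / p ^ a) then t n else 0) := by
          rw [Finset.sum_filter]
      _ = ∑ k ∈ win ε (x / (p ^ a : ℕ)), (if Rough p k then t (p ^ a * k) else 0) := by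
          rw [win, sum_ivl_dvd (by positivity) hpa0, win]
          have h5 : x * Real.exp (-ε) / (p ^ a : ℕ) = x / (p ^ a : ℕ) * Real.exp (-ε) := by ring
          rw [h5]
          refine Finset.sum_congr rfl fun k _ => ?_
          rw [Nat.mul_div_cancel_left _ hpa0]
      _ = _ := by
          rw [← Finset.sum_filter, roughMass, Finset.mul_sum]
          refine Finset.sum_congr rfl fun k hk => ?_
          rw [Finset.mem_filter] at hk
          have hpk : ¬ p ∣ k := fun h => lt_irrefl _ (hk.2 p hpp h)
          rw [ht]
          simp only
          rw [moebSum_prime_pow_mul hpp (Finset.mem_Icc.1 ha).1 hpk F hx]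
          push_cast
          field_simp
  rw [roughMass]
  linarith

/-- One step of the least-prime-factor recursion, with the prime powers summed out. -/
lemma roughMass_le_of_forall {ε q x Y B : ℝ} (hε : 0 < ε) (hε1 : ε ≤ 1) (hx : 0 < x)
    (hq : 0 ≤ q) (hY : 1 < Y) (hYx : Y ^ 7 ≤ ε * x) {F : ℝ → ℝ}
    (hF : ∀ s, Real.log Y ≤ s → F s = 0) (hB : ∀ s, 0 ≤ s → |F s| ≤ B) (U : ℕ → ℝ)
    (hU : ∀ p ∈ ivl q Y, p.Prime → 0 ≤ U p ∧ ∀ a : ℕ, 0 < a → ((p ^ a : ℕ) : ℝ) ≤ Y ^ 2 →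
      roughMass ε (primeDiff p a F) p (x / (p ^ a : ℕ)) ≤ U p) :
    roughMass ε F q x ≤ 10 * ε * B / Real.log Y +
      ∑ p ∈ ivl q Y with p.Prime, 2 / (p : ℝ) * U p := by
  refine (roughMass_le_add hε hε1 hx hq hY hYx hF hB).trans ?_
  gcongr with p hp
  rw [Finset.mem_filter] at hp
  obtain ⟨hU0, hU1⟩ := hU p hp.1 hp.2
  have hp0 : (0 : ℝ) < p := by exact_mod_cast hp.2.pos
  refine le_trans ?_ (mul_le_mul_of_nonneg_right (sum_inv_prime_pow_le hp.2 ⌊x⌋₊) hU0)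
  rw [Finset.sum_mul]
  refine Finset.sum_le_sum fun a ha => ?_
  gcongr
  have ha1 := (Finset.mem_Icc.1 ha).1
  by_cases hpa : ((p ^ a : ℕ) : ℝ) ≤ Y ^ 2
  · exact hU1 a ha1 hpa
  · refine le_trans (le_of_eq ?_) hU0
    push Not at hpa
    refine Finset.sum_eq_zero fun n hn => ?_
    rw [Finset.mem_filter] at hn
    have h1 : moebSum (primeDiff p a F) (x / (p ^ a : ℕ)) n = 0 := by
      refine Finset.sum_eq_zero fun e he => ?_
      have h2 := Real.log_nonneg (one_le_div_of_dvd (by positivity) hn.1 he)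
      have hpY := ((mem_ivl hq).1 hp.1).2
      have hlog : Real.log p ≤ Real.log Y := Real.log_le_log hp0 hpY
      have h3 : 2 * Real.log Y ≤ a * Real.log p := by
        have := Real.log_le_log (by positivity) hpa.le
        push_cast at this
        rw [Real.log_pow, Real.log_pow] at this
        exact_mod_cast this
      have hlogp : 0 ≤ Real.log p := Real.log_natCast_nonneg p
      rw [primeDiff, hF, hF]
      · simp
      · nlinarith
      · nlinarith
    rw [h1]; simp

lemma hasDerivAt_max_const_sub_pow (n : ℕ) (c s : ℝ) :
    HasDerivAt (fun u => max (c - u) 0 ^ (n + 2)) (-((n + 2) * max (c - s) 0 ^ (n + 1))) s := by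
  have h : HasDerivAt (fun u => max (-u - -c) 0 ^ (n + 2))
      ((n + 2) * max (-s - -c) 0 ^ (n + 1) * -1) s :=
    (hasDerivAt_max_sub_pow n (-c) (-s)).comp s (hasDerivAt_neg s)
  have e : ∀ u, -u - -c = c - u := fun u => by ring
  simp only [e] at h
  refine h.congr_deriv ?_
  ring

/-- A `C²` piecewise cubic cutoff supported on `s ≤ 2 L`. -/
noncomputable def cutoff (L s : ℝ) : ℝ := (max (2 * L - s) 0 ^ 3 - max (L - s) 0 ^ 3) / (3 * L)

/-- The first derivative of `cutoff`. -/
noncomputable def cutoffDeriv (L s : ℝ) : ℝ := -((max (2 * L - s) 0 ^ 2 - max (L - s) 0 ^ 2) / L)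

/-- The second derivative of `cutoff`. -/
noncomputable def cutoffDerivTwo (L s : ℝ) : ℝ := 2 * (max (2 * L - s) 0 - max (L - s) 0) / L

lemma hasDerivAt_cutoff {L : ℝ} (hL : 0 < L) (s : ℝ) :
    HasDerivAt (cutoff L) (cutoffDeriv L s) s := by
  have h := ((hasDerivAt_max_const_sub_pow 1 (2 * L) s).sub
    (hasDerivAt_max_const_sub_pow 1 L s)).div_const (3 * L)
  refine h.congr_deriv ?_
  rw [cutoffDeriv]
  field_simp
  push_cast
  ring

lemma hasDerivAt_cutoffDeriv {L : ℝ} (s : ℝ) :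
    HasDerivAt (cutoffDeriv L) (cutoffDerivTwo L s) s := by
  have h := (((hasDerivAt_max_const_sub_pow 0 (2 * L) s).sub
    (hasDerivAt_max_const_sub_pow 0 L s)).div_const L).neg
  refine h.congr_deriv ?_
  rw [cutoffDerivTwo]
  push_cast
  ring

lemma cutoff_eq_zero {L s : ℝ} (hL : 0 ≤ L) (hs : 2 * L ≤ s) : cutoff L s = 0 := by
  rw [cutoff, max_eq_right (by linarith), max_eq_right (by linarith)]; simp

lemma abs_cutoff_le {L s : ℝ} (hL : 0 < L) (hs : 0 ≤ s) : |cutoff L s| ≤ 3 * L ^ 2 := by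
  have h1 : 0 ≤ max (L - s) 0 := le_max_right _ _
  have h2 : max (L - s) 0 ≤ max (2 * L - s) 0 := max_le_max (by linarith) le_rfl
  have h3 : max (2 * L - s) 0 ≤ 2 * L := max_le (by linarith) (by linarith)
  have h4 : max (L - s) 0 ^ 3 ≤ max (2 * L - s) 0 ^ 3 := by gcongr
  have h5 : max (2 * L - s) 0 ^ 3 ≤ (2 * L) ^ 3 := by
    have := h1.trans h2
    gcongr
  have h6 : 0 ≤ max (L - s) 0 ^ 3 := by positivity
  rw [cutoff, abs_of_nonneg (div_nonneg (by linarith) (by positivity)), div_le_iff₀ (by positivity)]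
  nlinarith [pow_pos hL 3]

lemma abs_cutoffDeriv_le {L s : ℝ} (hL : 0 < L) (hs : 0 ≤ s) : |cutoffDeriv L s| ≤ 4 * L := by
  have h1 : 0 ≤ max (L - s) 0 := le_max_right _ _
  have h2 : max (L - s) 0 ≤ max (2 * L - s) 0 := max_le_max (by linarith) le_rfl
  have h3 : max (2 * L - s) 0 ≤ 2 * L := max_le (by linarith) (by linarith)
  have h4 : max (L - s) 0 ^ 2 ≤ max (2 * L - s) 0 ^ 2 := by gcongr
  have h5 : max (2 * L - s) 0 ^ 2 ≤ (2 * L) ^ 2 := by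
    have := h1.trans h2
    gcongr
  have h6 : 0 ≤ max (L - s) 0 ^ 2 := by positivity
  rw [cutoffDeriv, abs_neg, abs_of_nonneg (div_nonneg (by linarith) hL.le), div_le_iff₀ hL]
  nlinarith

lemma abs_cutoffDerivTwo_le {L : ℝ} (hL : 0 < L) (s : ℝ) : |cutoffDerivTwo L s| ≤ 2 := by
  have h2 : max (L - s) 0 ≤ max (2 * L - s) 0 := max_le_max (by linarith) le_rfl
  have h3 : max (2 * L - s) 0 ≤ max (L - s) 0 + L :=
    max_le (by linarith [le_max_left (L - s) 0]) (by linarith [le_max_right (L - s) 0])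
  rw [cutoffDerivTwo, abs_of_nonneg (div_nonneg (by linarith) hL.le), div_le_iff₀ hL]
  linarith

lemma abs_cutoffDerivTwo_sub_le {L s t : ℝ} (hL : 0 < L) (hst : s ≤ t) :
    |cutoffDerivTwo L t - cutoffDerivTwo L s| ≤ 2 / L * (t - s) := by
  have e : cutoffDerivTwo L t - cutoffDerivTwo L s =
      2 / L * ((max (2 * L - t) 0 - max (L - t) 0) - (max (2 * L - s) 0 - max (L - s) 0)) := by
    rw [cutoffDerivTwo, cutoffDerivTwo]; ring
  rw [e, abs_mul, abs_of_pos (by positivity)]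
  gcongr
  rcases max_cases (2 * L - t) 0 with h | h <;> rcases max_cases (L - t) 0 with h' | h' <;>
  rcases max_cases (2 * L - s) 0 with h'' | h'' <;> rcases max_cases (L - s) 0 with h''' | h''' <;>
  rw [h.1, h'.1, h''.1, h'''.1, abs_le] <;> constructor <;> linarith [h.2, h'.2, h''.2, h'''.2]

lemma primeDiff_eq_zero {p a : ℕ} (ha : 0 < a) {F : ℝ → ℝ} {S : ℝ}
    (hF : ∀ s, S ≤ s → F s = 0) (s : ℝ) (hs : S ≤ s) : primeDiff p a F s = 0 := by
  have hlogp : 0 ≤ Real.log p := Real.log_natCast_nonneg p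
  have ha' : (1 : ℝ) ≤ a := by exact_mod_cast ha
  rw [primeDiff, hF, hF, sub_zero] <;> nlinarith

lemma hasDerivAt_primeDiff (p a : ℕ) {F F' : ℝ → ℝ} (hF : ∀ s, HasDerivAt F (F' s) s) (s : ℝ) :
    HasDerivAt (primeDiff p a F) (primeDiff p a F' s) s :=
  ((hF _).comp_add_const s _).sub ((hF _).comp_add_const s _)

lemma abs_primeDiff_le {p a : ℕ} (ha : 0 < a) {F F' : ℝ → ℝ} (hF : ∀ s, HasDerivAt F (F' s) s)
    {B : ℝ} (hB : ∀ s, 0 ≤ s → |F' s| ≤ B) (s : ℝ) (hs : 0 ≤ s) :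
    |primeDiff p a F s| ≤ B * Real.log p := by
  have hlogp : 0 ≤ Real.log p := Real.log_natCast_nonneg p
  have ha' : (1 : ℝ) ≤ a := by exact_mod_cast ha
  have h := (convex_Ici (0 : ℝ)).norm_image_sub_le_of_norm_hasDerivWithin_le
    (f := F) (f' := F') (C := B) (x := s + (a - 1) * Real.log p) (y := s + a * Real.log p)
    (fun x _ => (hF x).hasDerivWithinAt) (fun x hx => hB x hx)
    (Set.mem_Ici.2 (by nlinarith)) (Set.mem_Ici.2 (by nlinarith))
  rw [Real.norm_eq_abs, Real.norm_eq_abs] at h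
  refine h.trans (le_of_eq ?_)
  rw [show s + a * Real.log p - (s + (a - 1) * Real.log p) = Real.log p by ring,
    abs_of_nonneg hlogp]

/-- The trivial divisor bound for `roughMass`, via sieve bounds. -/
lemma roughMass_le_of_bound {ε q x Y B L : ℝ} (hε : 0 < ε) (hε1 : ε ≤ 1) (hx : 0 < x)
    (hL : 1 ≤ L) (hY : Y = Real.exp (2 * L)) (hq : 1 < q) (hqY : q ≤ Y) (hYx : Y ^ 8 ≤ ε * x)
    {F : ℝ → ℝ} (hF : ∀ s, 2 * L ≤ s → F s = 0) (hB : ∀ s, 0 ≤ s → |F s| ≤ B) :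
    roughMass ε F q x ≤ 50 * B * L * ε / Real.log q ^ 2 := by
  have hB0 : 0 ≤ B := (abs_nonneg _).trans (hB 0 le_rfl)
  have hlq : 0 < Real.log q := Real.log_pos hq
  have hY0 : 0 < Y := by rw [hY]; positivity
  have hY1 : 1 < Y := hq.trans_le hqY
  have hxe : 0 ≤ x * Real.exp (-ε) := by positivity
  have h1 : ∀ n ∈ {n ∈ win ε x | Rough q n}, |moebSum F x n| / n ≤
      ∑ d ∈ n.divisors, if (d : ℝ) ≤ Y ∧ Rough q d ∧ Rough q (n / d) then
        B * (1 / (d : ℝ) * (1 / ((n / d : ℕ) : ℝ))) else 0 := by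
    intro n hn
    rw [Finset.mem_filter] at hn
    have hn0 : 0 < n := pos_of_mem_ivl hn.1
    have hn0' : (0 : ℝ) < n := by exact_mod_cast hn0
    rw [div_le_iff₀ hn0', moebSum, ← Nat.sum_div_divisors, Finset.sum_mul]
    refine (Finset.abs_sum_le_sum_abs _ _).trans (Finset.sum_le_sum fun d hd => ?_)
    have hdn := Nat.dvd_of_mem_divisors hd
    have hd0 : 0 < d := Nat.pos_of_mem_divisors hd
    have hd0' : (0 : ℝ) < d := by exact_mod_cast hd0
    have hr1 : Rough q d := fun p hp h => hn.2 p hp (h.trans hdn)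
    have hr2 : Rough q (n / d) := fun p hp h => hn.2 p hp (h.trans (Nat.div_dvd_of_dvd hdn))
    have hmem : n / d ∈ n.divisors := Nat.mem_divisors.2 ⟨Nat.div_dvd_of_dvd hdn, hn0.ne'⟩
    have hm0 : 0 < n / d := Nat.pos_of_mem_divisors hmem
    have hm0' : (0 : ℝ) < (n / d : ℕ) := by exact_mod_cast hm0
    have hprod : (n : ℝ) = d * (n / d : ℕ) := by exact_mod_cast (Nat.mul_div_cancel' hdn).symm
    have hx1 := one_le_div_of_dvd hx.le hn.1 hmem
    split_ifs with hc
    · rw [hprod, abs_mul]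
      have h2 : |(μ (n / d) : ℝ)| ≤ 1 := by exact_mod_cast abs_moebius_le_one
      have h3 := hB _ (Real.log_nonneg hx1)
      calc _ ≤ 1 * B := by gcongr
        _ = _ := by field_simp
    · have hdY : Y < d := by
        by_contra h
        exact hc ⟨not_lt.1 h, hr1, hr2⟩
      rw [hF, mul_zero, abs_zero, zero_mul]
      have h4 : Y ≤ x / (n / d : ℕ) := by
        rw [le_div_iff₀ hm0']
        have := ((mem_win hx.le).1 hn.1).2
        rw [hprod] at this
        nlinarith
      have := Real.log_le_log hY0 h4
      rwa [hY, Real.log_exp] at this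
  have hY8 : Y * q ^ 7 ≤ ε * x := by
    refine le_trans ?_ hYx
    calc Y * q ^ 7 ≤ Y * Y ^ 7 := by gcongr
      _ = Y ^ 8 := by ring
  have h5 : ∑ d ∈ ivl 0 Y with Rough q d, 1 / (d : ℝ) ≤ 5 * L / Real.log q := by
    refine (sum_rough_le hY1.le hq).trans ?_
    rw [Real.log_mul hY0.ne' (by linarith)]
    have h6 : Real.log Y = 2 * L := by rw [hY, Real.log_exp]
    have h7 : Real.log q ≤ Real.log Y := Real.log_le_log (by linarith) hqY
    gcongr
    linarith
  calc roughMass ε F q x ≤ ∑ n ∈ win ε x with Rough q n, _ := Finset.sum_le_sum h1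
    _ ≤ ∑ n ∈ win ε x, ∑ d ∈ n.divisors, if (d : ℝ) ≤ Y ∧ Rough q d ∧ Rough q (n / d) then
        B * (1 / (d : ℝ) * (1 / ((n / d : ℕ) : ℝ))) else 0 := by
          refine Finset.sum_le_sum_of_subset_of_nonneg (Finset.filter_subset _ _) fun n _ _ => ?_
          refine Finset.sum_nonneg fun d _ => ?_
          split_ifs <;> positivity
    _ = ∑ d ∈ ivl 0 x, ∑ k ∈ ivl (x * Real.exp (-ε) / d) (x / d),
          if (d : ℝ) ≤ Y ∧ Rough q d ∧ Rough q k then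
            B * (1 / (d : ℝ) * (1 / (k : ℝ))) else 0 :=
        sum_ivl_divisors hxe fun d k => if (d : ℝ) ≤ Y ∧ Rough q d ∧ Rough q k then
            B * (1 / (d : ℝ) * (1 / (k : ℝ))) else 0
    _ ≤ ∑ d ∈ ivl 0 x, if (d : ℝ) ≤ Y ∧ Rough q d then
          B * (10 * ε / Real.log q) * (1 / (d : ℝ)) else 0 := by
        refine Finset.sum_le_sum fun d hd => ?_
        have hd0 : (0 : ℝ) < d := by exact_mod_cast pos_of_mem_ivl hd
        split_ifs with hc
        · have e : x * Real.exp (-ε) / d = x / d * Real.exp (-ε) := by ring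
          simp only [hc.1, hc.2, true_and]
          rw [← Finset.sum_filter, ← Finset.mul_sum, ← Finset.mul_sum, e]
          have h6 : q ^ 7 ≤ ε * (x / d) := by
            rw [← mul_div_assoc, le_div_iff₀ hd0]
            refine le_trans ?_ hY8
            rw [mul_comm]
            gcongr
            exact hc.1
          have h7 := sum_rough_window_le hε hε1 hq h6
          rw [mul_assoc B, mul_comm (10 * ε / Real.log q)]
          gcongr
        · refine le_of_eq (Finset.sum_eq_zero fun k _ => ?_)
          rw [if_neg fun h => hc ⟨h.1, h.2.1⟩]
    _ ≤ ∑ d ∈ ivl 0 Y with Rough q d, B * (10 * ε / Real.log q) * (1 / (d : ℝ)) := by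
        rw [← Finset.sum_filter]
        refine Finset.sum_le_sum_of_subset_of_nonneg (fun d hd => ?_) fun n _ _ => by positivity
        rw [Finset.mem_filter] at hd ⊢
        refine ⟨(mem_ivl le_rfl).2 ⟨((mem_ivl le_rfl).1 hd.1).1, hd.2.1⟩, hd.2.2⟩
    _ ≤ B * (10 * ε / Real.log q) * (5 * L / Real.log q) := by
        rw [← Finset.mul_sum]
        gcongr
    _ = _ := by field_simp; ring

lemma sum_prime_interchange_le {q Y : ℝ} (hq : 0 ≤ q) {g k : ℕ → ℝ} (hg : ∀ n, 0 ≤ g n)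
    (hk : ∀ n, 0 ≤ k n) :
    ∑ p ∈ ivl q Y with p.Prime, g p * ∑ r ∈ ivl p Y with r.Prime, k r ≤
      ∑ r ∈ ivl q Y with r.Prime, k r * ∑ p ∈ ivl 0 r with p.Prime, g p := by
  simp_rw [Finset.mul_sum]
  rw [Finset.sum_comm' (s' := fun r => {p ∈ ivl q r | p.Prime ∧ p < r})
    (t' := {r ∈ ivl q Y | r.Prime})]
  · refine Finset.sum_le_sum fun r _ => ?_
    simp_rw [mul_comm (k r)]
    refine Finset.sum_le_sum_of_subset_of_nonneg (fun p hp => ?_)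
      fun p _ _ => mul_nonneg (hg p) (hk r)
    rw [Finset.mem_filter] at hp ⊢
    rw [mem_ivl hq] at hp
    exact ⟨(mem_ivl le_rfl).2 ⟨hq.trans_lt hp.1.1, hp.1.2⟩, hp.2.1⟩
  · intro p r
    simp only [Finset.mem_filter]
    rw [mem_ivl hq, mem_ivl hq, mem_ivl hq, mem_ivl (Nat.cast_nonneg p), Nat.cast_lt, Nat.cast_le]
    constructor
    · rintro ⟨⟨⟨h1, h2⟩, h3⟩, ⟨h4, h5⟩, h6⟩
      exact ⟨⟨⟨h1, h4.le⟩, h3, h4⟩, ⟨h1.trans (by exact_mod_cast h4), h5⟩, h6⟩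
    · rintro ⟨⟨⟨h1, _⟩, h3, h4⟩, ⟨_, h5⟩, h6⟩
      exact ⟨⟨⟨h1, (by exact_mod_cast h4.le : (p : ℝ) ≤ r).trans h5⟩, h3⟩, ⟨h4, h5⟩, h6⟩

lemma sum_prime_log_div_le_ten {p : ℕ} (hp : p.Prime) :
    ∑ r ∈ ivl 0 p with r.Prime, Real.log r / r ≤ 10 * Real.log p := by
  have h1 : (1 : ℝ) ≤ p := by exact_mod_cast hp.one_lt.le
  have h2 : Real.log 2 ≤ Real.log p := Real.log_le_log (by norm_num) (by exact_mod_cast hp.two_le)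
  have := sum_prime_log_div_le h1
  linarith [Real.log_two_gt_d9]

lemma sum_prime_log_div_ivl_le {q L : ℝ} (hL : 1 ≤ L) (hq : 0 ≤ q) :
    ∑ r ∈ ivl q (Real.exp (2 * L)) with r.Prime, Real.log r / r ≤ 8 * L := by
  have h1 := sum_prime_log_div_le (q := Real.exp (2 * L)) (Real.one_le_exp (by linarith))
  rw [Real.log_exp] at h1
  refine le_trans (Finset.sum_le_sum_of_subset_of_nonneg (Finset.filter_subset_filter _
    (ivl_mono_left hq)) fun r _ _ => ?_) (h1.trans (by linarith))
  exact div_nonneg (Real.log_natCast_nonneg r) (Nat.cast_nonneg r)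

lemma sum_prime_double_le {q Y : ℝ} (hq : 0 ≤ q) {k : ℕ → ℝ} (hk : ∀ n, 0 ≤ k n) :
    ∑ p ∈ ivl q Y with p.Prime, Real.log p / p * ∑ r ∈ ivl p Y with r.Prime, k r ≤
      10 * ∑ r ∈ ivl q Y with r.Prime, k r * Real.log r := by
  refine (sum_prime_interchange_le hq
    (fun n => div_nonneg (Real.log_natCast_nonneg n) (Nat.cast_nonneg n)) hk).trans ?_
  rw [Finset.mul_sum]
  refine Finset.sum_le_sum fun r hr => ?_
  have := sum_prime_log_div_le_ten (Finset.mem_filter.1 hr).2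
  nlinarith [hk r]

lemma le_div_prime_pow {ε x Y Z : ℝ} {m : ℕ} (hY : 0 < Y) (hm : 0 < m) (hmY : (m : ℝ) ≤ Y ^ 2)
    {k : ℕ} (h : Y ^ (k + 2) ≤ ε * x) (hZ : Z = Y ^ k) : Z ≤ ε * (x / m) := by
  have hm' : (0 : ℝ) < m := by exact_mod_cast hm
  rw [← mul_div_assoc, le_div_iff₀ hm', hZ]
  calc Y ^ k * m ≤ Y ^ k * Y ^ 2 := by gcongr
    _ = Y ^ (k + 2) := by ring
    _ ≤ _ := h

lemma roughMass_le_of_bound_diff {ε q x Y A L : ℝ} (hε : 0 < ε) (hε1 : ε ≤ 1) (hx : 0 < x)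
    (hL : 1 ≤ L) (hY : Y = Real.exp (2 * L)) (hq : 0 ≤ q) (hYx : Y ^ 10 ≤ ε * x) (hA : 0 ≤ A)
    {F : ℝ → ℝ} (hF : ∀ s, 2 * L ≤ s → F s = 0) (hB : ∀ s, 0 ≤ s → |F s| ≤ A)
    (hD : ∀ p a : ℕ, 0 < a → ∀ s, 0 ≤ s → |primeDiff p a F s| ≤ A / L * Real.log p) :
    roughMass ε F q x ≤
      ε * A * (5 / L + ∑ p ∈ ivl q Y with p.Prime, 100 / (p * Real.log p)) := by
  have hY1 : 1 < Y := by rw [hY]; exact Real.one_lt_exp_iff.2 (by linarith)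
  have hlY : Real.log Y = 2 * L := by rw [hY, Real.log_exp]
  have h7 : Y ^ 7 ≤ ε * x := (pow_le_pow_right₀ hY1.le (by norm_num)).trans hYx
  refine (roughMass_le_of_forall hε hε1 hx hq hY1 h7 (by rwa [hlY]) hB
    (fun p => 50 * A * ε / Real.log p) fun p hp hpp => ?_).trans (le_of_eq ?_)
  · have hlp : 0 < Real.log p := Real.log_pos (by exact_mod_cast hpp.one_lt)
    refine ⟨by positivity, fun a ha hpa => ?_⟩
    have hpa0 : 0 < p ^ a := pow_pos hpp.pos a
    refine (roughMass_le_of_bound hε hε1 (div_pos hx (by exact_mod_cast hpa0)) hL hY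
      (by exact_mod_cast hpp.one_lt) ((mem_ivl hq).1 hp).2
      (le_div_prime_pow (k := 8) (by linarith) hpa0 hpa hYx rfl) (primeDiff_eq_zero ha hF)
      (hD p a ha)).trans (le_of_eq ?_)
    field_simp
  · rw [hlY, mul_add, Finset.mul_sum]
    congr 1
    · field_simp; ring
    · refine Finset.sum_congr rfl fun p hp => ?_
      have hpp := (Finset.mem_filter.1 hp).2
      have hlp : 0 < Real.log p := Real.log_pos (by exact_mod_cast hpp.one_lt)
      have hp0 : (0 : ℝ) < p := by exact_mod_cast hpp.pos
      field_simp; ring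

lemma roughMass_le_of_bound_diff_two {ε q x Y A L : ℝ} (hε : 0 < ε) (hε1 : ε ≤ 1) (hx : 0 < x)
    (hL : 1 ≤ L) (hY : Y = Real.exp (2 * L)) (hq : 0 ≤ q) (hYx : Y ^ 12 ≤ ε * x) (hA : 0 ≤ A)
    {F : ℝ → ℝ} (hF : ∀ s, 2 * L ≤ s → F s = 0) (hB : ∀ s, 0 ≤ s → |F s| ≤ 2 * A * L)
    (hD : ∀ p a : ℕ, 0 < a → ∀ s, 0 ≤ s → |primeDiff p a F s| ≤ A * Real.log p)
    (hD2 : ∀ p a r b : ℕ, 0 < a → 0 < b → ∀ s, 0 ≤ s →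
      |primeDiff r b (primeDiff p a F) s| ≤ A * Real.log p / L * Real.log r) :
    roughMass ε F q x ≤ ε * A * (90 + 2000 * ∑ p ∈ ivl q Y with p.Prime, 1 / (p : ℝ)) := by
  have hY1 : 1 < Y := by rw [hY]; exact Real.one_lt_exp_iff.2 (by linarith)
  have hlY : Real.log Y = 2 * L := by rw [hY, Real.log_exp]
  have h7 : Y ^ 7 ≤ ε * x := (pow_le_pow_right₀ hY1.le (by norm_num)).trans hYx
  set k : ℕ → ℝ := fun p => 1 / (p * Real.log p) with hk
  have hk0 : ∀ n, 0 ≤ k n := fun n => one_div_nonneg.2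
    (mul_nonneg (Nat.cast_nonneg n) (Real.log_natCast_nonneg n))
  set S : ℕ → ℝ := fun p => ∑ r ∈ ivl p Y with r.Prime, k r with hS
  have hS0 : ∀ n, 0 ≤ S n := fun n => Finset.sum_nonneg fun r _ => hk0 r
  have h1 := roughMass_le_of_forall hε hε1 hx hq hY1 h7 (by rwa [hlY]) hB
    (fun p => ε * (A * Real.log p) * (5 / L + 100 * S p)) fun p hp hpp => ?_
  · have h2 := sum_prime_double_le (Y := Y) hq hk0
    have h3 : ∑ r ∈ ivl q Y with r.Prime, k r * Real.log r =
        ∑ p ∈ ivl q Y with p.Prime, 1 / (p : ℝ) := by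
      refine Finset.sum_congr rfl fun p hp => ?_
      have hpp := (Finset.mem_filter.1 hp).2
      have hlp : 0 < Real.log p := Real.log_pos (by exact_mod_cast hpp.one_lt)
      have hp0 : (0 : ℝ) < p := by exact_mod_cast hpp.pos
      simp only [hk]; field_simp
    rw [h3] at h2
    have h4 : ∑ r ∈ ivl q Y with r.Prime, Real.log r / r ≤ 8 * L := by
      rw [hY]; exact sum_prime_log_div_ivl_le hL hq
    have h5 : ∑ p ∈ ivl q Y with p.Prime,
        2 / (p : ℝ) * (ε * (A * Real.log p) * (5 / L + 100 * S p)) =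
        ε * A * (10 / L * (∑ r ∈ ivl q Y with r.Prime, Real.log r / r) +
          200 * ∑ p ∈ ivl q Y with p.Prime, Real.log p / p * S p) := by
      rw [Finset.mul_sum, Finset.mul_sum, ← Finset.sum_add_distrib, Finset.mul_sum]
      refine Finset.sum_congr rfl fun p _ => ?_
      ring
    have h6 : 10 / L * (∑ r ∈ ivl q Y with r.Prime, Real.log r / r) ≤ 80 := by
      calc _ ≤ 10 / L * (8 * L) := by gcongr
        _ = 80 := by field_simp; norm_num
    have h8 : 10 * ε * (2 * A * L) / Real.log Y = ε * A * 10 := by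
      rw [hlY]; field_simp
    rw [h5, h8, ← mul_add] at h1
    refine h1.trans (mul_le_mul_of_nonneg_left ?_ (by positivity))
    linarith
  · have hlp : 0 < Real.log p := Real.log_pos (by exact_mod_cast hpp.one_lt)
    refine ⟨mul_nonneg (by positivity) (add_nonneg (by positivity)
      (mul_nonneg (by norm_num) (hS0 p))), fun a ha hpa => ?_⟩
    have hpa0 : 0 < p ^ a := pow_pos hpp.pos a
    refine (roughMass_le_of_bound_diff hε hε1 (div_pos hx (by exact_mod_cast hpa0)) hL hY
      (Nat.cast_nonneg p)
      (le_div_prime_pow (k := 10) (by linarith) hpa0 hpa hYx rfl) (by positivity)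
      (primeDiff_eq_zero ha hF) (hD p a ha) (fun r b hb => hD2 p a r b ha hb)).trans
      (le_of_eq ?_)
    simp only [hS, hk]
    rw [Finset.mul_sum]
    simp only [mul_one_div]

/-- The cutoff contributes `O(ε L)` to the absolute mass of a window. -/
lemma roughMass_cutoff_le {ε x Y L : ℝ} (hε : 0 < ε) (hε1 : ε ≤ 1) (hx : 0 < x)
    (hL : 1 ≤ L) (hY : Y = Real.exp (2 * L)) (hYx : Y ^ 14 ≤ ε * x) :
    roughMass ε (cutoff L) 0 x ≤ 642895 * ε * L := by
  have hL0 : 0 < L := by linarith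
  have hY1 : 1 < Y := by rw [hY]; exact Real.one_lt_exp_iff.2 (by linarith)
  have hlY : Real.log Y = 2 * L := by rw [hY, Real.log_exp]
  have h7 : Y ^ 7 ≤ ε * x := (pow_le_pow_right₀ hY1.le (by norm_num)).trans hYx
  have hF : ∀ s, 2 * L ≤ s → cutoff L s = 0 := fun s hs => cutoff_eq_zero hL0.le hs
  set S : ℕ → ℝ := fun p => ∑ r ∈ ivl p Y with r.Prime, 1 / (r : ℝ) with hS
  have hS0 : ∀ n, 0 ≤ S n := fun n => Finset.sum_nonneg fun r _ => by positivity
  have h1 := roughMass_le_of_forall hε hε1 hx le_rfl hY1 h7 (by rwa [hlY])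
    (fun s hs => abs_cutoff_le hL0 hs)
    (fun p => ε * (2 * Real.log p) * (90 + 2000 * S p)) fun p hp hpp => ?_
  · have h2 := sum_prime_double_le (q := 0) (Y := Y) le_rfl (k := fun r => 1 / (r : ℝ))
      (fun n => by positivity)
    have h3 : ∑ r ∈ ivl 0 Y with r.Prime, 1 / (r : ℝ) * Real.log r =
        ∑ r ∈ ivl 0 Y with r.Prime, Real.log r / r :=
      Finset.sum_congr rfl fun r _ => by ring
    rw [h3] at h2
    have h4 : ∑ r ∈ ivl 0 Y with r.Prime, Real.log r / r ≤ 8 * L := by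
      rw [hY]; exact sum_prime_log_div_ivl_le hL le_rfl
    have h5 : ∑ p ∈ ivl 0 Y with p.Prime,
        2 / (p : ℝ) * (ε * (2 * Real.log p) * (90 + 2000 * S p)) =
        ε * (360 * (∑ r ∈ ivl 0 Y with r.Prime, Real.log r / r) +
          8000 * ∑ p ∈ ivl 0 Y with p.Prime, Real.log p / p * S p) := by
      rw [Finset.mul_sum, Finset.mul_sum, ← Finset.sum_add_distrib, Finset.mul_sum]
      refine Finset.sum_congr rfl fun p _ => ?_
      ring
    have h8 : 10 * ε * (3 * L ^ 2) / Real.log Y = ε * (15 * L) := by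
      rw [hlY]; field_simp; norm_num
    rw [h5, h8, ← mul_add] at h1
    refine h1.trans ?_
    rw [mul_comm 642895 ε, mul_assoc]
    gcongr
    linarith
  · have hlp : 0 < Real.log p := Real.log_pos (by exact_mod_cast hpp.one_lt)
    refine ⟨mul_nonneg (by positivity) (add_nonneg (by positivity)
      (mul_nonneg (by norm_num) (hS0 p))), fun a ha hpa => ?_⟩
    have hpa0 : 0 < p ^ a := pow_pos hpp.pos a
    have hd0 := hasDerivAt_primeDiff p a (hasDerivAt_cutoff hL0)
    have hd1 := hasDerivAt_primeDiff p a (hasDerivAt_cutoffDeriv (L := L))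
    have hb2 : ∀ s, 0 ≤ s → |primeDiff p a (cutoffDerivTwo L) s| ≤ 2 * Real.log p / L := by
      intro s hs
      refine (abs_cutoffDerivTwo_sub_le hL0 (by nlinarith)).trans (le_of_eq ?_)
      field_simp; ring
    refine (roughMass_le_of_bound_diff_two hε hε1 (div_pos hx (by exact_mod_cast hpa0)) hL hY
      (Nat.cast_nonneg p)
      (le_div_prime_pow (k := 12) (by linarith) hpa0 hpa hYx rfl)
      (A := 2 * Real.log p) (by positivity)
      (primeDiff_eq_zero ha hF) (fun s hs => ?_) (fun r b hb s hs => ?_)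
      (fun r b t c hb hc s hs => ?_))
    · refine (abs_primeDiff_le ha (hasDerivAt_cutoff hL0)
        (fun s hs => abs_cutoffDeriv_le hL0 hs) s hs).trans (le_of_eq ?_)
      ring
    · refine abs_primeDiff_le hb hd0 (fun s hs => ?_) s hs
      exact abs_primeDiff_le ha hasDerivAt_cutoffDeriv
        (fun s _ => abs_cutoffDerivTwo_le hL0 s) s hs
    · refine abs_primeDiff_le hc (hasDerivAt_primeDiff r b hd0) (fun s hs => ?_) s hs
      refine (abs_primeDiff_le hb hd1 hb2 s hs).trans (le_of_eq ?_)
      ring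

/-- Selberg's function `Λ log + Λ * Λ`. -/
noncomputable def selberg (n : ℕ) : ℝ :=
  Λ n * Real.log n + ∑ d ∈ n.divisors, Λ d * Λ (n / d)

lemma sum_divisors_selberg {n : ℕ} (hn : 0 < n) :
    ∑ d ∈ n.divisors, selberg d = Real.log n ^ 2 := by
  have h1 : ∀ d : ℕ, ∑ a ∈ d.divisors, Λ a * Λ (d / a) = (Λ * Λ) d := fun d => by
    rw [mul_apply, Nat.sum_divisorsAntidiagonal (fun a b => Λ a * Λ b)]
  simp only [selberg, h1]
  rw [Finset.sum_add_distrib, ← coe_mul_zeta_apply, mul_assoc, vonMangoldt_mul_zeta, mul_apply,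
    Nat.sum_divisorsAntidiagonal (fun a b => Λ a * ArithmeticFunction.log b),
    ← Finset.sum_add_distrib, pow_two]
  conv_rhs => rw [← vonMangoldt_sum, Finset.sum_mul, vonMangoldt_sum]
  refine Finset.sum_congr rfl fun d hd => ?_
  have hd0 : (0 : ℝ) < d := by exact_mod_cast Nat.pos_of_mem_divisors hd
  have hn0 : (0 : ℝ) < n := by exact_mod_cast hn
  rw [log_apply, Nat.cast_div (Nat.dvd_of_mem_divisors hd) hd0.ne', Real.log_div hn0.ne' hd0.ne']
  ring

lemma sum_moebius_mul_log_sq {n : ℕ} (hn : 0 < n) :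
    ∑ d ∈ n.divisors, (μ d : ℝ) * Real.log (n / d) ^ 2 = selberg n := by
  have h := (sum_eq_iff_sum_mul_moebius_eq (R := ℝ) (f := selberg)
    (g := fun n => Real.log n ^ 2)).1 (fun n hn => sum_divisors_selberg hn) n hn
  rw [Nat.sum_divisorsAntidiagonal (fun a b => (μ a : ℝ) * Real.log b ^ 2)] at h
  rw [← h]
  refine Finset.sum_congr rfl fun d hd => ?_
  have hd0 : (0 : ℝ) < d := by exact_mod_cast Nat.pos_of_mem_divisors hd
  rw [Nat.cast_div (Nat.dvd_of_mem_divisors hd) hd0.ne']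

lemma sum_moebius_mul_log_div {n : ℕ} :
    ∑ d ∈ n.divisors, (μ d : ℝ) * Real.log (n / d) = Λ n := by
  have h := congrArg (fun f : ArithmeticFunction ℝ => f n) moebius_mul_log_eq_vonMangoldt
  simp only [mul_apply] at h
  rw [Nat.sum_divisorsAntidiagonal (fun a b => ((μ : ArithmeticFunction ℝ) a) *
    ArithmeticFunction.log b)] at h
  rw [← h]
  refine Finset.sum_congr rfl fun d hd => ?_
  have hd0 : (0 : ℝ) < d := by exact_mod_cast Nat.pos_of_mem_divisors hd
  rw [log_apply, Nat.cast_div (Nat.dvd_of_mem_divisors hd) hd0.ne', intCoe_apply]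

lemma moebSum_quadratic {n : ℕ} (hn : 1 < n) {x : ℝ} (hx : 0 < x) (b c : ℝ) :
    moebSum (fun s => s ^ 2 + b * s + c) x n =
      selberg n + (2 * Real.log (x / n) + b) * Λ n := by
  have hn0 : (0 : ℝ) < n := by exact_mod_cast (by omega : 0 < n)
  set δ := Real.log (x / n) with hδ
  have h0 := sum_divisors_moebius (n := n)
  rw [if_neg (by omega)] at h0
  rw [← sum_moebius_mul_log_sq (by omega), ← sum_moebius_mul_log_div (n := n), Finset.mul_sum,
    ← Finset.sum_add_distrib, moebSum]
  have h1 : ∀ d ∈ n.divisors, (μ d : ℝ) * (Real.log (x / d) ^ 2 + b * Real.log (x / d) + c) =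
      ((μ d : ℝ) * Real.log (n / d) ^ 2 + (2 * δ + b) * ((μ d : ℝ) * Real.log (n / d))) +
        (δ ^ 2 + b * δ + c) * μ d := by
    intro d hd
    have hd0 : (0 : ℝ) < d := by exact_mod_cast Nat.pos_of_mem_divisors hd
    have : Real.log (x / d) = δ + Real.log (n / d) := by
      rw [hδ, Real.log_div hx.ne' hd0.ne', Real.log_div hx.ne' hn0.ne',
        Real.log_div hn0.ne' hd0.ne']
      ring
    rw [this]; ring
  rw [Finset.sum_congr rfl h1, Finset.sum_add_distrib, ← Finset.mul_sum, h0, mul_zero, add_zero]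

/-- Proper prime powers contribute negligibly to a window. -/
lemma sum_not_prime_vonMangoldt_le {ε x : ℝ} (hε1 : ε ≤ 1) (hx : 1 ≤ x) :
    ∑ n ∈ win ε x with ¬ n.Prime, Λ n / n ≤ 6 * Real.log x * Real.exp (-Real.log x / 2) := by
  have hx0 : 0 < x := by linarith
  have h1 : ∑ n ∈ ivl 0 x with ¬ n.Prime, Λ n ≤ 2 * √x * Real.log x := by
    have := Chebyshev.psi_sub_theta_le hx
    rw [Chebyshev.psi_sub_theta_eq_sum_not_prime] at this
    rwa [ivl, Nat.floor_zero]
  have hsub : {n ∈ win ε x | ¬ n.Prime} ⊆ {n ∈ ivl 0 x | ¬ n.Prime} :=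
    Finset.filter_subset_filter _ (ivl_mono_left (by positivity))
  have he : Real.exp 1 < 3 := by linarith [Real.exp_one_lt_d9]
  have hs : √x = Real.exp (Real.log x / 2) := by
    rw [Real.sqrt_eq_rpow, Real.rpow_def_of_pos hx0]; congr 1; ring
  calc ∑ n ∈ win ε x with ¬ n.Prime, Λ n / n
      ≤ ∑ n ∈ win ε x with ¬ n.Prime, Λ n * (3 / x) := by
        refine Finset.sum_le_sum fun n hn => ?_
        rw [Finset.mem_filter] at hn
        have hn0 : (0 : ℝ) < n := by exact_mod_cast pos_of_mem_ivl hn.1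
        have h2 := ((mem_win hx0.le).1 hn.1).1
        rw [div_eq_mul_one_div]
        refine mul_le_mul_of_nonneg_left ?_ vonMangoldt_nonneg
        rw [div_le_div_iff₀ hn0 hx0, one_mul]
        have h3 : x * Real.exp (-1) ≤ x * Real.exp (-ε) := by gcongr
        have h4 : x = x * Real.exp (-1) * Real.exp 1 := by
          rw [mul_assoc, ← Real.exp_add]; simp
        rw [h4]
        have h5 : 0 < x * Real.exp (-1) := by positivity
        nlinarith
    _ = (∑ n ∈ win ε x with ¬ n.Prime, Λ n) * (3 / x) := by rw [Finset.sum_mul]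
    _ ≤ (2 * √x * Real.log x) * (3 / x) := by
        refine mul_le_mul_of_nonneg_right (le_trans ?_ h1) (by positivity)
        exact Finset.sum_le_sum_of_subset_of_nonneg hsub fun n _ _ => vonMangoldt_nonneg
    _ = _ := by
        rw [hs]
        have h6 : x = Real.exp (Real.log x / 2) * Real.exp (Real.log x / 2) := by
          rw [← Real.exp_add, add_halves, Real.exp_log hx0]
        have h7 : Real.exp (-Real.log x / 2) = 1 / Real.exp (Real.log x / 2) := by
          rw [neg_div, Real.exp_neg, one_div]
        rw [h7]
        nth_rewrite 3 [h6]
        field_simp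
        ring

/-- `v exp (-v / 2)` is far below `exp (-L / 2)` for `v ≥ 30 L`. -/
lemma mul_exp_neg_half_le {v L : ℝ} (hL : 1 ≤ L) (hv : 30 * L ≤ v) :
    v * Real.exp (-v / 2) ≤ Real.exp (-L / 2) / v := by
  have hv0 : 0 < v := by linarith
  rw [le_div_iff₀ hv0]
  have h1 : v / 8 + 1 ≤ Real.exp (v / 8) := Real.add_one_le_exp _
  have h2 : v ^ 2 ≤ 64 * Real.exp (v / 4) := by
    have : Real.exp (v / 4) = Real.exp (v / 8) * Real.exp (v / 8) := by
      rw [← Real.exp_add]; congr 1; ring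
    rw [this]; nlinarith
  have h3 : 64 ≤ Real.exp (v / 5) := by
    have h4 : (2 : ℝ) ≤ Real.exp 1 := by linarith [Real.exp_one_gt_d9]
    calc (64 : ℝ) = 2 ^ 6 := by norm_num
      _ ≤ Real.exp 1 ^ 6 := by gcongr
      _ = Real.exp 6 := by rw [← Real.exp_nat_mul]; norm_num
      _ ≤ _ := Real.exp_le_exp.2 (by linarith)
  calc v * Real.exp (-v / 2) * v = v ^ 2 * Real.exp (-v / 2) := by ring
    _ ≤ (Real.exp (v / 5) * Real.exp (v / 4)) * Real.exp (-v / 2) := by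
        gcongr; exact h2.trans (by gcongr)
    _ = Real.exp (-v / 20) := by rw [← Real.exp_add, ← Real.exp_add]; congr 1; ring
    _ ≤ _ := Real.exp_le_exp.2 (by linarith)

/-- Brun–Titchmarsh for logarithmic windows. -/
lemma sum_vonMangoldt_win_le {ε x L : ℝ} (hL : 1 ≤ L) (hε : ε = Real.exp (-L / 2)) (hx : 0 < x)
    (hv : 30 * L ≤ Real.log x) : ∑ n ∈ win ε x, Λ n / n ≤ 81 * ε := by
  have hε0 : 0 < ε := by rw [hε]; positivity
  have hε1 : ε ≤ 1 := by rw [hε]; exact Real.exp_le_one_iff.2 (by linarith)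
  set v := Real.log x with hvx
  have hxv : x = Real.exp v := (Real.exp_log hx).symm
  have hx1 : 1 ≤ x := by rw [hxv]; exact Real.one_le_exp (by linarith)
  rw [← Finset.sum_filter_add_sum_filter_not _ (fun n => n.Prime)]
  have h1 := sum_not_prime_vonMangoldt_le hε1 hx1
  have h2 := mul_exp_neg_half_le hL hv
  rw [← hvx] at h1
  have h3 : 6 * v * Real.exp (-v / 2) ≤ ε := by
    have h4 : 6 * (Real.exp (-L / 2) / v) ≤ ε := by
      rw [← hε, ← mul_div_assoc, div_le_iff₀ (by linarith)]
      nlinarith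
    linarith
  have h5 : ∑ n ∈ win ε x with n.Prime, Λ n / n ≤ 80 * ε := by
    have hz : 1 < Real.exp (v / 8) := Real.one_lt_exp_iff.2 (by linarith)
    have h6 : Real.exp (v / 8) ^ 7 ≤ ε * x := by
      rw [← Real.exp_nat_mul, hε, hxv, ← Real.exp_add]
      refine Real.exp_le_exp.2 ?_
      push_cast
      linarith
    have h7 := sum_rough_window_le hε0 hε1 hz h6
    rw [Real.log_exp] at h7
    calc _ ≤ ∑ n ∈ win ε x with n.Prime, v * (1 / (n : ℝ)) := by
          refine Finset.sum_le_sum fun n hn => ?_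
          rw [Finset.mem_filter] at hn
          have hn0 : (0 : ℝ) < n := by exact_mod_cast pos_of_mem_ivl hn.1
          have h8 : Λ n ≤ v := vonMangoldt_le_log.trans
            (Real.log_le_log hn0 ((mem_win hx.le).1 hn.1).2)
          rw [div_eq_mul_one_div]
          gcongr
      _ ≤ ∑ n ∈ ivl (x * Real.exp (-ε)) x with Rough (Real.exp (v / 8)) n, v * (1 / (n : ℝ)) := by
          refine Finset.sum_le_sum_of_subset_of_nonneg (fun n hn => ?_) fun n _ _ => ?_
          · rw [Finset.mem_filter] at hn ⊢
            refine ⟨hn.1, fun p hp hpn => ?_⟩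
            rw [(Nat.prime_dvd_prime_iff_eq hp hn.2).1 hpn]
            refine lt_of_le_of_lt ?_ ((mem_win hx.le).1 hn.1).1
            rw [hxv, ← Real.exp_add]
            exact Real.exp_le_exp.2 (by linarith)
          · have : 0 ≤ v := by linarith
            positivity
      _ ≤ v * (10 * ε / (v / 8)) := by
          rw [← Finset.mul_sum]
          have : 0 ≤ v := by linarith
          gcongr
      _ = 80 * ε := by
          have : 0 < v := by linarith
          field_simp; norm_num
  linarith

/-- The complement of `cutoff` in a quadratic polynomial. -/
noncomputable def tailCube (L s : ℝ) : ℝ := (max (s - L) 0 ^ 3 - max (s - 2 * L) 0 ^ 3) / (3 * L)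

lemma tailCube_add_cutoff {L : ℝ} (hL : 0 < L) (s : ℝ) :
    tailCube L s + cutoff L s = s ^ 2 + -(3 * L) * s + 7 / 3 * L ^ 2 := by
  have h : ∀ c : ℝ, max (c - s) 0 ^ 3 - max (s - c) 0 ^ 3 = (c - s) ^ 3 := by
    intro c
    rcases le_total s c with h | h
    · rw [max_eq_left (by linarith), max_eq_right (by linarith)]; ring
    · rw [max_eq_right (by linarith), max_eq_left (by linarith)]; ring
  have e : tailCube L s + cutoff L s =
      ((max (2 * L - s) 0 ^ 3 - max (s - 2 * L) 0 ^ 3) -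
        (max (L - s) 0 ^ 3 - max (s - L) 0 ^ 3)) / (3 * L) := by
    rw [tailCube, cutoff]; ring
  rw [e, h, h]
  field_simp
  ring

lemma abs_tailCube_le {L s : ℝ} (hL : 0 < L) (hs : 0 ≤ s) : |tailCube L s| ≤ s ^ 2 := by
  set a := max (s - L) 0 with ha
  set b := max (s - 2 * L) 0 with hb
  have hb0 : 0 ≤ b := le_max_right _ _
  have hba : b ≤ a := max_le_max (by linarith) le_rfl
  have has : a ≤ s := max_le (by linarith) hs
  have hab : a ≤ b + L := max_le (by linarith [le_max_left (s - 2 * L) 0]) (by linarith)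
  have e : tailCube L s = (a - b) * (a ^ 2 + a * b + b ^ 2) / (3 * L) := by
    rw [tailCube]; ring
  have h1 : 0 ≤ a ^ 2 + a * b + b ^ 2 := by positivity
  rw [e, abs_of_nonneg (div_nonneg (mul_nonneg (by linarith) h1) (by positivity)),
    div_le_iff₀ (by positivity)]
  calc (a - b) * (a ^ 2 + a * b + b ^ 2) ≤ L * (s ^ 2 + s * s + s ^ 2) := by
        have : b ≤ s := hba.trans has
        have : 0 ≤ a := hb0.trans hba
        gcongr
        linarith
    _ = _ := by ring

lemma tailCube_eq_zero {L s : ℝ} (hL : 0 ≤ L) (hs : s ≤ L) : tailCube L s = 0 := by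
  rw [tailCube, max_eq_right (by linarith), max_eq_right (by linarith)]; simp

lemma sum_moebSum_win (F : ℝ → ℝ) (ε x : ℝ) (hx : 0 ≤ x) :
    ∑ n ∈ win ε x, moebSum F x n / n =
      ∑ d ∈ ivl 0 x, (μ d : ℝ) / d * F (Real.log (x / d)) *
        ∑ k ∈ win ε (x / d), 1 / (k : ℝ) := by
  have h := sum_ivl_divisors (a := x * Real.exp (-ε)) (x := x) (by positivity)
    (fun d k => (μ d : ℝ) / d * F (Real.log (x / d)) * (1 / (k : ℝ)))
  rw [win]
  refine Eq.trans ?_ (h.trans ?_)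
  · refine Finset.sum_congr rfl fun n hn => ?_
    rw [moebSum, Finset.sum_div]
    refine Finset.sum_congr rfl fun d hd => ?_
    have hd0 : (0 : ℝ) < d := by exact_mod_cast Nat.pos_of_mem_divisors hd
    have hn0 : (0 : ℝ) < n := by exact_mod_cast pos_of_mem_ivl hn
    rw [Nat.cast_div (Nat.dvd_of_mem_divisors hd) hd0.ne']
    field_simp
  · refine Finset.sum_congr rfl fun d _ => ?_
    rw [Finset.mul_sum, win]
    have e : x * Real.exp (-ε) / d = x / d * Real.exp (-ε) := by ring
    rw [e]

lemma sum_inv_sqrt_le (N : ℕ) : ∑ k ∈ Finset.Ioc 0 N, 1 / √(k : ℝ) ≤ 2 * √N := by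
  induction N with
  | zero => simp
  | succ n ih =>
    rw [Finset.sum_Ioc_succ_top (by omega)]
    have h1 : √(n : ℝ) ^ 2 = n := Real.sq_sqrt (Nat.cast_nonneg n)
    have h2 : √((n + 1 : ℕ) : ℝ) ^ 2 = n + 1 := by
      rw [Real.sq_sqrt (Nat.cast_nonneg _)]; push_cast; ring
    have h3 : 0 < √((n + 1 : ℕ) : ℝ) := Real.sqrt_pos.2 (by positivity)
    have h4 : 0 ≤ √(n : ℝ) := Real.sqrt_nonneg _
    have h5 : 1 / √((n + 1 : ℕ) : ℝ) ≤ 2 * √((n + 1 : ℕ) : ℝ) - 2 * √(n : ℝ) := by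
      rw [div_le_iff₀ h3]
      nlinarith [sq_nonneg (√((n + 1 : ℕ) : ℝ) - √(n : ℝ))]
    linarith

lemma log_sq_le_sqrt {t : ℝ} (ht : 1 ≤ t) : Real.log t ^ 2 ≤ 16 * √t := by
  have h0 : 0 ≤ Real.log t := Real.log_nonneg ht
  have h1 : Real.log t / 4 + 1 ≤ Real.exp (Real.log t / 4) := Real.add_one_le_exp _
  have h2 : √t = Real.exp (Real.log t / 4) ^ 2 := by
    rw [Real.sqrt_eq_rpow, Real.rpow_def_of_pos (by linarith), ← Real.exp_nat_mul]
    congr 1; push_cast; ring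
  rw [h2]
  nlinarith

lemma abs_sum_tailCube_le {ε x L : ℝ} (hL : 1 ≤ L) (hε : ε = Real.exp (-L / 2)) (hx : 0 < x)
    (hv : 30 * L ≤ Real.log x) :
    |∑ n ∈ win ε x, moebSum (tailCube L) x n / n - 2 * ε * Real.log x| ≤ 300 * ε * L := by
  have hε0 : 0 < ε := by rw [hε]; positivity
  have hε1 : ε ≤ 1 := by rw [hε]; exact Real.exp_le_one_iff.2 (by linarith)
  have hL0 : 0 < L := by linarith
  set v := Real.log x with hvx
  have hxv : x = Real.exp v := (Real.exp_log hx).symm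
  have hlog : ∀ d ∈ ivl 0 x, Real.log (x / d) = v - Real.log d := fun d hd => by
    have hd0 : (0 : ℝ) < d := by exact_mod_cast pos_of_mem_ivl hd
    rw [Real.log_div hx.ne' hd0.ne']
  have hmain : ∑ d ∈ ivl 0 x, (μ d : ℝ) / d * tailCube L (Real.log (x / d)) =
      (moebCube x (v - L) - moebCube x (v - 2 * L)) / (3 * L) := by
    rw [moebCube, moebCube, ← Finset.sum_sub_distrib, Finset.sum_div]
    refine Finset.sum_congr rfl fun d hd => ?_
    rw [hlog d hd, tailCube, sub_right_comm v L, sub_right_comm v (2 * L)]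
    ring
  have hcube := abs_moebCube_sub_le (X := x) (w₁ := v - 2 * L) (w₂ := v - L) (by linarith)
    (by linarith) (by rw [hxv]; exact Real.exp_le_exp.2 (by linarith))
  have hmain2 : |∑ d ∈ ivl 0 x, (μ d : ℝ) / d * tailCube L (Real.log (x / d)) - (2 * v - 3 * L)|
      ≤ 20 := by
    rw [hmain]
    have e : (moebCube x (v - L) - moebCube x (v - 2 * L)) / (3 * L) - (2 * v - 3 * L) =
        (moebCube x (v - L) - moebCube x (v - 2 * L) - 3 * ((v - L) ^ 2 - (v - 2 * L) ^ 2)) /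
          (3 * L) := by
      field_simp; ring
    rw [e, abs_div, abs_of_pos (by positivity : 0 < 3 * L), div_le_iff₀ (by positivity)]
    refine hcube.trans (le_of_eq ?_)
    ring
  have herr : |∑ d ∈ ivl 0 x, (μ d : ℝ) / d * tailCube L (Real.log (x / d)) *
      (∑ k ∈ win ε (x / d), 1 / (k : ℝ) - ε)| ≤ 256 * ε := by
    calc _ ≤ ∑ d ∈ ivl 0 x, if (d : ℝ) ≤ x * ε ^ 2 then 128 / √x * (1 / √(d : ℝ)) else 0 := by
          refine (Finset.abs_sum_le_sum_abs _ _).trans (Finset.sum_le_sum fun d hd => ?_)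
          have hd0 : (0 : ℝ) < d := by exact_mod_cast pos_of_mem_ivl hd
          have hdx : 1 ≤ x / d := by
            rw [one_le_div hd0]; exact ((mem_ivl le_rfl).1 hd).2
          have hxd : 0 < x / d := by positivity
          split_ifs with hc
          · rw [abs_mul, abs_mul]
            have h1 : |(μ d : ℝ) / d| ≤ 1 / d := by
              rw [abs_div, abs_of_pos hd0]
              have h2 : |(μ d : ℝ)| ≤ 1 := by exact_mod_cast abs_moebius_le_one
              gcongr
            have h2 := (abs_tailCube_le hL0 (Real.log_nonneg hdx)).trans (log_sq_le_sqrt hdx)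
            have h3 := abs_sum_window_le hε0.le hε1 hxd
            rw [← win] at h3
            have hsx : 0 < √x := Real.sqrt_pos.2 hx
            have hsd : 0 < √(d : ℝ) := Real.sqrt_pos.2 hd0
            calc _ ≤ 1 / (d : ℝ) * (16 * √(x / d)) * (8 / (x / d)) := by gcongr
              _ = _ := by
                rw [Real.sqrt_div hx.le]
                nth_rewrite 2 [← Real.mul_self_sqrt hx.le]
                field_simp
                norm_num
          · have h1 : Real.log (x / d) ≤ L := by
              have h2 : x / d ≤ Real.exp L := by
                rw [div_le_iff₀ hd0]
                have h3 : ε ^ 2 = Real.exp (-L) := by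
                  rw [hε, ← Real.exp_nat_mul]; congr 1; push_cast; ring
                rw [h3, not_le] at hc
                have h4 : x = x * Real.exp (-L) * Real.exp L := by
                  rw [mul_assoc, ← Real.exp_add]; simp
                have := Real.exp_pos L
                rw [h4]
                nlinarith
              rw [← Real.log_exp L]
              exact Real.log_le_log hxd h2
            rw [tailCube_eq_zero hL0.le h1]; simp
      _ ≤ ∑ d ∈ Finset.Ioc 0 ⌊x * ε ^ 2⌋₊, 128 / √x * (1 / √(d : ℝ)) := by
          rw [← Finset.sum_filter]
          refine Finset.sum_le_sum_of_subset_of_nonneg (fun d hd => ?_) fun _ _ _ => by positivity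
          rw [Finset.mem_filter] at hd
          exact Finset.mem_Ioc.2 ⟨pos_of_mem_ivl hd.1, Nat.le_floor hd.2⟩
      _ ≤ 128 / √x * (2 * (√x * ε)) := by
          rw [← Finset.mul_sum]
          have h1 : √(⌊x * ε ^ 2⌋₊ : ℝ) ≤ √x * ε := by
            rw [← Real.sqrt_sq hε0.le, ← Real.sqrt_mul hx.le, Real.sqrt_sq hε0.le]
            exact Real.sqrt_le_sqrt (Nat.floor_le (by positivity))
          have h2 := sum_inv_sqrt_le ⌊x * ε ^ 2⌋₊
          gcongr
          linarith
      _ = _ := by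
          have hsx : 0 < √x := Real.sqrt_pos.2 hx
          field_simp; norm_num
  rw [sum_moebSum_win _ _ _ hx.le]
  have e : ∑ d ∈ ivl 0 x, (μ d : ℝ) / d * tailCube L (Real.log (x / d)) *
        ∑ k ∈ win ε (x / d), 1 / (k : ℝ) =
      ∑ d ∈ ivl 0 x, (μ d : ℝ) / d * tailCube L (Real.log (x / d)) *
        (∑ k ∈ win ε (x / d), 1 / (k : ℝ) - ε) +
      ε * ∑ d ∈ ivl 0 x, (μ d : ℝ) / d * tailCube L (Real.log (x / d)) := by
    rw [Finset.mul_sum, ← Finset.sum_add_distrib]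
    refine Finset.sum_congr rfl fun d _ => ?_
    ring
  rw [e]
  rw [abs_le] at herr hmain2 ⊢
  have h1 : ε ≤ ε * L := le_mul_of_one_le_right hε0.le hL
  constructor <;> nlinarith

/-- Selberg's symmetry formula in logarithmic windows of width `exp (-L / 2)`. -/
lemma abs_sum_selberg_sub_le {ε x L : ℝ} (hL : 1 ≤ L) (hε : ε = Real.exp (-L / 2)) (hx : 0 < x)
    (hv : 30 * L ≤ Real.log x) :
    |∑ n ∈ win ε x, selberg n / n - 2 * ε * Real.log x| ≤ 643600 * ε * L := by
  have hε0 : 0 < ε := by rw [hε]; positivity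
  have hε1 : ε ≤ 1 := by rw [hε]; exact Real.exp_le_one_iff.2 (by linarith)
  have hL0 : 0 < L := by linarith
  set v := Real.log x with hvx
  have hxv : x = Real.exp v := (Real.exp_log hx).symm
  have h1 := abs_sum_tailCube_le hL hε hx hv
  have h2 := roughMass_cutoff_le hε0 hε1 hx hL (Y := Real.exp (2 * L)) rfl (by
    rw [← Real.exp_nat_mul, hε, hxv, ← Real.exp_add]
    refine Real.exp_le_exp.2 ?_
    push_cast
    linarith)
  have h3 : |∑ n ∈ win ε x, moebSum (cutoff L) x n / n| ≤ 642895 * ε * L := by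
    refine le_trans ?_ h2
    have hr : roughMass ε (cutoff L) 0 x = ∑ n ∈ win ε x, |moebSum (cutoff L) x n| / n := by
      rw [roughMass, Finset.filter_true_of_mem]
      intro n _ p hp _
      exact_mod_cast hp.pos
    rw [hr]
    refine (Finset.abs_sum_le_sum_abs _ _).trans (le_of_eq (Finset.sum_congr rfl fun n _ => ?_))
    rw [abs_div, Nat.abs_cast]
  have h4 := sum_vonMangoldt_win_le hL hε hx hv
  have h5 : ∑ n ∈ win ε x, selberg n / n = ∑ n ∈ win ε x, moebSum (tailCube L) x n / n +
      ∑ n ∈ win ε x, moebSum (cutoff L) x n / n -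
      ∑ n ∈ win ε x, (2 * Real.log (x / n) - 3 * L) * (Λ n / n) := by
    rw [← Finset.sum_add_distrib, ← Finset.sum_sub_distrib]
    refine Finset.sum_congr rfl fun n hn => ?_
    have hn1 : 1 < n := by
      have h6 := ((mem_win hx.le).1 hn).1
      rw [hxv, ← Real.exp_add] at h6
      have h7 : 1 ≤ Real.exp (v + -ε) := Real.one_le_exp (by linarith)
      exact_mod_cast h7.trans_lt h6
    have h6 := moebSum_quadratic hn1 hx (-(3 * L)) (7 / 3 * L ^ 2)
    have h7 : moebSum (tailCube L) x n + moebSum (cutoff L) x n =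
        moebSum (fun s => s ^ 2 + -(3 * L) * s + 7 / 3 * L ^ 2) x n := by
      rw [moebSum, moebSum, moebSum, ← Finset.sum_add_distrib]
      refine Finset.sum_congr rfl fun d _ => ?_
      rw [← mul_add, tailCube_add_cutoff hL0]
    rw [← add_div, h7, h6]
    ring
  have h6 : |∑ n ∈ win ε x, (2 * Real.log (x / n) - 3 * L) * (Λ n / n)| ≤ 3 * L * (81 * ε) := by
    refine (Finset.abs_sum_le_sum_abs _ _).trans
      (le_trans ?_ (mul_le_mul_of_nonneg_left h4 (by positivity)))
    rw [Finset.mul_sum]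
    refine Finset.sum_le_sum fun n hn => ?_
    have hn0 : (0 : ℝ) < n := by exact_mod_cast pos_of_mem_ivl hn
    have h7 := (mem_win hx.le).1 hn
    have h8 : 0 ≤ Λ n / (n : ℝ) := div_nonneg vonMangoldt_nonneg hn0.le
    have h9 : 0 ≤ Real.log (x / n) := Real.log_nonneg ((one_le_div hn0).2 h7.2)
    have h10 : Real.log (x / n) ≤ ε := by
      rw [← Real.log_exp ε]
      refine Real.log_le_log (by positivity) ?_
      rw [div_le_iff₀ hn0]
      have h11 : x = x * Real.exp (-ε) * Real.exp ε := by
        rw [mul_assoc, ← Real.exp_add]; simp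
      have := Real.exp_pos ε
      nlinarith
    rw [abs_mul, abs_of_nonneg h8]
    gcongr
    rw [abs_le]
    constructor <;> linarith
  rw [h5]
  have h7 : 0 < ε * L := by positivity
  rw [abs_le] at h1 h3 h6 ⊢
  constructor <;> nlinarith

end Rarefaction

namespace Rarefaction

open Finset ArithmeticFunction MeasureTheory

/-- The density of prime powers, weighted by `Λ n / n`, in the window `log n ∈ (v - ε, v]`. -/
noncomputable def dens (ε v : ℝ) : ℝ := (∑ n ∈ win ε (Real.exp v), Λ n / n) / ε

/-- The normalised indicator function of `[0, ε)`. -/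
noncomputable def bump (ε t : ℝ) : ℝ := if 0 ≤ t ∧ t < ε then 1 / ε else 0

lemma intervalIntegrable_of_measurable_bound {f : ℝ → ℝ} (hf : Measurable f) {a b C : ℝ}
    (hC : ∀ w ∈ Set.uIcc a b, |f w| ≤ C) : IntervalIntegrable f volume a b := by
  refine (intervalIntegrable_const (c := C)).mono_fun hf.aestronglyMeasurable ?_
  filter_upwards [ae_restrict_mem measurableSet_uIoc] with w hw
  rw [Real.norm_eq_abs, Real.norm_eq_abs]
  exact (hC w (Set.uIoc_subset_uIcc hw)).trans (le_abs_self C)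

lemma measurable_dens (ε : ℝ) : Measurable (dens ε) := by
  have h : dens ε = (fun q : ℕ × ℕ => (∑ n ∈ Finset.Ioc q.1 q.2, Λ n / n) / ε) ∘
      fun v => (⌊Real.exp v * Real.exp (-ε)⌋₊, ⌊Real.exp v⌋₊) := rfl
  rw [h]
  refine (Measurable.of_discrete (f := _)).comp ?_
  exact ((Real.measurable_exp.mul_const _).nat_floor).prodMk Real.measurable_exp.nat_floor

lemma dens_nonneg {ε : ℝ} (hε : 0 < ε) (v : ℝ) : 0 ≤ dens ε v :=
  div_nonneg (Finset.sum_nonneg fun _ _ => div_nonneg vonMangoldt_nonneg (Nat.cast_nonneg _)) hε.le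

lemma dens_eq_sum {ε v V : ℝ} (hvV : v ≤ V) :
    dens ε v = ∑ d ∈ ivl 0 (Real.exp V), Λ d / d * bump ε (v - Real.log d) := by
  rw [dens, Finset.sum_div]
  have hsub : win ε (Real.exp v) ⊆ ivl 0 (Real.exp V) :=
    (ivl_mono_left (by positivity)).trans (ivl_mono_right (Real.exp_le_exp.2 hvV))
  have key : ∀ d : ℕ, 0 < d →
      (d ∈ win ε (Real.exp v) ↔ 0 ≤ v - Real.log d ∧ v - Real.log d < ε) := by
    intro d hd
    have hd0 : (0 : ℝ) < d := by exact_mod_cast hd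
    rw [mem_win (Real.exp_pos v).le, ← Real.exp_add, ← Real.lt_log_iff_exp_lt hd0,
      ← Real.log_le_iff_le_exp hd0, and_comm]
    refine and_congr ?_ ?_ <;> constructor <;> intro h <;> linarith
  rw [← Finset.sum_subset hsub]
  · refine Finset.sum_congr rfl fun d hd => ?_
    rw [bump, if_pos ((key d (pos_of_mem_ivl hd)).1 hd)]
    ring
  · intro d hd hd'
    rw [bump, if_neg (fun h => hd' ((key d (pos_of_mem_ivl hd)).2 h)), mul_zero]

lemma dens_eq_zero {ε v : ℝ} (hv : v < Real.log 2) : dens ε v = 0 := by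
  rw [dens, Finset.sum_eq_zero, zero_div]
  intro n hn
  have h1 : (n : ℝ) < 2 := by
    refine ((mem_win (Real.exp_pos v).le).1 hn).2.trans_lt ?_
    rw [← Real.exp_log (by norm_num : (0 : ℝ) < 2)]
    exact Real.exp_lt_exp.2 hv
  have h2 : n < 2 := by exact_mod_cast h1
  have h3 := pos_of_mem_ivl hn
  obtain rfl : n = 1 := by omega
  simp

lemma dens_eq_zero_of_neg {ε v : ℝ} (hv : v < 0) : dens ε v = 0 :=
  dens_eq_zero (hv.trans (Real.log_pos (by norm_num)))

lemma bump_nonneg {ε : ℝ} (hε : 0 < ε) (t : ℝ) : 0 ≤ bump ε t := by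
  rw [bump]; split_ifs <;> positivity

lemma measurable_bump (ε : ℝ) : Measurable (bump ε) := by
  refine Measurable.ite ?_ measurable_const measurable_const
  exact (measurableSet_Ici (a := (0 : ℝ))).inter (measurableSet_Iio (a := ε))

lemma exists_dens_le (ε V : ℝ) (hε : 0 < ε) : ∃ C, ∀ v ≤ V, |dens ε v| ≤ C := by
  refine ⟨∑ d ∈ ivl 0 (Real.exp V), Λ d / d * (1 / ε), fun v hv => ?_⟩
  rw [abs_of_nonneg (dens_nonneg hε v), dens_eq_sum hv]
  refine Finset.sum_le_sum fun d _ => mul_le_mul_of_nonneg_left ?_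
    (div_nonneg vonMangoldt_nonneg (Nat.cast_nonneg d))
  rw [bump]
  split_ifs
  · exact le_rfl
  · positivity

lemma intervalIntegrable_dens {ε : ℝ} (hε : 0 < ε) (a b : ℝ) :
    IntervalIntegrable (dens ε) volume a b := by
  obtain ⟨C, hC⟩ := exists_dens_le ε (max a b) hε
  exact intervalIntegrable_of_measurable_bound (measurable_dens ε)
    fun w hw => hC w hw.2

lemma integral_bump_mul {ε l T : ℝ} (hε : 0 < ε) (hl : 0 < l) (hlT : l + ε ≤ T) (k : ℝ → ℝ) :
    ∫ w in 0..T, bump ε (w - l) * k w = (1 / ε) * ∫ w in l..l + ε, k w := by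
  rw [intervalIntegral.integral_of_le (by linarith), intervalIntegral.integral_of_le (by linarith),
    ← integral_Ico_eq_integral_Ioc (x := l) (y := l + ε), ← integral_const_mul]
  have h : (fun w => bump ε (w - l) * k w) =
      (Set.Ico l (l + ε)).indicator (fun w => 1 / ε * k w) := by
    funext w
    rw [Set.indicator_apply, bump]
    have : w ∈ Set.Ico l (l + ε) ↔ (0 ≤ w - l ∧ w - l < ε) := by
      rw [Set.mem_Ico]
      constructor <;> rintro ⟨h1, h2⟩ <;> constructor <;> linarith
    simp only [this]
    split_ifs <;> simp
  rw [h, setIntegral_indicator measurableSet_Ico]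
  congr 2
  rw [Set.inter_eq_right]
  intro w hw
  exact ⟨hl.trans_le hw.1, hw.2.le.trans hlT⟩

lemma integral_bump_le {ε l T : ℝ} (hε : 0 < ε) (hl : 0 < l) (hT : 0 ≤ T) :
    ∫ w in 0..T, bump ε (w - l) ≤ 1 := by
  have hm : Measurable fun w => bump ε (w - l) :=
    (measurable_bump ε).comp (measurable_id.sub_const l)
  have hi : ∀ a b, IntervalIntegrable (fun w => bump ε (w - l)) volume a b := fun a b =>
    intervalIntegrable_of_measurable_bound hm (C := 1 / ε) fun w _ => by
      rw [abs_of_nonneg (bump_nonneg hε _), bump]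
      split_ifs
      · exact le_rfl
      · positivity
  have h1 := integral_bump_mul (T := max T (l + ε)) hε hl (le_max_right _ _) (fun _ => 1)
  simp only [mul_one, intervalIntegral.integral_const, smul_eq_mul, add_sub_cancel_left] at h1
  rw [one_div_mul_cancel hε.ne'] at h1
  rw [← h1]
  exact intervalIntegral.integral_mono_interval le_rfl hT (le_max_left _ _)
    (Filter.Eventually.of_forall fun w => bump_nonneg hε _) (hi _ _)

lemma sum_vonMangoldt_congr {X : ℝ} {F G : ℕ → ℝ}
    (h : ∀ d ∈ ivl 0 X, 0 < Real.log d → F d = G d) :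
    ∑ d ∈ ivl 0 X, Λ d / d * F d = ∑ d ∈ ivl 0 X, Λ d / d * G d := by
  refine Finset.sum_congr rfl fun d hd => ?_
  have hd0 := pos_of_mem_ivl hd
  rcases Nat.eq_or_lt_of_le (show 1 ≤ d from hd0) with h1 | h1
  · subst h1; simp
  · rw [h d hd (Real.log_pos (by exact_mod_cast h1))]

lemma integral_dens_mul {ε V : ℝ} (hε : 0 < ε) (hV : 0 ≤ V) {k : ℝ → ℝ} (hk : Measurable k)
    {C : ℝ} (hC : ∀ w ∈ Set.Icc 0 V, |k w| ≤ C) :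
    ∫ w in 0..V, dens ε w * k w =
      ∑ d ∈ ivl 0 (Real.exp V), Λ d / d * ∫ w in 0..V, bump ε (w - Real.log d) * k w := by
  have h1 : ∫ w in 0..V, dens ε w * k w =
      ∫ w in 0..V, ∑ d ∈ ivl 0 (Real.exp V), Λ d / d * (bump ε (w - Real.log d) * k w) := by
    refine intervalIntegral.integral_congr fun w hw => ?_
    rw [Set.uIcc_of_le hV] at hw
    rw [dens_eq_sum hw.2, Finset.sum_mul]
    refine Finset.sum_congr rfl fun d _ => by ring
  rw [h1, intervalIntegral.integral_finsetSum]
  · simp only [intervalIntegral.integral_const_mul]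
  · intro d _
    refine IntervalIntegrable.const_mul (intervalIntegrable_of_measurable_bound
      (((measurable_bump ε).comp (measurable_id.sub_const _)).mul hk) (C := 1 / ε * C)
      fun w hw => ?_) _
    rw [Set.uIcc_of_le hV] at hw
    change |bump ε (w - Real.log d) * k w| ≤ _
    rw [abs_mul, abs_of_nonneg (bump_nonneg hε _)]
    have h2 : bump ε (w - Real.log d) ≤ 1 / ε := by
      rw [bump]
      split_ifs
      · exact le_rfl
      · positivity
    gcongr
    exact hC w hw

/-- The Mertens estimate for the density. -/
lemma abs_integral_dens_sub_le {ε v : ℝ} (hε : 0 < ε) (hε1 : ε ≤ 1) (hv : 0 ≤ v) :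
    |(∫ w in 0..v, dens ε w) - v| ≤ 7 := by
  have h1 := integral_dens_mul hε hv (measurable_const (a := (1 : ℝ))) (C := 1) (by simp)
  simp only [mul_one] at h1
  have h0 : ∀ d : ℕ, 0 ≤ Λ d / (d : ℝ) := fun d => div_nonneg vonMangoldt_nonneg (Nat.cast_nonneg d)
  have hb0 : ∀ l, 0 ≤ ∫ w in 0..v, bump ε (w - l) := fun l =>
    intervalIntegral.integral_nonneg hv fun w _ => bump_nonneg hε _
  have hup : ∫ w in 0..v, dens ε w ≤ v + 6 := by
    rw [h1]
    have h2 := (abs_le.1 (abs_sum_vonMangoldt_div_sub_log_le (Real.one_le_exp hv))).2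
    rw [Real.log_exp] at h2
    have h3 : ∑ d ∈ ivl 0 (Real.exp v), Λ d / d * ∫ w in 0..v, bump ε (w - Real.log d) ≤
        ∑ d ∈ ivl 0 (Real.exp v), Λ d / d := by
      refine Finset.sum_le_sum fun d hd => ?_
      rcases Nat.eq_or_lt_of_le (show 1 ≤ d from pos_of_mem_ivl hd) with h | h
      · subst h; simp
      · exact mul_le_of_le_one_right (h0 d)
          (integral_bump_le hε (Real.log_pos (by exact_mod_cast h)) hv)
    linarith
  have hlow : v - 7 ≤ ∫ w in 0..v, dens ε w := by
    rcases le_total v ε with hvε | hvε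
    · have := intervalIntegral.integral_nonneg (μ := volume) hv fun w _ => dens_nonneg hε w
      linarith
    · rw [h1]
      have h2 := (abs_le.1 (abs_sum_vonMangoldt_div_sub_log_le
        (Real.one_le_exp (sub_nonneg.2 hvε)))).1
      rw [Real.log_exp] at h2
      have h3 : ∑ d ∈ ivl 0 (Real.exp (v - ε)), Λ d / d ≤
          ∑ d ∈ ivl 0 (Real.exp v), Λ d / d * ∫ w in 0..v, bump ε (w - Real.log d) := by
        refine le_trans ?_ (Finset.sum_le_sum_of_subset_of_nonneg
          (ivl_mono_right (Real.exp_le_exp.2 (by linarith : v - ε ≤ v)))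
          fun d _ _ => mul_nonneg (h0 d) (hb0 _))
        have h4 := sum_vonMangoldt_congr (X := Real.exp (v - ε))
          (F := fun d => ∫ w in 0..v, bump ε (w - Real.log d)) (G := fun _ => 1) ?_
        · rw [h4]; simp
        · intro d hd hd0
          have h5 : Real.log d ≤ v - ε := by
            have := Real.log_le_log (by exact_mod_cast pos_of_mem_ivl hd)
              ((mem_ivl le_rfl).1 hd).2
            rwa [Real.log_exp] at this
          have h6 := integral_bump_mul (T := v) hε hd0 (by linarith) (fun _ => 1)
          simp only [mul_one, intervalIntegral.integral_const, smul_eq_mul,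
            add_sub_cancel_left] at h6
          rw [h6, one_div_mul_cancel hε.ne']
      linarith
  rw [abs_le]
  constructor <;> linarith

lemma dens_le {ε L v : ℝ} (hL : 1 ≤ L) (hε : ε = Real.exp (-L / 2)) (hv : 30 * L ≤ v) :
    dens ε v ≤ 81 := by
  have hε0 : 0 < ε := by rw [hε]; positivity
  rw [dens, div_le_iff₀ hε0]
  exact sum_vonMangoldt_win_le hL hε (Real.exp_pos v) (by rwa [Real.log_exp])

/-- Selberg's identity for the density, before averaging. -/
lemma abs_selberg_dens_le {ε L v : ℝ} (hL : 1 ≤ L) (hε : ε = Real.exp (-L / 2))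
    (hv : 30 * L ≤ v) :
    |v * dens ε v + ∑ d ∈ ivl 0 (Real.exp v), Λ d / d * dens ε (v - Real.log d) - 2 * v| ≤
      643700 * L := by
  have hε0 : 0 < ε := by rw [hε]; positivity
  have hε1 : ε ≤ 1 := by rw [hε]; exact Real.exp_le_one_iff.2 (by linarith)
  have hS := abs_sum_selberg_sub_le hL hε (Real.exp_pos v) (by rwa [Real.log_exp])
  rw [Real.log_exp] at hS
  have h1 : ∑ n ∈ win ε (Real.exp v), (∑ d ∈ n.divisors, Λ d * Λ (n / d)) / n =
      ε * ∑ d ∈ ivl 0 (Real.exp v), Λ d / d * dens ε (v - Real.log d) := by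
    have h := sum_ivl_divisors (a := Real.exp v * Real.exp (-ε)) (x := Real.exp v) (by positivity)
      (fun d k => Λ d / d * (Λ k / k))
    calc _ = ∑ n ∈ win ε (Real.exp v), ∑ d ∈ n.divisors,
          Λ d / d * (Λ (n / d) / (n / d : ℕ)) := by
          refine Finset.sum_congr rfl fun n hn => ?_
          rw [Finset.sum_div]
          refine Finset.sum_congr rfl fun d hd => ?_
          have hdn := Nat.dvd_of_mem_divisors hd
          have : (n : ℝ) = d * (n / d : ℕ) := by
            exact_mod_cast (Nat.mul_div_cancel' hdn).symm
          rw [div_mul_div_comm, ← this]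
      _ = _ := by
          rw [win, h, Finset.mul_sum]
          refine Finset.sum_congr rfl fun d hd => ?_
          have hd0 : (0 : ℝ) < d := by exact_mod_cast pos_of_mem_ivl hd
          rw [dens, win, Real.exp_sub, Real.exp_log hd0, ← Finset.mul_sum,
            show Real.exp v * Real.exp (-ε) / d = Real.exp v / d * Real.exp (-ε) by ring]
          field_simp
  have h2 : |∑ n ∈ win ε (Real.exp v), Λ n * Real.log n / n - ε * (v * dens ε v)| ≤
      81 * ε := by
    have h3 : ε * (v * dens ε v) = ∑ n ∈ win ε (Real.exp v), Λ n / n * v := by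
      rw [← Finset.sum_mul, dens]; field_simp
    rw [h3, ← Finset.sum_sub_distrib]
    refine (Finset.abs_sum_le_sum_abs _ _).trans (le_trans ?_
      (sum_vonMangoldt_win_le hL hε (Real.exp_pos v) (by rwa [Real.log_exp])))
    refine Finset.sum_le_sum fun n hn => ?_
    have hn0 : (0 : ℝ) < n := by exact_mod_cast pos_of_mem_ivl hn
    obtain ⟨ha, hb⟩ := (mem_win (Real.exp_pos v).le).1 hn
    rw [← Real.exp_add, ← Real.lt_log_iff_exp_lt hn0] at ha
    rw [← Real.log_le_iff_le_exp hn0] at hb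
    rw [show Λ n * Real.log n / n - Λ n / n * v = Λ n / n * (Real.log n - v) by ring, abs_mul,
      abs_of_nonneg (div_nonneg vonMangoldt_nonneg hn0.le)]
    refine mul_le_of_le_one_right (div_nonneg vonMangoldt_nonneg hn0.le) ?_
    rw [abs_le]; constructor <;> linarith
  have h4 : ∑ n ∈ win ε (Real.exp v), selberg n / n =
      ∑ n ∈ win ε (Real.exp v), Λ n * Real.log n / n +
        ε * ∑ d ∈ ivl 0 (Real.exp v), Λ d / d * dens ε (v - Real.log d) := by
    rw [← h1, ← Finset.sum_add_distrib]
    exact Finset.sum_congr rfl fun n _ => by rw [selberg, add_div]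
  rw [h4] at hS
  set S := ∑ d ∈ ivl 0 (Real.exp v), Λ d / d * dens ε (v - Real.log d)
  set T := ∑ n ∈ win ε (Real.exp v), Λ n * Real.log n / n
  have h5 : ε * |v * dens ε v + S - 2 * v| ≤ ε * (643700 * L) := by
    rw [← abs_of_pos hε0, ← abs_mul, abs_of_pos hε0]
    have : ε ≤ ε * L := le_mul_of_one_le_right hε0.le hL
    rw [abs_le] at *
    constructor <;> nlinarith
  exact le_of_mul_le_mul_left h5 hε0

lemma dens_le_two_add {ε L v : ℝ} (hL : 1 ≤ L) (hε : ε = Real.exp (-L / 2)) (hv : 30 * L ≤ v) :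
    dens ε v ≤ 2 + 643700 * L / v := by
  have hε0 : 0 < ε := by rw [hε]; positivity
  have hv0 : 0 < v := by linarith
  have h1 := (abs_le.1 (abs_selberg_dens_le hL hε hv)).2
  have h2 : 0 ≤ ∑ d ∈ ivl 0 (Real.exp v), Λ d / d * dens ε (v - Real.log d) :=
    Finset.sum_nonneg fun d _ => mul_nonneg
      (div_nonneg vonMangoldt_nonneg (Nat.cast_nonneg d)) (dens_nonneg hε0 _)
  have h3 : v * dens ε v ≤ 2 * v + 643700 * L := by linarith
  calc dens ε v = v * dens ε v / v := by field_simp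
    _ ≤ (2 * v + 643700 * L) / v := by gcongr
    _ = _ := by field_simp

/-- In the absence of primes the density is tiny. -/
lemma dens_le_of_no_prime {ε L v : ℝ} (hL : 1 ≤ L) (hε : ε = Real.exp (-L / 2))
    (hv : 30 * L ≤ v)
    (hp : ∀ p : ℕ, p.Prime → Real.exp (v - ε) < p → (p : ℝ) ≤ Real.exp v → False) :
    dens ε v ≤ 6 / v := by
  have hε0 : 0 < ε := by rw [hε]; positivity
  have hε1 : ε ≤ 1 := by rw [hε]; exact Real.exp_le_one_iff.2 (by linarith)
  have h1 := sum_not_prime_vonMangoldt_le hε1 (Real.one_le_exp (by linarith : 0 ≤ v))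
  rw [Real.log_exp, Finset.filter_true_of_mem] at h1
  · have h2 := mul_exp_neg_half_le hL hv
    rw [← hε] at h2
    rw [dens, div_le_iff₀ hε0]
    calc _ ≤ 6 * v * Real.exp (-v / 2) := h1
      _ ≤ 6 * (ε / v) := by linarith
      _ = _ := by ring
  · intro n hn hnp
    obtain ⟨ha, hb⟩ := (mem_win (Real.exp_pos v).le).1 hn
    rw [← Real.exp_add] at ha
    exact hp n hnp ha hb

/-- The average of `g` over `[v - ε, v]`. -/
noncomputable def avg (ε : ℝ) (g : ℝ → ℝ) (v : ℝ) : ℝ := (∫ u in (v - ε)..v, g u) / ε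

lemma sum_dens_extend {ε u V : ℝ} (huV : u ≤ V) :
    ∑ d ∈ ivl 0 (Real.exp u), Λ d / d * dens ε (u - Real.log d) =
      ∑ d ∈ ivl 0 (Real.exp V), Λ d / d * dens ε (u - Real.log d) := by
  refine Finset.sum_subset (ivl_mono_right (Real.exp_le_exp.2 huV)) fun d hd hd' => ?_
  have hd0 : (0 : ℝ) < d := by exact_mod_cast pos_of_mem_ivl hd
  have h : u < Real.log d := by
    rw [mem_ivl le_rfl] at hd'
    rw [Real.lt_log_iff_exp_lt hd0]
    by_contra! h
    exact hd' ⟨hd0, h⟩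
  rw [dens_eq_zero_of_neg (by linarith), mul_zero]

lemma intervalIntegrable_dens_sub {ε : ℝ} (hε : 0 < ε) (l a b : ℝ) :
    IntervalIntegrable (fun u => dens ε (u - l)) volume a b := by
  have := (intervalIntegrable_dens hε (a - l) (b - l)).comp_sub_right l
  simpa using this

lemma integral_dens_conv {ε v : ℝ} (hε : 0 < ε) (hv : 0 ≤ v) :
    ∫ w in 0..v, dens ε w * dens ε (v - w) =
      avg ε (fun u => ∑ d ∈ ivl 0 (Real.exp u), Λ d / d * dens ε (u - Real.log d)) v := by
  obtain ⟨C, hC⟩ := exists_dens_le ε v hε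
  have hk : Measurable fun w => dens ε (v - w) :=
    (measurable_dens ε).comp (measurable_const.sub measurable_id)
  have h1 : ∫ w in 0..v, dens ε w * dens ε (v - w) =
      ∫ w in 0..(v + ε), dens ε w * dens ε (v - w) := by
    obtain ⟨D, hD⟩ := exists_dens_le ε (v + ε) hε
    have hi : ∀ b ∈ Set.Icc 0 (v + ε), IntervalIntegrable (fun w => dens ε w * dens ε (v - w))
        volume 0 b := fun b hb =>
      intervalIntegrable_of_measurable_bound ((measurable_dens ε).mul hk) (C := D * C)
        fun w hw => by
          rw [Set.uIcc_of_le hb.1] at hw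
          change |dens ε w * dens ε (v - w)| ≤ _
          rw [abs_mul]
          have := hD w (hw.2.trans hb.2)
          have := hC (v - w) (by linarith [hw.1])
          have := (abs_nonneg (dens ε w))
          gcongr
          · linarith
    have hz : ∫ w in v..(v + ε), dens ε w * dens ε (v - w) = 0 := by
      refine intervalIntegral.integral_zero_ae (Filter.Eventually.of_forall fun w hw => ?_)
      rw [Set.uIoc_of_le (by linarith)] at hw
      rw [dens_eq_zero_of_neg (by linarith [hw.1] : v - w < 0), mul_zero]
    rw [← intervalIntegral.integral_add_adjacent_intervals (hi v ⟨hv, by linarith⟩)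
      ((hi v ⟨hv, by linarith⟩).symm.trans (hi (v + ε) ⟨by linarith, le_rfl⟩)), hz, add_zero]
  rw [h1, integral_dens_mul hε (by linarith) hk (C := C) (fun w hw => hC _ (by linarith [hw.1]))]
  have h2 : ∫ u in (v - ε)..v, ∑ d ∈ ivl 0 (Real.exp u), Λ d / d * dens ε (u - Real.log d) =
      ∫ u in (v - ε)..v, ∑ d ∈ ivl 0 (Real.exp (v + ε)), Λ d / d * dens ε (u - Real.log d) := by
    refine intervalIntegral.integral_congr fun u hu => ?_
    rw [Set.uIcc_of_le (by linarith)] at hu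
    exact sum_dens_extend (by linarith [hu.2])
  rw [avg, h2, intervalIntegral.integral_finsetSum
    fun d _ => (intervalIntegrable_dens_sub hε _ _ _).const_mul _]
  simp only [intervalIntegral.integral_const_mul]
  rw [Finset.sum_div]
  simp only [mul_div_assoc]
  refine sum_vonMangoldt_congr fun d _ hl => ?_
  rcases le_or_gt (Real.log d) v with hlv | hlv
  · rw [integral_bump_mul hε hl (by linarith), one_div, div_eq_inv_mul (∫ u in (v - ε)..v, _)]
    congr 1
    have h3 := intervalIntegral.integral_comp_sub_left (fun u => dens ε (u - Real.log d))
      (a := Real.log d) (b := Real.log d + ε) (v + Real.log d)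
    have e1 : v + Real.log d - (Real.log d + ε) = v - ε := by ring
    have e2 : v + Real.log d - Real.log d = v := by ring
    rw [e1, e2] at h3
    rw [← h3]
    congr 1
    funext w
    congr 1
    ring
  · have hz : ∫ u in (v - ε)..v, dens ε (u - Real.log d) = 0 := by
      refine intervalIntegral.integral_zero_ae (Filter.Eventually.of_forall fun u hu => ?_)
      rw [Set.uIoc_of_le (by linarith)] at hu
      exact dens_eq_zero_of_neg (by linarith [hu.2])
    rw [hz, zero_div]
    refine intervalIntegral.integral_zero_ae (Filter.Eventually.of_forall fun w _ => ?_)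
    rcases lt_or_ge w (Real.log d) with h | h
    · rw [bump, if_neg (fun h' => by linarith [h'.1]), zero_mul]
    · rw [dens_eq_zero_of_neg (by linarith), mul_zero]

/-- Selberg's identity for the density. -/
lemma abs_avg_dens_add_conv_sub_le {ε L v : ℝ} (hL : 1 ≤ L) (hε : ε = Real.exp (-L / 2))
    (hv : 30 * L + 1 ≤ v) :
    |v * avg ε (dens ε) v + (∫ w in 0..v, dens ε w * dens ε (v - w)) - 2 * v| ≤ 643800 * L := by
  have hε0 : 0 < ε := by rw [hε]; positivity
  have hε1 : ε ≤ 1 := by rw [hε]; exact Real.exp_le_one_iff.2 (by linarith)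
  have hv0 : 0 ≤ v := by linarith
  rw [integral_dens_conv hε0 hv0]
  set S : ℝ → ℝ := fun u => ∑ d ∈ ivl 0 (Real.exp u), Λ d / d * dens ε (u - Real.log d) with hS
  have hSi : IntervalIntegrable S volume (v - ε) v := by
    refine IntervalIntegrable.congr (f := fun u => ∑ d ∈ ivl 0 (Real.exp v),
      Λ d / d * dens ε (u - Real.log d)) (fun u hu => ?_) ?_
    · rw [Set.uIoc_of_le (by linarith)] at hu
      exact (sum_dens_extend hu.2).symm
    · have := IntervalIntegrable.sum (ivl 0 (Real.exp v)) (μ := volume) (a := v - ε) (b := v)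
        (f := fun d u => Λ d / d * dens ε (u - Real.log d))
        (fun d _ => (intervalIntegrable_dens_sub hε0 _ _ _).const_mul _)
      refine this.congr fun u _ => ?_
      simp
  have hpt : ∀ u ∈ Set.uIoc (v - ε) v, ‖v * dens ε u + S u - 2 * v‖ ≤ 643800 * L := by
    intro u hu
    rw [Set.uIoc_of_le (by linarith)] at hu
    have h1 := abs_selberg_dens_le hL hε (v := u) (by linarith [hu.1])
    have h2 := dens_le hL hε (v := u) (by linarith [hu.1])
    have h3 := dens_nonneg hε0 u
    change |u * dens ε u + S u - 2 * u| ≤ _ at h1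
    rw [Real.norm_eq_abs]
    rw [abs_le] at *
    constructor <;> nlinarith [hu.1, hu.2]
  have h := intervalIntegral.norm_integral_le_of_norm_le_const hpt
  rw [intervalIntegral.integral_sub (((intervalIntegrable_dens hε0 _ _).const_mul _).add hSi)
    intervalIntegrable_const, intervalIntegral.integral_add
    ((intervalIntegrable_dens hε0 _ _).const_mul _) hSi, intervalIntegral.integral_const,
    intervalIntegral.integral_const_mul, sub_sub_cancel, abs_of_pos hε0, smul_eq_mul,
    Real.norm_eq_abs] at h
  rw [avg, avg]
  have h4 : v * ((∫ u in (v - ε)..v, dens ε u) / ε) + (∫ u in (v - ε)..v, S u) / ε - 2 * v =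
      (v * (∫ u in (v - ε)..v, dens ε u) + (∫ u in (v - ε)..v, S u) - ε * (2 * v)) / ε := by
    field_simp
  rw [h4, abs_div, abs_of_pos hε0, div_le_iff₀ hε0]
  exact h

lemma intervalIntegrable_of_bound {k : ℝ → ℝ} (hk : Measurable k) {C : ℝ} (hC : ∀ w, |k w| ≤ C)
    (a b : ℝ) : IntervalIntegrable k volume a b :=
  intervalIntegrable_of_measurable_bound hk fun w _ => hC w

lemma abs_mul_le_one {x y : ℝ} (hx : |x| ≤ 1) (hy : |y| ≤ 1) : |x * y| ≤ 1 := by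
  rw [abs_mul]; exact mul_le_one₀ hx (abs_nonneg _) hy

lemma sq_le_one_of_abs {x : ℝ} (hx : |x| ≤ 1) : x ^ 2 ≤ 1 := by
  rw [← sq_abs]; exact pow_le_one₀ (abs_nonneg _) hx

section
variable {g : ℝ → ℝ}

lemma avg_eq_integral (ε v : ℝ) : avg ε g v = (∫ s in 0..ε, g (v - s)) / ε := by
  rw [avg, intervalIntegral.integral_comp_sub_left, sub_zero]

lemma abs_avg_le {ε : ℝ} (hε : 0 < ε) (hb : ∀ w, |g w| ≤ 1) (v : ℝ) : |avg ε g v| ≤ 1 := by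
  have h := intervalIntegral.norm_integral_le_of_norm_le_const (f := g) (C := 1) (a := v - ε)
    (b := v) fun w _ => hb w
  rw [sub_sub_cancel, abs_of_pos hε, one_mul] at h
  rw [avg, abs_div, abs_of_pos hε, div_le_one hε]
  exact h

lemma continuous_avg {ε : ℝ} (hg : Measurable g) (hb : ∀ w, |g w| ≤ 1) :
    Continuous (avg ε g) := by
  have hi := intervalIntegrable_of_bound hg hb
  have h : avg ε g = fun v => ((∫ u in 0..v, g u) - ∫ u in 0..(v - ε), g u) / ε := by
    funext v
    rw [avg, intervalIntegral.integral_interval_sub_left (hi _ _) (hi _ _)]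
  have hc := intervalIntegral.continuous_primitive hi 0
  rw [h]
  exact (hc.sub (hc.comp (continuous_id.sub continuous_const))).div_const _

lemma le_avg {ε c v : ℝ} (hε : 0 < ε) (hg : Measurable g) (hb : ∀ w, |g w| ≤ 1)
    (hc : ∀ w ∈ Set.Icc (v - ε) v, c ≤ g w) : c ≤ avg ε g v := by
  rw [avg, le_div_iff₀ hε]
  have := intervalIntegral.integral_mono_on (by linarith : v - ε ≤ v)
    (intervalIntegrable_const (c := c)) (intervalIntegrable_of_bound hg hb _ _) hc
  rw [intervalIntegral.integral_const, sub_sub_cancel, smul_eq_mul] at this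
  linarith

lemma integrableOn_mul_shift (hg : Measurable g) (hb : ∀ w, |g w| ≤ 1)
    {k : ℝ → ℝ} (hk : Measurable k) (hkb : ∀ w, |k w| ≤ 1) (a b ε : ℝ) :
    IntegrableOn (Function.uncurry fun v s => k v * g (v - s))
      (Set.uIoc a b ×ˢ Set.uIoc 0 ε) := by
  have hm : Measurable (Function.uncurry fun v s => k v * g (v - s)) :=
    (hk.comp measurable_fst).mul (hg.comp (measurable_fst.sub measurable_snd))
  have hB : ∀ a b : ℝ, Bornology.IsBounded (Set.uIoc a b) := fun a b =>
    (Metric.isBounded_Icc _ _).subset Set.uIoc_subset_uIcc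
  exact Measure.integrableOn_of_bounded ((hB a b).prod (hB 0 ε)).measure_lt_top.ne
    hm.aestronglyMeasurable
    (Filter.Eventually.of_forall fun q => abs_mul_le_one (hkb _) (hb _))

lemma integral_mul_avg {ε a b : ℝ} (hg : Measurable g) (hb : ∀ w, |g w| ≤ 1)
    {k : ℝ → ℝ} (hk : Measurable k) (hkb : ∀ w, |k w| ≤ 1) :
    ∫ v in a..b, k v * avg ε g v = (∫ s in 0..ε, ∫ v in a..b, k v * g (v - s)) / ε := by
  have h : ∀ v, k v * avg ε g v = (∫ s in 0..ε, k v * g (v - s)) / ε := fun v => by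
    rw [avg_eq_integral, intervalIntegral.integral_const_mul, mul_div_assoc]
  simp only [h]
  rw [intervalIntegral.integral_div]
  congr 1
  exact intervalIntegral_intervalIntegral_swap (integrableOn_mul_shift hg hb hk hkb a b ε)

lemma le_integral_mul_avg {ε a b c : ℝ} (hε : 0 < ε) (hab : a ≤ b) (hg : Measurable g)
    (hb : ∀ w, |g w| ≤ 1) {k : ℝ → ℝ} (hk : Measurable k) (hkb : ∀ w, |k w| ≤ 1)
    (h : ∀ s ∈ Set.Icc 0 ε, c ≤ ∫ v in a..b, k v * g (v - s)) :
    c ≤ ∫ v in a..b, k v * avg ε g v := by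
  have hi := integrableOn_mul_shift hg hb hk hkb a b ε
  rw [IntegrableOn, Measure.volume_eq_prod, ← Measure.prod_restrict, Set.uIoc_of_le hab,
    Set.uIoc_of_le hε.le] at hi
  have hi2 := hi.integral_prod_right
  simp only [Function.uncurry, ← intervalIntegral.integral_of_le hab] at hi2
  rw [integral_mul_avg hg hb hk hkb, le_div_iff₀ hε]
  have := intervalIntegral.integral_mono_on hε.le (intervalIntegrable_const (c := c))
    ((intervalIntegrable_iff_integrableOn_Ioc_of_le hε.le).2 hi2) h
  rw [intervalIntegral.integral_const, smul_eq_mul, sub_zero] at this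
  linarith

/-- The squared failure of `g` to be symmetric, up to the sign `σ`, under `w ↦ u - w`. -/
def defect (g : ℝ → ℝ) (u σ w : ℝ) : ℝ := (g w - σ * g (u - w)) ^ 2

lemma defect_nonneg (u σ w : ℝ) : 0 ≤ defect g u σ w := sq_nonneg _

lemma measurable_defect (hg : Measurable g) (u σ : ℝ) : Measurable (defect g u σ) := by
  have hm : Measurable fun w => g (u - w) := hg.comp (measurable_const.sub measurable_id)
  unfold defect
  fun_prop

lemma abs_defect_le (hb : ∀ w, |g w| ≤ 1) {σ : ℝ} (hσ : σ ^ 2 = 1) (u w : ℝ) :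
    |defect g u σ w| ≤ 4 := by
  have hσ1 : |σ| ≤ 1 := by
    rw [← sq_le_one_iff_abs_le_one]; exact hσ.le
  have h3 := hb w
  have h4 := abs_mul_le_one hσ1 (hb (u - w))
  rw [abs_of_nonneg (defect_nonneg u σ w), defect]
  rw [abs_le] at h3 h4
  nlinarith

lemma integral_defect_le (hg : Measurable g) (hb : ∀ w, |g w| ≤ 1) {u σ : ℝ}
    (hu : 0 ≤ u) (hσ : σ ^ 2 = 1) :
    ∫ w in 0..u, defect g u σ w ≤ 2 * u - 2 * (σ * ∫ w in 0..u, g w * g (u - w)) := by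
  have hm : Measurable fun w => g (u - w) := hg.comp (measurable_const.sub measurable_id)
  have h1 : IntervalIntegrable (fun w => g w * g (u - w)) volume 0 u :=
    intervalIntegrable_of_bound (hg.mul hm) (fun w => abs_mul_le_one (hb _) (hb _)) 0 u
  have h0 : IntervalIntegrable (defect g u σ) volume 0 u :=
    intervalIntegrable_of_bound (measurable_defect hg u σ) (abs_defect_le hb hσ u) _ _
  have h2 : ∫ w in 0..u, defect g u σ w ≤
      ∫ w in 0..u, (2 - 2 * σ * (g w * g (u - w))) := by
    refine intervalIntegral.integral_mono_on hu h0
      (intervalIntegrable_const.sub (h1.const_mul _)) fun w _ => ?_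
    have h3 := sq_le_one_of_abs (hb w)
    have h4 := sq_le_one_of_abs (hb (u - w))
    have : (σ * g (u - w)) ^ 2 = g (u - w) ^ 2 := by rw [mul_pow, hσ, one_mul]
    rw [defect]
    nlinarith
  refine h2.trans (le_of_eq ?_)
  rw [intervalIntegral.integral_sub intervalIntegrable_const (h1.const_mul _),
    intervalIntegral.integral_const, intervalIntegral.integral_const_mul]
  simp only [smul_eq_mul]
  ring

end

section
variable {g : ℝ → ℝ}

lemma intervalIntegrable_sq_comp (hb : ∀ w, |g w| ≤ 1) {φ : ℝ → ℝ}
    (hφ : Measurable fun w => g (φ w))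
    (a b : ℝ) : IntervalIntegrable (fun w => g (φ w) ^ 2) volume a b :=
  intervalIntegrable_of_bound (C := 1) (hφ.pow_const 2)
    (fun w => by rw [abs_of_nonneg (sq_nonneg _)]; exact sq_le_one_of_abs (hb _)) a b

lemma intervalIntegrable_defect (hg : Measurable g) (hb : ∀ w, |g w| ≤ 1) {σ : ℝ} (hσ : σ ^ 2 = 1)
    (u a b : ℝ) : IntervalIntegrable (defect g u σ) volume a b :=
  intervalIntegrable_of_bound (measurable_defect hg u σ) (abs_defect_le hb hσ u) a b

lemma integral_defect_mono (hg : Measurable g) (hb : ∀ w, |g w| ≤ 1) {σ : ℝ} (hσ : σ ^ 2 = 1)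
    {u a b c d : ℝ} (hca : c ≤ a) (hab : a ≤ b) (hbd : b ≤ d) :
    ∫ w in a..b, defect g u σ w ≤ ∫ w in c..d, defect g u σ w :=
  intervalIntegral.integral_mono_interval hca hab hbd
    (Filter.Eventually.of_forall fun w => defect_nonneg u σ w)
    (intervalIntegrable_defect hg hb hσ u c d)

lemma integral_conv_le_integral_sq (hg : Measurable g) (hb : ∀ w, |g w| ≤ 1) {u : ℝ}
    (hu : 0 ≤ u) : ∫ w in 0..u, g w * g (u - w) ≤ ∫ w in 0..u, g w ^ 2 := by
  have hm : Measurable fun w => g (u - w) := hg.comp (measurable_const.sub measurable_id)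
  have hi1 := intervalIntegrable_sq_comp (φ := fun w => w) hb hg 0 u
  have hi2 := intervalIntegrable_sq_comp hb hm 0 u
  have h1 : ∫ w in 0..u, g (u - w) ^ 2 = ∫ w in 0..u, g w ^ 2 := by
    have := intervalIntegral.integral_comp_sub_left (fun w => g w ^ 2) (a := 0) (b := u) u
    simpa using this
  have hi : IntervalIntegrable (fun w => g w * g (u - w)) volume 0 u :=
    intervalIntegrable_of_bound (hg.mul hm) (fun w => abs_mul_le_one (hb _) (hb _)) 0 u
  have h2 := intervalIntegral.integral_mono_on hu (hi.const_mul 2) (hi1.add hi2)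
    fun w _ => by nlinarith [sq_nonneg (g w - g (u - w))]
  rw [intervalIntegral.integral_add hi1 hi2, h1, intervalIntegral.integral_const_mul] at h2
  linarith

lemma integral_sq_mono_lower (hg : Measurable g) (hb : ∀ w, |g w| ≤ 1) {a b u T : ℝ}
    (ha : 0 ≤ a) (hab : a ≤ b) (hbu : b ≤ u) (h : u - T ≤ ∫ w in 0..u, g w ^ 2) :
    b - a - T ≤ ∫ w in a..b, g w ^ 2 := by
  have hi := fun a b => intervalIntegrable_sq_comp (φ := fun w => w) hb hg a b
  have h1 : ∫ w in a..b, (1 - g w ^ 2) ≤ ∫ w in 0..u, (1 - g w ^ 2) :=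
    intervalIntegral.integral_mono_interval ha hab hbu
      (Filter.Eventually.of_forall fun w => sub_nonneg.2 (sq_le_one_of_abs (hb w)))
      (intervalIntegrable_const.sub (hi _ _))
  rw [intervalIntegral.integral_sub intervalIntegrable_const (hi _ _),
    intervalIntegral.integral_sub intervalIntegrable_const (hi _ _)] at h1
  simp only [intervalIntegral.integral_const, smul_eq_mul, mul_one] at h1
  linarith

/-- Almost symmetry under two reflections gives almost invariance under their composition. -/
lemma le_integral_mul_shift (hg : Measurable g) (hb : ∀ w, |g w| ≤ 1) {u s R : ℝ}
    (hs : 0 ≤ s) (hsu : s ≤ u)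
    (h1 : u - 2 * R ≤ ∫ w in 0..u, g w * g (u - w))
    (h2 : (u - s) - 2 * R ≤ ∫ w in 0..(u - s), g w * g ((u - s) - w)) :
    u - s - 10 * R ≤ ∫ y in 0..(u - s), g y * g (y + s) := by
  have hu' : 0 ≤ u - s := sub_nonneg.2 hsu
  have hd1 := integral_defect_le hg hb (hs.trans hsu) (one_pow 2)
  have hd2 := integral_defect_le hg hb hu' (one_pow 2)
  have hsq1 := h1.trans (integral_conv_le_integral_sq hg hb (hs.trans hsu))
  have hms : Measurable fun y => g (y + s) := hg.comp (measurable_id.add_const s)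
  have hd3 : ∫ y in 0..(u - s), defect g u 1 (u - s - y) ≤ 4 * R := by
    rw [intervalIntegral.integral_comp_sub_left (fun w => defect g u 1 w), sub_self, sub_zero]
    have := integral_defect_mono hg hb (one_pow 2) (u := u) le_rfl hu' (by linarith : u - s ≤ u)
    linarith
  have hs1 := integral_sq_mono_lower hg hb le_rfl hu' (by linarith : u - s ≤ u) hsq1
  have hs2 : u - s - 2 * R ≤ ∫ y in 0..(u - s), g (y + s) ^ 2 := by
    rw [intervalIntegral.integral_comp_add_right (fun w => g w ^ 2), zero_add, sub_add_cancel]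
    exact integral_sq_mono_lower hg hb hs hsu le_rfl hsq1
  have i1 := intervalIntegrable_sq_comp (φ := fun w => w) hb hg 0 (u - s)
  have i2 := intervalIntegrable_sq_comp hb hms 0 (u - s)
  have i3 := intervalIntegrable_defect hg hb (one_pow 2) (u - s) 0 (u - s)
  have i4 : IntervalIntegrable (fun y => defect g u 1 (u - s - y)) volume 0 (u - s) :=
    intervalIntegrable_of_bound ((measurable_defect hg u 1).comp
      (measurable_const.sub measurable_id)) (fun y => abs_defect_le hb (one_pow 2) u _) _ _
  have i5 : IntervalIntegrable (fun y => g y * g (y + s)) volume 0 (u - s) :=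
    intervalIntegrable_of_bound (hg.mul hms) (fun w => abs_mul_le_one (hb _) (hb _)) _ _
  have h := intervalIntegral.integral_mono_on hu'
    (((i1.const_mul (1 / 2)).add (i2.const_mul (1 / 2))).sub (i3.add i4)) i5 fun y _ => by
      simp only [defect]
      rw [show u - (u - s - y) = y + s by ring]
      nlinarith [sq_nonneg (g y - 2 * g (u - s - y) + g (y + s))]
  rw [intervalIntegral.integral_sub ((i1.const_mul (1 / 2)).add (i2.const_mul (1 / 2)))
    (i3.add i4), intervalIntegral.integral_add (i1.const_mul _) (i2.const_mul _),
    intervalIntegral.integral_add i3 i4, intervalIntegral.integral_const_mul,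
    intervalIntegral.integral_const_mul] at h
  linarith

/-- Almost symmetry, up to sign, under three reflections gives it for their composition. -/
lemma le_integral_conv_of_chain (hg : Measurable g) (hb : ∀ w, |g w| ≤ 1)
    {u δ v R T σ τ : ℝ} (hδ : 0 ≤ δ) (hδv : δ ≤ v) (hvu : v ≤ u)
    (hσ : σ ^ 2 = 1) (hτ : τ ^ 2 = 1)
    (hsq : u - 2 * R ≤ ∫ w in 0..u, g w ^ 2)
    (h1 : ∫ w in 0..u, defect g u 1 w ≤ 4 * R)
    (h2 : ∫ w in 0..(u - δ), defect g (u - δ) σ w ≤ T)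
    (h3 : ∫ w in 0..(v - δ), defect g (v - δ) τ w ≤ T) :
    v - 2 * δ - 2 * R - 3 / 2 * (4 * R + 2 * T) ≤ σ * τ * ∫ w in 0..v, g w * g (v - w) := by
  have hστ : (σ * τ) ^ 2 = 1 := by rw [mul_pow, hσ, hτ, one_mul]
  have hστ1 : |σ * τ| ≤ 1 := by
    rw [← sq_le_one_iff_abs_le_one]; exact hστ.le
  have hmv : Measurable fun w => g (v - w) := hg.comp (measurable_const.sub measurable_id)
  have d1 : ∫ w in δ..v, defect g u 1 w ≤ 4 * R :=
    (integral_defect_mono hg hb (one_pow 2) hδ hδv hvu).trans h1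
  have d2 : ∫ w in δ..v, defect g (u - δ) σ (u - w) ≤ T := by
    rw [intervalIntegral.integral_comp_sub_left (fun w => defect g (u - δ) σ w)]
    exact (integral_defect_mono hg hb hσ (by linarith) (by linarith) le_rfl).trans h2
  have d3 : ∫ w in δ..v, defect g (v - δ) τ (w - δ) ≤ T := by
    rw [intervalIntegral.integral_comp_sub_right (fun w => defect g (v - δ) τ w), sub_self]
    exact h3
  have s1 := integral_sq_mono_lower hg hb hδ hδv hvu hsq
  have s2 : v - δ - 2 * R ≤ ∫ w in δ..v, g (v - w) ^ 2 := by
    rw [intervalIntegral.integral_comp_sub_left (fun w => g w ^ 2), sub_self]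
    have := integral_sq_mono_lower hg hb le_rfl (by linarith : 0 ≤ v - δ)
      (by linarith : v - δ ≤ u) hsq
    linarith
  have i1 := intervalIntegrable_sq_comp (φ := fun w => w) hb hg δ v
  have i2 := intervalIntegrable_sq_comp hb hmv δ v
  have i3 := intervalIntegrable_defect hg hb (one_pow 2) u δ v
  have i4 : IntervalIntegrable (fun w => defect g (u - δ) σ (u - w)) volume δ v :=
    intervalIntegrable_of_bound ((measurable_defect hg (u - δ) σ).comp
      (measurable_const.sub measurable_id)) (fun y => abs_defect_le hb hσ _ _) _ _
  have i5 : IntervalIntegrable (fun w => defect g (v - δ) τ (w - δ)) volume δ v :=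
    intervalIntegrable_of_bound ((measurable_defect hg (v - δ) τ).comp
      (measurable_id.sub_const δ)) (fun y => abs_defect_le hb hτ _ _) _ _
  have i6 : ∀ a b, IntervalIntegrable (fun w => σ * τ * (g w * g (v - w))) volume a b :=
    fun a b => (intervalIntegrable_of_bound (C := 1) (hg.mul hmv)
      (fun w => abs_mul_le_one (hb _) (hb _)) a b).const_mul _
  have h := intervalIntegral.integral_mono_on hδv
    (((i1.add i2).const_mul (1 / 2)).sub (((i3.add i4).add i5).const_mul (3 / 2))) (i6 δ v)
    fun w _ => by
      simp only [defect]
      rw [show u - δ - (u - w) = w - δ by ring, show v - δ - (w - δ) = v - w by ring]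
      set a := g w
      set b := g (u - w)
      set c := g (w - δ)
      set d := g (v - w)
      have e1 : (a - σ * τ * d) ^ 2 = a ^ 2 - 2 * (σ * τ * (a * d)) + d ^ 2 := by
        linear_combination d ^ 2 * hστ
      have e2 : (σ * (c - τ * d)) ^ 2 = (c - τ * d) ^ 2 := by rw [mul_pow, hσ, one_mul]
      have e3 : ∀ x y z : ℝ, (x + y + z) ^ 2 ≤ 3 * (x ^ 2 + y ^ 2 + z ^ 2) := fun x y z => by
        nlinarith [sq_nonneg (x - y), sq_nonneg (y - z), sq_nonneg (x - z)]
      have e4 := e3 (a - 1 * b) (b - σ * c) (σ * (c - τ * d))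
      rw [show a - 1 * b + (b - σ * c) + σ * (c - τ * d) = a - σ * τ * d by ring, e1, e2] at e4
      linarith
  rw [intervalIntegral.integral_sub ((i1.add i2).const_mul _) (((i3.add i4).add i5).const_mul _),
    intervalIntegral.integral_const_mul, intervalIntegral.integral_const_mul,
    intervalIntegral.integral_add i1 i2, intervalIntegral.integral_add (i3.add i4) i5,
    intervalIntegral.integral_add i3 i4] at h
  have hlow : -δ ≤ ∫ w in 0..δ, σ * τ * (g w * g (v - w)) := by
    have := intervalIntegral.norm_integral_le_of_norm_le_const (a := 0) (b := δ) (C := 1)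
      (f := fun w => σ * τ * (g w * g (v - w)))
      fun w _ => abs_mul_le_one hστ1 (abs_mul_le_one (hb _) (hb _))
    rw [sub_zero, abs_of_nonneg hδ, one_mul, Real.norm_eq_abs, abs_le] at this
    exact this.1
  rw [← intervalIntegral.integral_const_mul,
    ← intervalIntegral.integral_add_adjacent_intervals (i6 0 δ) (i6 δ v)]
  linarith

end

section
variable {g : ℝ → ℝ}

lemma exists_sign_defect_le (hg : Measurable g) (hb : ∀ w, |g w| ≤ 1) {ε v R c : ℝ}
    (hv : 0 ≤ v) (hA : |v * avg ε g v - ∫ w in 0..v, g w * g (v - w)| ≤ R)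
    (hc : 1 - c ≤ |avg ε g v|) :
    ∃ σ : ℝ, σ ^ 2 = 1 ∧ ∫ w in 0..v, defect g v σ w ≤ 2 * (v * c + R) := by
  rw [abs_le] at hA
  rcases le_total 0 (avg ε g v) with h | h
  · rw [abs_of_nonneg h] at hc
    refine ⟨1, one_pow 2, (integral_defect_le hg hb hv (one_pow 2)).trans ?_⟩
    nlinarith [mul_le_mul_of_nonneg_left hc hv]
  · rw [abs_of_nonpos h] at hc
    refine ⟨-1, by norm_num, (integral_defect_le hg hb hv (by norm_num)).trans ?_⟩
    nlinarith [mul_le_mul_of_nonneg_left hc hv]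

lemma integral_one_sub_abs_avg_le (hg : Measurable g) (hb : ∀ w, |g w| ≤ 1)
    (hneg : ∀ w < 0, g w = 0) {ε u R : ℝ} (hε : 0 < ε) (hε1 : ε ≤ 1) (hR : 1 ≤ R) (hu : 1 ≤ u)
    (h : ∀ v ∈ Set.Icc (u - ε) u, v - 2 * R ≤ ∫ w in 0..v, g w * g (v - w)) :
    ∫ w in 0..u, (1 - |avg ε g w|) ≤ 11 * R := by
  have hu0 : 0 ≤ u := by linarith
  have hc := continuous_avg (ε := ε) hg hb
  have h1 : u - 11 * R ≤ ∫ v in 0..u, g v * avg ε g v := by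
    refine le_integral_mul_avg hε hu0 hg hb hg hb fun s hs => ?_
    have hsu : s ≤ u := by linarith [hs.2]
    have h2 := le_integral_mul_shift hg hb hs.1 hsu (h u ⟨by linarith, le_rfl⟩)
      (h (u - s) ⟨by linarith [hs.2], by linarith [hs.1]⟩)
    have hm : Measurable fun v => g (v - s) := hg.comp (measurable_id.sub_const s)
    have hi : ∀ a b, IntervalIntegrable (fun v => g v * g (v - s)) volume a b :=
      intervalIntegrable_of_bound (hg.mul hm) fun w => abs_mul_le_one (hb _) (hb _)
    have h3 : ∫ v in 0..s, g v * g (v - s) = 0 := by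
      refine intervalIntegral.integral_zero_ae ?_
      have : ∀ᵐ v : ℝ, v ≠ s := by simp [ae_iff, measure_singleton]
      filter_upwards [this] with v hv hvs
      rw [Set.uIoc_of_le hs.1] at hvs
      rw [hneg (v - s) (by have := lt_of_le_of_ne hvs.2 hv; linarith), mul_zero]
    have h4 : ∫ v in s..u, g v * g (v - s) = ∫ y in 0..(u - s), g y * g (y + s) := by
      have := intervalIntegral.integral_comp_sub_right (fun y => g (y + s) * g y) (a := s)
        (b := u) s
      simp only [sub_add_cancel, sub_self] at this
      rw [this]
      simp only [mul_comm]
    rw [← intervalIntegral.integral_add_adjacent_intervals (hi 0 s) (hi s u), h3, h4]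
    linarith [hs.2]
  have h5 : ∫ v in 0..u, g v * avg ε g v ≤ ∫ v in 0..u, |avg ε g v| := by
    refine intervalIntegral.integral_mono_on hu0 (intervalIntegrable_of_bound
      (hg.mul hc.measurable) (fun w => abs_mul_le_one (hb _) (abs_avg_le hε hb _)) _ _)
      (hc.abs.intervalIntegrable _ _) fun w _ => ?_
    refine (le_abs_self _).trans ?_
    rw [abs_mul]
    exact mul_le_of_le_one_left (abs_nonneg _) (hb w)
  rw [intervalIntegral.integral_sub intervalIntegrable_const (hc.abs.intervalIntegrable _ _),
    intervalIntegral.integral_const, smul_eq_mul]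
  linarith

lemma abs_integral_avg_le (hg : Measurable g) (hb : ∀ w, |g w| ≤ 1) {ε a b u R : ℝ}
    (hε : 0 < ε) (hεa : ε ≤ a) (hab : a ≤ b) (hbu : b ≤ u)
    (hB : ∀ v ∈ Set.Icc 0 u, |∫ w in 0..v, g w| ≤ R) :
    |∫ v in a..b, avg ε g v| ≤ 2 * R := by
  have hi := intervalIntegrable_of_bound hg hb
  have h := integral_mul_avg (ε := ε) (a := a) (b := b) hg hb (measurable_const (a := (1 : ℝ)))
    (fun _ => by simp)
  simp only [one_mul] at h
  rw [h, abs_div, abs_of_pos hε, div_le_iff₀ hε]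
  have h2 := intervalIntegral.norm_integral_le_of_norm_le_const (a := 0) (b := ε) (C := 2 * R)
    (f := fun s => ∫ v in a..b, g (v - s)) fun s hs => by
      rw [Set.uIoc_of_le hε.le] at hs
      rw [intervalIntegral.integral_comp_sub_right, ← intervalIntegral.integral_interval_sub_left
        (hi 0 (b - s)) (hi 0 (a - s))]
      have e1 := hB (b - s) ⟨by linarith [hs.2], by linarith [hs.1]⟩
      have e2 := hB (a - s) ⟨by linarith [hs.2], by linarith [hs.1]⟩
      rw [Real.norm_eq_abs]
      rw [abs_le] at *
      constructor <;> linarith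
  rwa [sub_zero, abs_of_pos hε] at h2

lemma half_le_abs_avg (hg : Measurable g) (hb : ∀ w, |g w| ≤ 1) {ε u R v : ℝ}
    (hε : 0 < ε) (hR : 1 ≤ R) (hu : 100000 * R ≤ u)
    (hA : ∀ v ∈ Set.Icc (u / 5) u, |v * avg ε g v - ∫ w in 0..v, g w * g (v - w)| ≤ R)
    (hsym : u - 2 * R ≤ ∫ w in 0..u, g w * g (u - w))
    (havg : ∫ w in 0..u, (1 - |avg ε g w|) ≤ 11 * R)
    (hv : v ∈ Set.Icc (u / 4) (3 * u / 4)) : 1 / 2 ≤ |avg ε g v| := by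
  have hu0 : 0 < u := by linarith
  have hc := continuous_avg (ε := ε) hg hb
  have hii : ∀ a b, IntervalIntegrable (fun w => 1 - |avg ε g w|) volume a b := fun a b =>
    (continuous_const.sub hc.abs).intervalIntegrable a b
  have hmono : ∀ a b, 0 ≤ a → a ≤ b → b ≤ u → ∫ w in a..b, (1 - |avg ε g w|) ≤ 11 * R :=
    fun a b ha hab hbu => (intervalIntegral.integral_mono_interval ha hab hbu
      (Filter.Eventually.of_forall fun w => sub_nonneg.2 (abs_avg_le hε hb w)) (hii _ _)).trans havg
  set c := 800 * R / u with hcdef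
  have hcu : c * u = 800 * R := by rw [hcdef]; field_simp
  have hc0 : 0 ≤ c := by positivity
  obtain ⟨β, hβ, hβc⟩ : ∃ β ∈ Set.Icc (31 * u / 32) u,
      (1 - |avg ε g β|) + (1 - |avg ε g (β - (u - v))|) ≤ c := by
    by_contra! hcon
    have hij : IntervalIntegrable (fun w => 1 - |avg ε g (w - (u - v))|) volume
        (31 * u / 32) u :=
      (continuous_const.sub
        (hc.comp (continuous_id.sub continuous_const)).abs).intervalIntegrable _ _
    have h1 := intervalIntegral.integral_mono_on (by linarith : 31 * u / 32 ≤ u)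
      (intervalIntegrable_const (c := c)) ((hii _ _).add hij) fun β hβ => (hcon β hβ).le
    rw [intervalIntegral.integral_add (hii _ _) hij, intervalIntegral.integral_const,
      smul_eq_mul] at h1
    have h2 := intervalIntegral.integral_comp_sub_right (fun w => 1 - |avg ε g w|)
      (a := 31 * u / 32) (b := u) (u - v)
    rw [h2] at h1
    have h3 := hmono (31 * u / 32) u (by linarith) (by linarith) le_rfl
    have h4 := hmono (31 * u / 32 - (u - v)) (u - (u - v)) (by linarith [hv.1]) (by linarith)
      (by linarith [hv.2])
    nlinarith
  have hα : β - (u - v) ∈ Set.Icc (u / 5) u :=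
    ⟨by linarith [hβ.1, hv.1], by linarith [hβ.2, hv.2]⟩
  have hb1 := abs_avg_le hε hb β
  have hb2 := abs_avg_le hε hb (β - (u - v))
  have hβ0 : 0 ≤ β := by linarith [hβ.1]
  have hα0 : 0 ≤ β - (u - v) := by linarith [hα.1]
  obtain ⟨σ, hσ, hσd⟩ := exists_sign_defect_le hg hb hβ0
    (hA β ⟨by linarith [hβ.1], hβ.2⟩) (by linarith : 1 - c ≤ _)
  obtain ⟨τ, hτ, hτd⟩ := exists_sign_defect_le hg hb hα0
    (hA _ hα) (by linarith : 1 - c ≤ _)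
  have hβT : 2 * (β * c + R) ≤ 1602 * R := by nlinarith [hβ.2]
  have hαT : 2 * ((β - (u - v)) * c + R) ≤ 1602 * R := by nlinarith [hα.2]
  have hd := integral_defect_le hg hb hu0.le (one_pow 2)
  have hch := le_integral_conv_of_chain hg hb (u := u) (δ := u - β) (v := v) (R := R)
    (T := 1602 * R) (σ := σ) (τ := τ) (by linarith [hβ.2]) (by linarith [hβ.1, hv.1])
    (by linarith [hv.2]) hσ hτ (hsym.trans (integral_conv_le_integral_sq hg hb hu0.le))
    (by linarith) (by rw [sub_sub_cancel]; linarith)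
    (by rw [show v - (u - β) = β - (u - v) by ring]; linarith)
  have hστ : |σ * τ| = 1 := by
    rw [← sq_eq_sq₀ (abs_nonneg _) zero_le_one, sq_abs, mul_pow, hσ, hτ, one_mul, one_pow]
  have h5 : σ * τ * ∫ w in 0..v, g w * g (v - w) ≤ |∫ w in 0..v, g w * g (v - w)| := by
    refine (le_abs_self _).trans (le_of_eq ?_)
    rw [abs_mul, hστ, one_mul]
  have hv0 : 0 ≤ v := by linarith [hv.1]
  have h6 : |∫ w in 0..v, g w * g (v - w)| ≤ v * |avg ε g v| + R := by
    have h7 := hA v ⟨by linarith [hv.1], by linarith [hv.2]⟩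
    rw [abs_sub_comm] at h7
    have := abs_sub_abs_le_abs_sub (∫ w in 0..v, g w * g (v - w)) (v * avg ε g v)
    rw [abs_mul, abs_of_nonneg hv0] at this
    linarith
  by_contra! hlt
  nlinarith [hv.1, hβ.1, mul_le_mul_of_nonneg_left hlt.le hv0]

/-- A function bounded by `1`, almost equal to its own convolution square in the averaged sense
`v * g ≈ g ∗ g`, with small primitive, cannot be close to `1` near a large point `u`. -/
theorem lt_of_near_one (hg : Measurable g) (hb : ∀ w, |g w| ≤ 1) (hneg : ∀ w < 0, g w = 0)
    {ε u R : ℝ} (hε : 0 < ε) (hε1 : ε ≤ 1) (hR : 1 ≤ R)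
    (hA : ∀ v ∈ Set.Icc (u / 5) u, |v * avg ε g v - ∫ w in 0..v, g w * g (v - w)| ≤ R)
    (hB : ∀ v ∈ Set.Icc 0 u, |∫ w in 0..v, g w| ≤ R)
    (hC : ∀ w ∈ Set.Icc (u - 2 * ε) u, 1 - R / u ≤ g w) : u < 100000 * R := by
  by_contra! hu
  have hu0 : 0 < u := by linarith
  have hsym : ∀ v ∈ Set.Icc (u - ε) u, v - 2 * R ≤ ∫ w in 0..v, g w * g (v - w) := by
    intro v hv
    have hv0 : 0 ≤ v := by linarith [hv.1]
    have h1 : 1 - R / u ≤ avg ε g v := le_avg hε hg hb fun w hw =>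
      hC w ⟨by linarith [hw.1, hv.1], hw.2.trans hv.2⟩
    have h2 := (abs_le.1 (hA v ⟨by linarith [hv.1], hv.2⟩)).2
    have h3 : v * (R / u) ≤ R := by
      rw [mul_div_assoc', div_le_iff₀ hu0]
      nlinarith [hv.2]
    nlinarith [mul_le_mul_of_nonneg_left h1 hv0]
  have hsu := hsym u ⟨by linarith, le_rfl⟩
  have havg := integral_one_sub_abs_avg_le hg hb hneg hε hε1 hR (by linarith) hsym
  have hhalf : ∀ v ∈ Set.Icc (u / 4) (3 * u / 4), 1 / 2 ≤ |avg ε g v| := fun v hv =>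
    half_le_abs_avg hg hb hε hR hu hA hsu havg hv
  have hc := continuous_avg (ε := ε) hg hb
  have hI := abs_le.1 (abs_integral_avg_le hg hb hε (by linarith : ε ≤ u / 4)
    (by linarith : u / 4 ≤ 3 * u / 4) (by linarith) hB)
  have hle : u / 4 ≤ 3 * u / 4 := by linarith
  have hsign : (∀ v ∈ Set.Icc (u / 4) (3 * u / 4), 1 / 2 ≤ avg ε g v) ∨
      ∀ v ∈ Set.Icc (u / 4) (3 * u / 4), avg ε g v ≤ -(1 / 2) := by
    by_contra! hcon
    obtain ⟨⟨x, hx, hxl⟩, y, hy, hyl⟩ := hcon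
    have hx' : avg ε g x ≤ 0 := by
      by_contra! h
      have := hhalf x hx
      rw [abs_of_pos h] at this
      linarith
    have hy' : 0 ≤ avg ε g y := by
      by_contra! h
      have := hhalf y hy
      rw [abs_of_neg h] at this
      linarith
    obtain ⟨z, hz, hz0⟩ := (isPreconnected_Icc).intermediate_value hx hy hc.continuousOn
      ⟨hx', hy'⟩
    have := hhalf z hz
    rw [hz0, abs_zero] at this
    linarith
  rcases hsign with h | h
  · have := intervalIntegral.integral_mono_on (μ := volume) hle intervalIntegrable_const
      (hc.intervalIntegrable _ _) h
    rw [intervalIntegral.integral_const, smul_eq_mul] at this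
    linarith
  · have := intervalIntegral.integral_mono_on (μ := volume) hle (hc.intervalIntegrable _ _)
      intervalIntegrable_const h
    rw [intervalIntegral.integral_const, smul_eq_mul] at this
    linarith

end

/-- The deviation `1 - dens ε w` of the density from its mean, truncated. -/
noncomputable def deviation (ε B w : ℝ) : ℝ := if B < w then max (1 - dens ε w) (-1) else 0

lemma measurable_deviation (ε B : ℝ) : Measurable (deviation ε B) :=
  Measurable.ite measurableSet_Ioi ((measurable_const.sub (measurable_dens ε)).max measurable_const)
    measurable_const

lemma abs_deviation_le {ε : ℝ} (hε : 0 < ε) (B w : ℝ) : |deviation ε B w| ≤ 1 := by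
  rw [deviation]
  split_ifs
  · rw [abs_le]
    exact ⟨le_max_right _ _, max_le (by linarith [dens_nonneg hε w]) (by norm_num)⟩
  · simp

lemma deviation_eq_zero {ε B w : ℝ} (h : w ≤ B) : deviation ε B w = 0 := if_neg h.not_gt

lemma deviation_sub_mem {ε L B w : ℝ} (hL : 1 ≤ L) (hε : ε = Real.exp (-L / 2))
    (hB : 30 * L + 1 ≤ B) (hw : B < w) :
    |deviation ε B w - (1 - dens ε w)| ≤ 643800 * L / B := by
  have h1 := dens_le_two_add hL hε (v := w) (by linarith)
  have h2 : 643700 * L / w ≤ 643800 * L / B := by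
    have : 0 < B := by linarith
    gcongr
    norm_num
  have h3 : 0 ≤ 643800 * L / B := by
    have : 0 < B := by linarith
    positivity
  rw [deviation, if_pos hw, abs_le]
  constructor
  · linarith [le_max_left (1 - dens ε w) (-1)]
  · rw [tsub_le_iff_right]
    exact max_le (by linarith) (by linarith)

lemma abs_one_sub_dens_le {ε L B w : ℝ} (hL : 1 ≤ L) (hε : ε = Real.exp (-L / 2))
    (hBM : 643800 * L ≤ B) (hw : B ≤ w) : |1 - dens ε w| ≤ 2 := by
  have h1 := dens_le_two_add hL hε (v := w) (by linarith)
  have h2 : 643700 * L / w ≤ 1 := by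
    rw [div_le_one (by linarith)]
    linarith
  have h0 : 0 ≤ dens ε w := dens_nonneg (by rw [hε]; positivity) w
  rw [abs_le]
  constructor <;> linarith

lemma abs_conv_one_sub_dens_le {ε L v : ℝ} (hL : 1 ≤ L) (hε : ε = Real.exp (-L / 2))
    (hv : 30 * L + 1 ≤ v) :
    |v * avg ε (fun w => 1 - dens ε w) v -
      ∫ w in 0..v, (1 - dens ε w) * (1 - dens ε (v - w))| ≤ 643800 * L + 14 := by
  have hε0 : 0 < ε := by rw [hε]; positivity
  have hε1 : ε ≤ 1 := by rw [hε]; exact Real.exp_le_one_iff.2 (by linarith)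
  have hv0 : 0 ≤ v := by linarith
  have h1 := abs_avg_dens_add_conv_sub_le hL hε hv
  have h2 := abs_integral_dens_sub_le hε0 hε1 hv0
  have i1 := fun a b => intervalIntegrable_dens hε0 a b
  have i2 : IntervalIntegrable (fun w => dens ε (v - w)) volume 0 v := by
    simpa using (i1 v 0).comp_sub_left v
  have i3 : IntervalIntegrable (fun w => dens ε w * dens ε (v - w)) volume 0 v := by
    obtain ⟨C, hC⟩ := exists_dens_le ε v hε0
    have hm : Measurable fun w => dens ε w * dens ε (v - w) :=
      (measurable_dens ε).mul ((measurable_dens ε).comp (measurable_const.sub measurable_id))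
    refine intervalIntegrable_of_measurable_bound hm (C := C * C) fun w hw => ?_
    rw [Set.uIcc_of_le hv0] at hw
    have e1 := hC w hw.2
    have e2 := hC (v - w) (by linarith [hw.1])
    rw [abs_mul]
    exact mul_le_mul e1 e2 (abs_nonneg _) ((abs_nonneg _).trans e1)
  have h3 : ∫ w in 0..v, (1 - dens ε w) * (1 - dens ε (v - w)) =
      v - 2 * (∫ w in 0..v, dens ε w) + ∫ w in 0..v, dens ε w * dens ε (v - w) := by
    have e1 : ∀ w, (1 - dens ε w) * (1 - dens ε (v - w)) =
        1 - dens ε w - dens ε (v - w) + dens ε w * dens ε (v - w) := fun w => by ring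
    have e2 : ∫ w in 0..v, dens ε (v - w) = ∫ w in 0..v, dens ε w := by
      rw [intervalIntegral.integral_comp_sub_left]; simp
    simp only [e1]
    rw [intervalIntegral.integral_add ((intervalIntegrable_const.sub (i1 _ _)).sub i2) i3,
      intervalIntegral.integral_sub (intervalIntegrable_const.sub (i1 _ _)) i2,
      intervalIntegral.integral_sub intervalIntegrable_const (i1 _ _), e2,
      intervalIntegral.integral_const, smul_eq_mul]
    ring
  have h4 : avg ε (fun w => 1 - dens ε w) v = 1 - avg ε (dens ε) v := by
    rw [avg, avg, intervalIntegral.integral_sub intervalIntegrable_const (i1 _ _),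
      intervalIntegral.integral_const, smul_eq_mul]
    field_simp
    ring
  rw [h3, h4]
  rw [abs_le] at *
  constructor <;> nlinarith

lemma abs_integral_conv_sub_le {ε L B v : ℝ} (hL : 1 ≤ L) (hε : ε = Real.exp (-L / 2))
    (hB : 30 * L + 1 ≤ B) (hBM : 643800 * L ≤ B) (hv : 2 * B ≤ v) :
    |(∫ w in 0..v, deviation ε B w * deviation ε B (v - w)) -
      ∫ w in 0..v, (1 - dens ε w) * (1 - dens ε (v - w))| ≤
      3 * (643800 * L / B) * v + 8 * B + 28 := by
  have hε0 : 0 < ε := by rw [hε]; positivity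
  have hε1 : ε ≤ 1 := by rw [hε]; exact Real.exp_le_one_iff.2 (by linarith)
  have hB0 : 0 ≤ B := by linarith
  have hv0 : 0 ≤ v := by linarith
  set η := 643800 * L / B with hη
  have hη0 : 0 ≤ η := by positivity
  obtain ⟨C, hC⟩ := exists_dens_le ε v hε0
  have hmd := measurable_dens ε
  have hmg := measurable_deviation ε B
  have i1 : ∀ a ∈ Set.Icc 0 v, ∀ b ∈ Set.Icc 0 v,
      IntervalIntegrable (fun w => (1 - dens ε w) * (1 - dens ε (v - w))) volume a b := by
    intro a ha b hb
    have hm : Measurable fun w => (1 - dens ε w) * (1 - dens ε (v - w)) := by fun_prop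
    refine intervalIntegrable_of_measurable_bound hm (C := (1 + C) * (1 + C)) fun w hw => ?_
    have hw' := (Set.uIcc_subset_Icc ha hb) hw
    have e0 : ∀ x, |1 - dens ε x| ≤ 1 + |dens ε x| := fun x => by
      simpa using abs_sub (1 : ℝ) (dens ε x)
    have e1 := (e0 w).trans (add_le_add_right (hC w hw'.2) 1)
    have e2 := (e0 (v - w)).trans (add_le_add_right (hC (v - w) (by linarith [hw'.1])) 1)
    rw [abs_mul]
    exact mul_le_mul e1 e2 (abs_nonneg _) ((abs_nonneg _).trans e1)
  have hmg2 : Measurable fun w => deviation ε B w * deviation ε B (v - w) := by fun_prop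
  have i2 : ∀ a b, IntervalIntegrable (fun w => deviation ε B w * deviation ε B (v - w))
      volume a b := intervalIntegrable_of_bound hmg2
    fun w => abs_mul_le_one (abs_deviation_le hε0 _ _) (abs_deviation_le hε0 _ _)
  have m0 : (0 : ℝ) ∈ Set.Icc 0 v := ⟨le_rfl, hv0⟩
  have mB : B ∈ Set.Icc 0 v := ⟨hB0, by linarith⟩
  have mC : v - B ∈ Set.Icc 0 v := ⟨by linarith, by linarith⟩
  have mv : v ∈ Set.Icc 0 v := ⟨hv0, le_rfl⟩
  rw [← intervalIntegral.integral_sub (i2 _ _) (i1 _ m0 _ mv)]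
  set H : ℝ → ℝ := fun w => deviation ε B w * deviation ε B (v - w) -
    (1 - dens ε w) * (1 - dens ε (v - w)) with hH
  have i3 : ∀ a ∈ Set.Icc 0 v, ∀ b ∈ Set.Icc 0 v, IntervalIntegrable H volume a b :=
    fun a ha b hb => (i2 a b).sub (i1 a ha b hb)
  have idens := fun a b => intervalIntegrable_dens hε0 a b
  have hdi : IntervalIntegrable (fun w => 2 * (1 + dens ε w)) volume 0 B :=
    (intervalIntegrable_const.add (idens _ _)).const_mul 2
  have hdens : ∫ w in 0..B, 2 * (1 + dens ε w) ≤ 4 * B + 14 := by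
    rw [intervalIntegral.integral_const_mul,
      intervalIntegral.integral_add intervalIntegrable_const (idens _ _),
      intervalIntegral.integral_const, smul_eq_mul]
    linarith [(abs_le.1 (abs_integral_dens_sub_le hε0 hε1 hB0)).2]
  have hends : ∀ x y, B ≤ y → |(1 - dens ε x) * (1 - dens ε y)| ≤ 2 * (1 + dens ε x) := by
    intro x y hy
    have e1 := abs_one_sub_dens_le hL hε hBM hy
    have e2 : |1 - dens ε x| ≤ 1 + dens ε x := by
      have := dens_nonneg hε0 x
      rw [abs_le]; constructor <;> linarith
    rw [abs_mul, mul_comm 2]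
    exact mul_le_mul e2 e1 (abs_nonneg _) ((abs_nonneg _).trans e2)
  have b1 : |∫ w in 0..B, H w| ≤ 4 * B + 14 := by
    rw [← Real.norm_eq_abs]
    refine le_trans ?_ hdens
    refine intervalIntegral.norm_integral_le_of_norm_le hB0 (Filter.Eventually.of_forall
      fun w hw => ?_) hdi
    rw [hH]
    simp only
    rw [deviation_eq_zero hw.2, zero_mul, zero_sub, norm_neg]
    exact hends w _ (by linarith [hw.2])
  have b2 : |∫ w in (v - B)..v, H w| ≤ 4 * B + 14 := by
    have e1 : ∫ w in (v - B)..v, H w = ∫ w in 0..B, H (v - w) := by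
      rw [intervalIntegral.integral_comp_sub_left]; simp
    rw [e1]
    rw [← Real.norm_eq_abs]
    refine le_trans ?_ hdens
    refine intervalIntegral.norm_integral_le_of_norm_le hB0 (Filter.Eventually.of_forall
      fun w hw => ?_) hdi
    rw [hH]
    simp only
    rw [sub_sub_cancel, deviation_eq_zero hw.2, mul_zero, zero_sub, norm_neg, mul_comm]
    exact hends w _ (by linarith [hw.2])
  have b3 : |∫ w in B..(v - B), H w| ≤ 3 * η * v := by
    have e1 := intervalIntegral.norm_integral_le_of_norm_le_const_ae (a := B) (b := v - B)
      (C := 3 * η) (f := H) ?_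
    · rw [abs_of_nonneg (by linarith : 0 ≤ v - B - B)] at e1
      refine e1.trans ?_
      gcongr
      linarith
    · have : ∀ᵐ w : ℝ, w ≠ v - B := by simp [ae_iff, measure_singleton]
      filter_upwards [this] with w hwne hw
      rw [Set.uIoc_of_le (by linarith)] at hw
      have hlt := lt_of_le_of_ne hw.2 hwne
      have d1 := deviation_sub_mem hL hε hB hw.1
      have d2 := deviation_sub_mem hL hε hB (by linarith : B < v - w)
      have d3 := abs_one_sub_dens_le hL hε hBM (by linarith : B ≤ v - w)
      have d4 := abs_deviation_le hε0 B w
      rw [hH, Real.norm_eq_abs]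
      simp only
      set p := deviation ε B w
      set q := deviation ε B (v - w)
      set r := 1 - dens ε w
      set s := 1 - dens ε (v - w)
      calc |p * q - r * s| = |p * (q - s) + (p - r) * s| := by ring_nf
        _ ≤ |p| * |q - s| + |p - r| * |s| := by
          rw [← abs_mul, ← abs_mul]; exact abs_add_le _ _
        _ ≤ 1 * η + η * 2 := by gcongr
        _ = 3 * η := by ring
  rw [← intervalIntegral.integral_add_adjacent_intervals (i3 _ m0 _ mB) (i3 _ mB _ mv),
    ← intervalIntegral.integral_add_adjacent_intervals (i3 _ mB _ mC) (i3 _ mC _ mv)]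
  rw [abs_le] at *
  constructor <;> linarith

lemma abs_avg_sub_avg_le {g f : ℝ → ℝ} {ε η v : ℝ} (hε : 0 < ε)
    (hg : IntervalIntegrable g volume (v - ε) v) (hf : IntervalIntegrable f volume (v - ε) v)
    (h : ∀ w ∈ Set.Ioc (v - ε) v, |g w - f w| ≤ η) : |avg ε g v - avg ε f v| ≤ η := by
  rw [avg, avg, ← sub_div, ← intervalIntegral.integral_sub hg hf, abs_div, abs_of_pos hε,
    div_le_iff₀ hε]
  have := intervalIntegral.norm_integral_le_of_norm_le_const (a := v - ε) (b := v) (C := η)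
    (f := fun w => g w - f w) fun w hw => h w (by rwa [Set.uIoc_of_le (by linarith)] at hw)
  rwa [sub_sub_cancel, abs_of_pos hε] at this

/-- A point `u` with no primes just below `exp u` cannot be large compared to `L`. -/
lemma lt_of_no_prime {ε L B u : ℝ} (hL : 1 ≤ L) (hε : ε = Real.exp (-L / 2))
    (hB : 30 * L + 1 ≤ B) (hBM : 643800 * L ≤ B) (hu : 10 * B + 10 ≤ u)
    (hp : ∀ p : ℕ, p.Prime → Real.exp (u - 3 * ε) < p → (p : ℝ) ≤ Real.exp u → False) :
    u < 100000 * (4 * (643800 * L / B) * u + 8 * B + 42 + 643800 * L) := by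
  have hε0 : 0 < ε := by rw [hε]; positivity
  have hε1 : ε ≤ 1 := by rw [hε]; exact Real.exp_le_one_iff.2 (by linarith)
  have hB0 : 0 < B := by linarith
  have hu0 : 0 < u := by linarith
  set η := 643800 * L / B with hη
  have hη0 : 0 ≤ η := by positivity
  have hηv : ∀ v ≤ u, η * v ≤ η * u := fun v hv => mul_le_mul_of_nonneg_left hv hη0
  have hηu : 0 ≤ η * u := by positivity
  have hmg := measurable_deviation ε B
  have hbg := abs_deviation_le hε0 B
  have ig := intervalIntegrable_of_bound hmg hbg
  have idens : ∀ a b, IntervalIntegrable (fun w => 1 - dens ε w) volume a b :=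
    fun a b => intervalIntegrable_const.sub (intervalIntegrable_dens hε0 a b)
  refine lt_of_near_one hmg hbg (fun w hw => deviation_eq_zero (by linarith)) hε0 hε1
    (by nlinarith) (fun v hv => ?_) (fun v hv => ?_) fun w hw => ?_
  · have h1 := abs_conv_one_sub_dens_le hL hε (v := v) (by linarith [hv.1])
    have h2 := abs_integral_conv_sub_le hL hε hB hBM (v := v) (by linarith [hv.1])
    rw [← hη] at h2
    have h3 := abs_avg_sub_avg_le (η := η) hε0 (ig _ _) (idens (v - ε) v)
      fun w hw => deviation_sub_mem hL hε hB (by linarith [hw.1, hv.1])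
    have hv0 : 0 ≤ v := by linarith [hv.1]
    have h4 : |v * avg ε (deviation ε B) v - v * avg ε (fun w => 1 - dens ε w) v| ≤ v * η := by
      rw [← mul_sub, abs_mul, abs_of_nonneg hv0]
      gcongr
    have h5 := hηv v hv.2
    rw [abs_le] at *
    constructor <;> linarith
  · have h0 : ∀ b ≤ B, 0 ≤ b → ∫ w in 0..b, deviation ε B w = 0 := fun b hb hb0 => by
      refine intervalIntegral.integral_zero_ae (Filter.Eventually.of_forall fun w hw => ?_)
      rw [Set.uIoc_of_le hb0] at hw
      exact deviation_eq_zero (hw.2.trans hb)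
    rcases le_total v B with hvB | hvB
    · rw [h0 v hvB hv.1, abs_zero]
      linarith
    · rw [← intervalIntegral.integral_add_adjacent_intervals (ig 0 B) (ig B v),
        h0 B le_rfl hB0.le, zero_add]
      have h1 := abs_integral_dens_sub_le hε0 hε1 hv.1
      have h2 := abs_integral_dens_sub_le hε0 hε1 hB0.le
      have h3 := intervalIntegral.norm_integral_le_of_norm_le_const (a := B) (b := v) (C := η)
        (f := fun w => deviation ε B w - (1 - dens ε w)) fun w hw => by
          rw [Set.uIoc_of_le hvB] at hw
          exact deviation_sub_mem hL hε hB hw.1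
      rw [intervalIntegral.integral_sub (ig _ _) (idens _ _), intervalIntegral.integral_sub
        intervalIntegrable_const (intervalIntegrable_dens hε0 _ _),
        ← intervalIntegral.integral_interval_sub_left (intervalIntegrable_dens hε0 0 v)
          (intervalIntegrable_dens hε0 0 B), intervalIntegral.integral_const, smul_eq_mul,
        abs_of_nonneg (by linarith : 0 ≤ v - B), Real.norm_eq_abs] at h3
      have h5 := hηv (v - B) (by linarith [hv.2])
      rw [abs_le] at *
      constructor <;> linarith
  · have hwu : u / 2 ≤ w := by linarith [hw.1]
    rw [deviation, if_pos (by linarith)]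
    refine le_trans ?_ (le_max_left _ _)
    have h1 := dens_le_of_no_prime hL hε (v := w) (by linarith) fun p hpp h1 h2 =>
      hp p hpp (lt_of_le_of_lt (Real.exp_le_exp.2 (by linarith [hw.1])) h1)
        (h2.trans (Real.exp_le_exp.2 hw.2))
    have h2 : 6 / w ≤ 12 / u := by
      rw [div_le_div_iff₀ (by linarith) hu0]
      linarith
    have h3 : 12 / u ≤ (4 * η * u + 8 * B + 42 + 643800 * L) / u := by
      gcongr
      nlinarith
    linarith

/-- There is a prime in every interval `(exp (K * L - 3 * exp (-L / 2)), exp (K * L)]`. -/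
theorem exists_prime_window : ∃ K : ℝ, 0 < K ∧ ∀ L : ℝ, 1 ≤ L → ∃ p : ℕ, p.Prime ∧
    Real.exp (K * L - 3 * Real.exp (-L / 2)) < p ∧ (p : ℝ) ≤ Real.exp (K * L) := by
  refine ⟨10 ^ 13 * 643800, by norm_num, fun L hL => ?_⟩
  by_contra! hcon
  have h := lt_of_no_prime (B := 10 ^ 6 * 643800 * L) (u := 10 ^ 13 * 643800 * L) hL rfl
    (by linarith) (by linarith) (by linarith) fun p hp h1 h2 => (hcon p hp h1).not_ge h2
  have e : 643800 * L / (10 ^ 6 * 643800 * L) = 1 / 10 ^ 6 := by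
    have : L ≠ 0 := by linarith
    field_simp
  rw [e] at h
  linarith

end Rarefaction

namespace Rarefaction

lemma fstep_le_of_prime {n p : ℕ} (hp : p.Prime) (hnp : n < p) : fstep n ≤ p - n := by
  have h : nextprime n ≤ p := Nat.find_min' _ ⟨hnp, hp⟩
  rw [fstep]
  omega

lemma exists_log_fstep_le : ∃ κ : ℝ, 0 < κ ∧ κ < 1 ∧ ∃ N : ℕ, ∀ n ≥ N,
    Real.log (fstep n) ≤ (1 - κ) * Real.log n := by
  obtain ⟨K, hK, hprime⟩ := exists_prime_window
  set κ := 1 / (4 * (K + 1)) with hκ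
  have hκ0 : 0 < κ := by positivity
  have hκ1 : κ < 1 := by
    rw [hκ, div_lt_one (by positivity)]
    linarith
  refine ⟨κ, hκ0, hκ1, ⌈Real.exp (K + 6 / κ)⌉₊, fun n hn => ?_⟩
  have hn1 : Real.exp (K + 6 / κ) ≤ n := Nat.ceil_le.1 hn
  have hn0 : (0 : ℝ) < n := (Real.exp_pos _).trans_le hn1
  set y := Real.log n with hy
  have hyn : Real.exp y = n := Real.exp_log hn0
  have hyK : K + 6 / κ ≤ y := (Real.le_log_iff_exp_le hn0).2 hn1
  have hκy : 6 ≤ κ * y := by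
    have h1 : 6 / κ ≤ y := by linarith
    rw [div_le_iff₀ hκ0] at h1
    linarith
  have hy0 : 0 < y := by
    have : 0 < 6 / κ := by positivity
    linarith
  set t := 3 * Real.exp (-(2 * (κ * y))) with ht
  have ht0 : 0 < t := by positivity
  have h6 : 7 ≤ Real.exp (κ * y) := by linarith [Real.add_one_le_exp (κ * y)]
  have ht6 : 2 * t ≤ Real.exp (-(κ * y)) := by
    have e1 : Real.exp (-(2 * (κ * y))) = Real.exp (-(κ * y)) * Real.exp (-(κ * y)) := by
      rw [← Real.exp_add]; ring_nf
    have e2 : Real.exp (-(κ * y)) * Real.exp (κ * y) = 1 := by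
      rw [← Real.exp_add]; simp
    have e3 := Real.exp_pos (-(κ * y))
    rw [ht, e1]
    nlinarith [mul_le_mul_of_nonneg_left h6 e3.le]
  have ht1 : t ≤ 1 := by
    have : Real.exp (-(κ * y)) ≤ 1 := Real.exp_le_one_iff.2 (by linarith)
    linarith
  have hL : y / K ≤ (y + t) / K := by gcongr; linarith
  obtain ⟨p, hp, hp1, hp2⟩ := hprime ((y + t) / K) (le_trans (by
    rw [le_div_iff₀ hK]
    have : 0 < 6 / κ := by positivity
    linarith) hL)
  rw [mul_div_cancel₀ _ hK.ne'] at hp1 hp2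
  have hexp : 3 * Real.exp (-((y + t) / K) / 2) ≤ t := by
    rw [ht]
    gcongr
    have h1 : 2 * (κ * y) = y / (2 * (K + 1)) := by rw [hκ]; field_simp; norm_num
    have h2 : y / (2 * (K + 1)) ≤ y / K / 2 := by
      rw [div_div]
      exact div_le_div_of_nonneg_left hy0.le (by positivity) (by linarith)
    linarith
  have hnp : (n : ℝ) < p := by
    rw [← hyn]
    exact (Real.exp_le_exp.2 (by linarith)).trans_lt hp1
  have hfs : (fstep n : ℝ) ≤ p - n := by
    have h := fstep_le_of_prime hp (by exact_mod_cast hnp)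
    have h2 : (fstep n : ℝ) + n ≤ p := by
      have : fstep n + n ≤ p := by
        have : n < p := by exact_mod_cast hnp
        omega
      exact_mod_cast this
    linarith
  rcases Nat.eq_zero_or_pos (fstep n) with h0 | h0
  · rw [h0, Nat.cast_zero, Real.log_zero]
    exact mul_nonneg (by linarith) hy0.le
  · rw [Real.log_le_iff_le_exp (by exact_mod_cast h0)]
    have h1 := (abs_le.1 (Real.abs_exp_sub_one_le (x := t) (by rwa [abs_of_pos ht0]))).2
    rw [abs_of_pos ht0] at h1
    rw [Real.exp_add, hyn] at hp2
    have h2 : Real.exp ((1 - κ) * y) = n * Real.exp (-(κ * y)) := by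
      rw [← hyn, ← Real.exp_add]; ring_nf
    rw [h2]
    nlinarith

lemma Rsteps_le_succ (n : ℕ) : Rsteps n ≤ Rsteps (fstep n) + 1 := by
  rcases Set.eq_empty_or_nonempty {k : ℕ | fstep^[k] (fstep n) = 0 ∨ fstep^[k] (fstep n) = 1}
    with h | h
  · have h0 : Rsteps n = 0 := by
      rw [Rsteps, Nat.sInf_eq_zero]
      rcases Set.eq_empty_or_nonempty {k : ℕ | fstep^[k] n = 0 ∨ fstep^[k] n = 1}
        with h1 | ⟨k, hk⟩
      · exact Or.inr h1
      · cases k with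
        | zero => exact Or.inl hk
        | succ k =>
          have : k ∈ {k : ℕ | fstep^[k] (fstep n) = 0 ∨ fstep^[k] (fstep n) = 1} := hk
          rw [h] at this
          exact this.elim
    omega
  · exact Nat.sInf_le (Nat.sInf_mem h)

lemma exists_Rsteps_le : ∃ A c : ℝ, 0 ≤ A ∧ 0 < c ∧ ∃ N : ℕ, ∀ n ≥ N,
    (Rsteps n : ℝ) ≤ A + Real.log (Real.log n) / c := by
  obtain ⟨κ, hκ0, hκ1, N, hN⟩ := exists_log_fstep_le
  set M := max N 3
  have hlog3 : ∀ n : ℕ, M ≤ n → 1 ≤ Real.log n := fun n hn => by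
    have h3 : (3 : ℝ) ≤ n := by exact_mod_cast (le_max_right N 3).trans hn
    rw [Real.le_log_iff_exp_le (by linarith)]
    exact (Real.exp_one_lt_d9.trans (by norm_num)).le.trans h3
  set A := ∑ m ∈ Finset.range M, Rsteps m
  have hc : 0 < -Real.log (1 - κ) :=
    neg_pos.2 (Real.log_neg (by linarith) (by linarith))
  refine ⟨A + 1, -Real.log (1 - κ), by positivity, hc, M, fun n => ?_⟩
  induction n using Nat.strong_induction_on with
  | _ n ih =>
    intro hn
    have hln := hlog3 n hn
    have hstep : (Rsteps n : ℝ) ≤ Rsteps (fstep n) + 1 := by exact_mod_cast Rsteps_le_succ n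
    have hf := hN n ((le_max_left N 3).trans hn)
    rcases lt_or_ge (fstep n) M with hm | hm
    · have h1 : (Rsteps (fstep n) : ℝ) ≤ A := by
        exact_mod_cast Finset.single_le_sum (f := Rsteps) (fun _ _ => Nat.zero_le _)
          (Finset.mem_range.2 hm)
      have h2 : 0 ≤ Real.log (Real.log n) / -Real.log (1 - κ) :=
        div_nonneg (Real.log_nonneg hln) hc.le
      linarith
    · have hlm := hlog3 _ hm
      have hlt : fstep n < n := by
        have h1 : Real.log (fstep n) < Real.log n := by nlinarith
        by_contra! h2
        have h3 : (0 : ℝ) < n := by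
          exact_mod_cast (show 0 < n from lt_of_lt_of_le (by norm_num)
            ((le_max_right N 3).trans hn))
        exact h1.not_ge (Real.log_le_log h3 (by exact_mod_cast h2))
      have h1 := ih _ hlt hm
      have h2 : Real.log (Real.log (fstep n)) ≤ Real.log (1 - κ) + Real.log (Real.log n) := by
        rw [← Real.log_mul (by linarith) (by linarith)]
        exact Real.log_le_log (by linarith) hf
      have h3 : Real.log (Real.log (fstep n)) / -Real.log (1 - κ) ≤
          Real.log (Real.log n) / -Real.log (1 - κ) - 1 := by
        rw [div_le_iff₀ hc, sub_mul, div_mul_cancel₀ _ hc.ne']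
        linarith
      linarith

end Rarefaction

/-- `R(n) = O(log log n)`. -/
theorem rarefaction_stmt8 :
    ∃ (C : ℝ) (N₀ : ℕ), ∀ n : ℕ, N₀ ≤ n →
      (Rsteps n : ℝ) ≤ C * Real.log (Real.log n) := by
  obtain ⟨A, c, hA, hc, N, hN⟩ := Rarefaction.exists_Rsteps_le
  refine ⟨A + 1 / c, max N ⌈Real.exp (Real.exp 1)⌉₊, fun n hn => ?_⟩
  have h1 := hN n ((le_max_left _ _).trans hn)
  have h2 : Real.exp (Real.exp 1) ≤ n := Nat.ceil_le.1 ((le_max_right _ _).trans hn)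
  have hn0 : (0 : ℝ) < n := (Real.exp_pos _).trans_le h2
  have h3 : Real.exp 1 ≤ Real.log n := (Real.le_log_iff_exp_le hn0).2 h2
  have h4 : 1 ≤ Real.log (Real.log n) :=
    (Real.le_log_iff_exp_le ((Real.exp_pos 1).trans_le h3)).2 h3
  calc (Rsteps n : ℝ) ≤ A * 1 + Real.log (Real.log n) / c := by linarith
    _ ≤ A * Real.log (Real.log n) + Real.log (Real.log n) / c := by gcongr
    _ = _ := by ring
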